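/- Let 𝔹 = (B_n)_{n∈ℤ⁺} be a sequence of invertible linear operators on ℝ^d admitting a strong exponential dichotomy with respect to a sequence of norms 𝒮 = (‖·‖_n)_{n∈ℤ⁺}. Suppose Σ_{ED,𝔹,𝒮} = ⋃_{i=1}^r [a_i,b_i] where a_1≤b_1<···<a_k≤b_k<1<a_{k+1}≤b_{k+1}<···<a_r≤b_r, a_{k+1}/b_k > max{b_r, a_1^{-1}}, b_i/a_i < b_k^{-1} for all i=1,…,k, and b_j/a_j < a_{k+1} for all j=k+1,…,r. Let f_n : ℝ^d → ℝ^d, n∈ℤ⁺, be C¹ maps with f_n(0)=0, Df_n(0)=0, ‖Df_n(x)v‖_{n+1} ≤ η‖v‖_n and ‖(Df_n(x)−Df_n(y))v‖_{n+1} ≤ L‖x−y‖_n·‖v‖_n for all x,y,v∈ℝ^d, with constants L,η>0. Then there exists η₀>0 (depending only on the data) such that if η≤η₀, there exists a sequence of C¹-diffeomorphisms h_n : ℝ^d → ℝ^d, n∈ℤ⁺, such that h_{n+1}∘(B_n+f_n) = B_n∘h_n for all n∈ℤ⁺, and there exist M,ρ>0 such that ‖Dh_n(x)v‖_n ≤ M‖v‖_n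 and ‖Dh_n^{-1}(x)v‖_n ≤ M‖v‖_n for all n∈ℤ⁺, all v∈ℝ^d, and all x∈ℝ^d with ‖x‖_n ≤ ρ. -/

import Mathlib

noncomputable section

namespace NonautLin

variable {E : Type*} [NormedAddCommGroup E] [NormedSpace ℝ E]

/-- `N : E → ℝ` is a norm on the real vector space `E`. -/
def IsNormOn (N : E → ℝ) : Prop :=
  (∀ x, 0 ≤ N x) ∧ (∀ x, N x = 0 ↔ x = 0) ∧
  (∀ (c : ℝ) (x : E), N (c • x) = |c| * N x) ∧
  (∀ x y : E, N (x + y) ≤ N x + N y)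

/-- Multiplication by the scalar `c` as a continuous linear equivalence
(junk value `id` for `c = 0`). -/
def smulCLE (c : ℝ) : E ≃L[ℝ] E :=
  if hc : c = 0 then ContinuousLinearEquiv.refl ℝ E
  else
    { toFun := fun x => c • x
      invFun := fun x => c⁻¹ • x
      map_add' := fun x y => smul_add c x y
      map_smul' := fun a x => smul_comm c a x
      left_inv := fun x => by simp [smul_smul, inv_mul_cancel₀ hc]
      right_inv := fun x => by simp [smul_smul, mul_inv_cancel₀ hc]
      continuous_toFun := continuous_const_smul c
      continuous_invFun := continuous_const_smul c⁻¹ }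

/-- The operator `c • A` as a continuous linear equivalence. -/
def scale (c : ℝ) (A : E ≃L[ℝ] E) : E ≃L[ℝ] E := A.trans (smulCLE c)

/-- `fwd A n k` is the composition `A (n+k-1) ∘ ⋯ ∘ A n`. -/
def fwd (A : ℕ → (E ≃L[ℝ] E)) (n : ℕ) : ℕ → (E ≃L[ℝ] E)
  | 0 => ContinuousLinearEquiv.refl ℝ E
  | k + 1 => (fwd A n k).trans (A (n + k))

/-- The cocycle `𝒜(m,n)` associated with the one-sided sequence `A`:
`𝒜(m,n) = A (m-1) ∘ ⋯ ∘ A n` for `m > n`, `𝒜(n,n) = Id`, and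
`𝒜(m,n) = (𝒜(n,m))⁻¹` for `m < n`. -/
def coc (A : ℕ → (E ≃L[ℝ] E)) (m n : ℕ) : E ≃L[ℝ] E :=
  if n ≤ m then fwd A n (m - n) else (fwd A m (n - m)).symm

/-- Strong exponential dichotomy, over `ℤ⁺`, with respect to a sequence of norms and a
given sequence of projections. -/
def StrongExpDichotomyWRTProj (B : ℕ → (E ≃L[ℝ] E)) (N : ℕ → E → ℝ)
    (P : ℕ → (E →L[ℝ] E)) : Prop :=
  ∃ K lam a : ℝ, 0 < K ∧ 0 < lam ∧ lam ≤ a ∧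
    (∀ n, (P n).comp (P n) = P n) ∧
    (∀ n, ((B n : E →L[ℝ] E)).comp (P n) = (P (n + 1)).comp (B n : E →L[ℝ] E)) ∧
    (∀ m n : ℕ, n ≤ m → ∀ x : E,
      N m (coc B m n (P n x)) ≤ K * Real.exp (-lam * ((m : ℝ) - n)) * N n x ∧
      N n (coc B n m (x - P m x)) ≤ K * Real.exp (-lam * ((m : ℝ) - n)) * N m x ∧
      N m (coc B m n x) ≤ K * Real.exp (a * ((m : ℝ) - n)) * N n x ∧
      N n (coc B n m x) ≤ K * Real.exp (a * ((m : ℝ) - n)) * N m x)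

/-- Strong exponential dichotomy, over `ℤ⁺`, with respect to a sequence of norms. -/
def StrongExpDichotomyWRT (B : ℕ → (E ≃L[ℝ] E)) (N : ℕ → E → ℝ) : Prop :=
  ∃ P : ℕ → (E →L[ℝ] E), StrongExpDichotomyWRTProj B N P

/-- The exponential dichotomy spectrum over `ℤ⁺`: the set of `τ > 0` such that
`((1/τ) B_n)` does not admit a strong exponential dichotomy w.r.t. the norms `N`. -/
def SigmaED (B : ℕ → (E ≃L[ℝ] E)) (N : ℕ → E → ℝ) : Set ℝ :=
  {τ | 0 < τ ∧ ¬ StrongExpDichotomyWRT (fun n => scale τ⁻¹ (B n)) N}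

open Set Filter Topology

section Seminorms
variable {G : Type*} [NormedAddCommGroup G] [NormedSpace ℝ G]

/-- A supporting functional of a seminorm at a vector. -/
theorem exists_supporting_functional (p : Seminorm ℝ G) (v : G) :
    ∃ φ : G →ₗ[ℝ] ℝ, φ v = p v ∧ ∀ x, φ x ≤ p x := by
  by_cases hv : v = 0
  · exact ⟨0, by simp [hv], fun x => by simp⟩
  obtain ⟨g, hg, hle⟩ := exists_extension_of_le_sublinear
    (LinearPMap.mkSpanSingleton v (p v) hv) p
    (fun c hc x => by rw [map_smul_eq_mul, Real.norm_eq_abs, abs_of_pos hc]) (map_add_le_add p)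
    (by
      rintro ⟨x, hx⟩
      obtain ⟨c, rfl⟩ := Submodule.mem_span_singleton.1 hx
      rw [LinearPMap.mkSpanSingleton'_apply]
      rw [map_smul_eq_mul, smul_eq_mul, Real.norm_eq_abs]
      exact mul_le_mul_of_nonneg_right (le_abs_self c) (apply_nonneg p v))
  refine ⟨g, ?_, hle⟩
  have := hg ⟨v, Submodule.mem_span_singleton_self v⟩
  rw [this]
  exact LinearPMap.mkSpanSingleton_apply ℝ _ hv (p v)

/-- Every seminorm on a finite-dimensional space is bounded by a multiple of the norm. -/
theorem exists_seminorm_le_norm [FiniteDimensional ℝ G] (p : Seminorm ℝ G) :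
    ∃ C : ℝ, 0 < C ∧ ∀ x, p x ≤ C * ‖x‖ := by
  let b := Module.finBasis ℝ G
  let l : G →L[ℝ] (Fin (Module.finrank ℝ G) → ℝ) :=
    LinearMap.toContinuousLinearMap (b.equivFun : G →ₗ[ℝ] _)
  refine ⟨∑ i, ‖l‖ * p (b i) + 1, by positivity, fun x => ?_⟩
  calc p x = p (∑ i, l x i • b i) := by
        congr 1; exact (b.sum_equivFun x).symm
    _ ≤ ∑ i, p (l x i • b i) :=
        Finset.le_sum_of_subadditive p (map_zero p).le (map_add_le_add p) _ _
    _ ≤ ∑ i, ‖l‖ * p (b i) * ‖x‖ := by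
        refine Finset.sum_le_sum fun i _ => ?_
        rw [map_smul_eq_mul]
        have h1 : ‖l x i‖ ≤ ‖l‖ * ‖x‖ := (norm_le_pi_norm (l x) i).trans (l.le_opNorm x)
        have := mul_le_mul_of_nonneg_right h1 (apply_nonneg p (b i))
        linarith
    _ ≤ _ := by rw [← Finset.sum_mul, add_mul]; linarith [norm_nonneg x]

theorem seminorm_continuous [FiniteDimensional ℝ G] (p : Seminorm ℝ G) : Continuous p := by
  obtain ⟨C, hC, h⟩ := exists_seminorm_le_norm p
  have : LipschitzWith ⟨C, hC.le⟩ p := by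
    refine LipschitzWith.of_dist_le_mul fun x y => ?_
    rw [Real.dist_eq, dist_eq_norm]
    exact (abs_sub_map_le_sub p x y).trans (h _)
  exact this.continuous

/-- A positive definite seminorm on a finite-dimensional space dominates the norm. -/
theorem exists_norm_le_seminorm [FiniteDimensional ℝ G] (p : Seminorm ℝ G)
    (hp : ∀ x, p x = 0 → x = 0) : ∃ C : ℝ, 0 < C ∧ ∀ x, ‖x‖ ≤ C * p x := by
  by_cases hne : (Metric.sphere (0 : G) 1).Nonempty
  · obtain ⟨z, hz, hmin⟩ := (isCompact_sphere (0 : G) 1).exists_isMinOn hne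
      (seminorm_continuous p).continuousOn
    have hz1 : ‖z‖ = 1 := by simpa using hz
    have hpz : 0 < p z := by
      refine lt_of_le_of_ne (apply_nonneg p z) fun h => ?_
      rw [hp z h.symm] at hz1; simp at hz1
    refine ⟨(p z)⁻¹, inv_pos.2 hpz, fun x => ?_⟩
    by_cases hx : x = 0
    · simp [hx]
    have hx' : 0 < ‖x‖ := norm_pos_iff.2 hx
    have h1 : p z ≤ p (‖x‖⁻¹ • x) := hmin (by simp [norm_smul, hx'.ne'])
    rw [map_smul_eq_mul, norm_inv, norm_norm] at h1
    rw [inv_mul_eq_div, le_div_iff₀ hpz]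
    rw [inv_mul_eq_div, le_div_iff₀ hx'] at h1
    linarith
  · refine ⟨1, one_pos, fun x => ?_⟩
    by_cases hx : x = 0
    · simp [hx]
    exact absurd ⟨‖x‖⁻¹ • x, by simp [norm_smul, hx]⟩ hne

/-- Mean value inequality with respect to a seminorm. -/
theorem seminorm_image_sub_le [FiniteDimensional ℝ G] (p : Seminorm ℝ G) {g : E → G}
    {g' : E → E →L[ℝ] G} (hg : ∀ x, HasFDerivAt g (g' x) x) {C : ℝ} (x y : E)
    (h : ∀ t ∈ Icc (0 : ℝ) 1, p (g' (x + t • (y - x)) (y - x)) ≤ C) :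
    p (g y - g x) ≤ C := by
  obtain ⟨φ, hφ, hle⟩ := exists_supporting_functional p (g y - g x)
  let ψ : G →L[ℝ] ℝ := LinearMap.toContinuousLinearMap φ
  have hd : ∀ t : ℝ, HasDerivAt (fun t : ℝ => ψ (g (x + t • (y - x))))
      (ψ (g' (x + t • (y - x)) (y - x))) t := by
    intro t
    have h1 : HasDerivAt (fun t : ℝ => x + t • (y - x)) (y - x) t := by
      simpa using ((hasDerivAt_id t).smul_const (y - x)).const_add x
    have h2 := (hg (x + t • (y - x))).comp_hasDerivAt t h1
    exact ψ.hasFDerivAt.comp_hasDerivAt t h2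
  obtain ⟨t, ht, hte⟩ := exists_hasDerivAt_eq_slope _ _ (zero_lt_one' ℝ)
    (fun t _ => (hd t).continuousAt.continuousWithinAt) (fun t _ => hd t)
  have h3 : ψ (g' (x + t • (y - x)) (y - x)) = φ (g y - g x) := by
    rw [hte, map_sub]; simp [ψ]
  rw [← hφ, ← h3]
  exact (hle _).trans (h t ⟨ht.1.le, ht.2.le⟩)

theorem tendsto_line (x v : E) : Tendsto (fun t : ℝ => x + t • v) (𝓝[≠] 0) (𝓝 x) := by
  have : ContinuousAt (fun t : ℝ => x + t • v) 0 := by fun_prop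
  have h4 : Tendsto (fun t : ℝ => x + t • v) (𝓝 0) (𝓝 x) := by
    simpa [ContinuousAt] using this
  exact h4.mono_left nhdsWithin_le_nhds

/-- The derivative inherits a local Lipschitz bound between seminorms. -/
theorem seminorm_fderiv_le [FiniteDimensional ℝ G] (p : Seminorm ℝ E)
    (q : Seminorm ℝ G) {g : E → G} {g' : E →L[ℝ] G} {x : E} (hg : HasFDerivAt g g' x) {C : ℝ}
    (h : ∀ᶠ y in 𝓝 x, q (g y - g x) ≤ C * p (y - x)) (v : E) : q (g' v) ≤ C * p v := by
  have h3 := ((seminorm_continuous q).tendsto _).comp (hg.hasLineDerivAt v).tendsto_slope_zero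
  refine le_of_tendsto h3 ?_
  filter_upwards [(tendsto_line x v).eventually h, self_mem_nhdsWithin] with t ht ht0
  have ht0' : 0 < |t| := abs_pos.2 ht0
  simp only [Function.comp]
  rw [map_smul_eq_mul, norm_inv, Real.norm_eq_abs, inv_mul_le_iff₀ ht0']
  refine ht.trans (le_of_eq ?_)
  rw [add_sub_cancel_left, map_smul_eq_mul, Real.norm_eq_abs]; ring

theorem fderiv_injective_of_lower_lipschitz {g : E → G} {g' : E →L[ℝ] G} {x : E}
    (hg : HasFDerivAt g g' x) {C : ℝ}
    (h : ∀ᶠ y in 𝓝 x, ‖y - x‖ ≤ C * ‖g y - g x‖) : Function.Injective g' := by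
  rw [injective_iff_map_eq_zero]
  intro v hv
  have h2 := (hg.hasLineDerivAt v).tendsto_slope_zero
  rw [hv] at h2
  have h3 : Tendsto (fun t : ℝ => C * ‖t⁻¹ • (g (x + t • v) - g x)‖) (𝓝[≠] 0) (𝓝 0) := by
    simpa using h2.norm.const_mul C
  have h5 : ‖v‖ ≤ 0 := by
    refine ge_of_tendsto h3 ?_
    filter_upwards [(tendsto_line x v).eventually h, self_mem_nhdsWithin] with t ht ht0
    have ht0' : 0 < |t| := abs_pos.2 ht0
    rw [add_sub_cancel_left, norm_smul, Real.norm_eq_abs] at ht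
    rw [norm_smul, norm_inv, Real.norm_eq_abs]
    have : ‖v‖ = |t|⁻¹ * (|t| * ‖v‖) := by field_simp
    rw [this]
    calc _ ≤ |t|⁻¹ * (C * ‖g (x + t • v) - g x‖) := by gcongr
      _ = _ := by ring
  exact norm_le_zero_iff.1 h5

theorem exists_hasStrictFDerivAt_equiv [FiniteDimensional ℝ E] {g : E → E}
    (hg : ContDiff ℝ 1 g)
    (h : ∀ x, ∃ C : ℝ, ∀ᶠ y in 𝓝 x, ‖y - x‖ ≤ C * ‖g y - g x‖) :
    ∃ A : E → (E ≃L[ℝ] E), ∀ x, HasStrictFDerivAt g (A x : E →L[ℝ] E) x := by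
  have hinj : ∀ x, Function.Injective (fderiv ℝ g x) := fun x => by
    obtain ⟨C, hC⟩ := h x
    exact fderiv_injective_of_lower_lipschitz
      (hg.differentiable one_ne_zero x).hasFDerivAt hC
  refine ⟨fun x => (LinearEquiv.ofInjectiveEndo (fderiv ℝ g x : E →ₗ[ℝ] E)
    (hinj x)).toContinuousLinearEquiv, fun x => ?_⟩
  convert hg.contDiffAt.hasStrictFDerivAt one_ne_zero using 1
  ext v; rfl

/-- A `C¹` bijection with locally Lipschitz inverse estimate has a `C¹` inverse. -/
theorem contDiff_symm_of_lower_lipschitz [FiniteDimensional ℝ E] (g : E ≃ E)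
    (hg : ContDiff ℝ 1 g)
    (h : ∀ x, ∃ C : ℝ, ∀ᶠ y in 𝓝 x, ‖y - x‖ ≤ C * ‖g y - g x‖) :
    ContDiff ℝ 1 g.symm := by
  have : CompleteSpace E := FiniteDimensional.complete ℝ E
  obtain ⟨A, hder⟩ := exists_hasStrictFDerivAt_equiv hg h
  have hopen : IsOpenMap g := isOpenMap_of_hasStrictFDerivAt_equiv hder
  let e : E ≃ₜ E := g.toHomeomorphOfContinuousOpen hg.continuous hopen
  exact e.contDiff_symm (f₀' := A) (fun x => (hder x).hasFDerivAt) hg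

/-- A `C¹` self-map of a finite-dimensional space that is globally expanding up to a constant
is surjective. -/
theorem surjective_of_lower_lipschitz [FiniteDimensional ℝ E] {g : E → E}
    (hg : ContDiff ℝ 1 g) {C : ℝ} (h : ∀ x y, ‖y - x‖ ≤ C * ‖g y - g x‖) :
    Function.Surjective g := by
  have : CompleteSpace E := FiniteDimensional.complete ℝ E
  obtain ⟨A, hder⟩ := exists_hasStrictFDerivAt_equiv hg
    (fun x => ⟨C, Eventually.of_forall (h x)⟩)
  have hopen : IsOpenMap g := isOpenMap_of_hasStrictFDerivAt_equiv hder
  have hC : ∀ x y, ‖y - x‖ ≤ |C| * ‖g y - g x‖ := fun x y => (h x y).trans (by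
    gcongr; exact le_abs_self C)
  have hclosed : IsClosed (range g) := by
    refine IsSeqClosed.isClosed fun u z hu hz => ?_
    choose x hx using hu
    have hcau : CauchySeq x := by
      have hcu : CauchySeq u := hz.cauchySeq
      rw [Metric.cauchySeq_iff] at hcu ⊢
      intro ε hε
      obtain ⟨N, hN⟩ := hcu (ε / (|C| + 1)) (by positivity)
      refine ⟨N, fun m hm n hn => ?_⟩
      have h1 := hN m hm n hn
      rw [dist_eq_norm] at h1 ⊢
      rw [lt_div_iff₀ (by positivity)] at h1
      have h2 := hC (x n) (x m)
      rw [hx, hx] at h2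
      nlinarith [norm_nonneg (u m - u n)]
    obtain ⟨y, hy⟩ := cauchySeq_tendsto_of_complete hcau
    refine ⟨y, tendsto_nhds_unique ((hg.continuous.tendsto y).comp hy) ?_⟩
    convert hz using 1
    ext n; exact hx n
  have := IsClopen.eq_univ ⟨hclosed, hopen.isOpen_range⟩ (range_nonempty g)
  exact range_eq_univ.1 this

/-- A map close to the identity on a ball covers a smaller ball. -/
theorem exists_preimage_of_near_id [FiniteDimensional ℝ E] (p : Seminorm ℝ E)
    (hp : ∀ x, p x = 0 → x = 0) {g : E → E} (hg : Continuous g) (h0 : g 0 = 0) {ρ : ℝ}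
    (h : ∀ x y, p x ≤ ρ → p y ≤ ρ → p (g y - g x - (y - x)) ≤ 1 / 2 * p (y - x))
    {s : E} (hs : p s ≤ ρ / 2) : ∃ x, p x ≤ ρ ∧ g x = s := by
  have hρ : 0 ≤ ρ := by linarith [apply_nonneg p s]
  have hpc := seminorm_continuous p
  obtain ⟨C, hC, hCp⟩ := exists_norm_le_seminorm p hp
  have hcomp : IsCompact {x | p x ≤ ρ} := by
    have : ProperSpace E := FiniteDimensional.proper_real E
    refine (isCompact_closedBall (0 : E) (C * ρ)).of_isClosed_subset
      (isClosed_le hpc continuous_const) fun x hx => ?_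
    rw [mem_closedBall_zero_iff]
    exact (hCp x).trans (by gcongr; exact hx)
  obtain ⟨x, hx, hmin⟩ := hcomp.exists_isMinOn ⟨0, by simpa using hρ⟩
    (f := fun x => p (g x - s)) (by fun_prop)
  refine ⟨x, hx, ?_⟩
  have hx' : p x ≤ ρ := hx
  have e1 : p (x + (s - g x)) ≤ ρ := by
    have h1 := h 0 x (by simpa using hρ) hx'
    rw [h0, sub_zero, sub_zero] at h1
    have : x + (s - g x) = s - (g x - x) := by abel
    rw [this]
    linarith [map_sub_le_add p s (g x - x)]
  have e2 := h x _ hx' e1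
  have e3 : p (g x - s) ≤ p (g (x + (s - g x)) - s) := hmin e1
  have e4 : g (x + (s - g x)) - g x - (x + (s - g x) - x) = g (x + (s - g x)) - s := by abel
  rw [e4, add_sub_cancel_left, map_sub_rev p s] at e2
  have e5 : p (g x - s) = 0 := by linarith [apply_nonneg p (g x - s)]
  exact sub_eq_zero.1 (hp _ e5)

end Seminorms

section Implicit
variable {G : Type*} [NormedAddCommGroup G] [NormedSpace ℝ G]
variable {F : Type*} [NormedAddCommGroup F] [NormedSpace ℝ F]
  {H : Type*} [NormedAddCommGroup H] [NormedSpace ℝ H]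

theorem HasStrictFDerivAt.tendsto_scaled {g : E → G} {g' : E →L[ℝ] G} {x : E}
    (hg : HasStrictFDerivAt g g' x) {ι : Type*} {l : Filter ι} {a b : ι → E} {r : ι → ℝ} {e : E}
    (ha : Tendsto a l (𝓝 x)) (hb : Tendsto b l (𝓝 x))
    (he : Tendsto (fun i => (r i)⁻¹ • (b i - a i)) l (𝓝 e)) :
    Tendsto (fun i => (r i)⁻¹ • (g (b i) - g (a i))) l (𝓝 (g' e)) := by
  have h1 := hg.isLittleO.comp_tendsto (hb.prodMk_nhds ha)
  have h2 : (fun i => (r i)⁻¹ • (g (b i) - g (a i) - g' (b i - a i))) =o[l]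
      fun i => (r i)⁻¹ • (b i - a i) :=
    (Asymptotics.isBigO_refl (fun i => (r i)⁻¹) l).smul_isLittleO h1
  have h3 := h2.trans_isBigO (he.isBigO_one ℝ)
  have h4 := (Asymptotics.isLittleO_one_iff ℝ).1 h3
  have h5 := h4.add ((g'.continuous.tendsto e).comp he)
  simp only [zero_add] at h5
  refine h5.congr fun i => ?_
  simp only [Function.comp, map_smul, ← smul_add]
  congr 1; abel

theorem Ultrafilter.exists_tendsto_of_bounded [FiniteDimensional ℝ E] {ι : Type*}
    (U : Ultrafilter ι) {z : ι → E} {C : ℝ} (h : ∀ᶠ i in (U : Filter ι), ‖z i‖ ≤ C) :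
    ∃ w, Tendsto z U (𝓝 w) := by
  have : ProperSpace E := FiniteDimensional.proper_real E
  obtain ⟨w, -, hw⟩ := (isCompact_closedBall (0 : E) C).ultrafilter_le_nhds' (U.map z)
    (by
      change ∀ᶠ i in (U : Filter ι), z i ∈ Metric.closedBall (0 : E) C
      filter_upwards [h] with i hi using by simpa using hi)
  exact ⟨w, hw⟩

theorem contDiff_one_of_hasStrictFDerivAt {y : E → F} {D : E → E →L[ℝ] F}
    (h : ∀ x, HasStrictFDerivAt y (D x) x) : ContDiff ℝ 1 y := by
  rw [contDiff_one_iff_fderiv]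
  refine ⟨fun x => (h x).hasFDerivAt.differentiableAt, ?_⟩
  have hD : fderiv ℝ y = D := funext fun x => (h x).hasFDerivAt.fderiv
  rw [hD, continuous_iff_continuousAt]
  intro x
  rw [Metric.continuousAt_iff]
  intro ε hε
  have h1 := (h x).isLittleO.def (half_pos hε)
  rw [nhds_prod_eq, eventually_prod_self_iff'] at h1
  obtain ⟨t, ht, hball⟩ := h1
  obtain ⟨δ, hδ, hsub⟩ := Metric.mem_nhds_iff.1 ht
  refine ⟨δ, hδ, fun {z} hz => ?_⟩
  rw [dist_eq_norm]
  refine lt_of_le_of_lt ?_ (half_lt_self hε)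
  have hder : HasFDerivAt (fun w => y w - D x w) (D z - D x) z :=
    (h z).hasFDerivAt.sub (D x).hasFDerivAt
  have hlip : LipschitzOnWith ⟨ε / 2, by positivity⟩ (fun w => y w - D x w) (Metric.ball x δ) := by
    refine LipschitzOnWith.of_dist_le_mul fun a ha b hb => ?_
    have := hball a (hsub ha) b (hsub hb)
    rw [dist_eq_norm, dist_eq_norm]
    simp only [map_sub] at this
    rw [sub_sub_sub_comm]
    exact this
  exact hder.le_of_lipschitzOn (Metric.isOpen_ball.mem_nhds hz) hlip

variable [FiniteDimensional ℝ E] [FiniteDimensional ℝ F] [FiniteDimensional ℝ G]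
  [FiniteDimensional ℝ H]

/-- A map that is locally Lipschitz and determined by infinitely many implicit relations whose
linearization has unique solutions is `C¹`. -/
theorem contDiff_of_implicit {y : E → F} {T : ℕ → F → G} {X : ℕ → E → G}
    {ν : ℕ → Seminorm ℝ G} {c : ℕ → ℝ} (hc : ∀ j, 0 ≤ c j) {R : F →L[ℝ] H} {ξ : E → H}
    (hT : ∀ j, ContDiff ℝ 1 (T j)) (hX : ∀ j, ContDiff ℝ 1 (X j)) (hξ : ContDiff ℝ 1 ξ)
    (hR : ∀ θ, R (y θ) = ξ θ)
    (hlip : ∀ ρ : ℝ, ∃ C : ℝ, ∀ θ θ', ‖θ‖ ≤ ρ → ‖θ'‖ ≤ ρ →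
      ‖y θ' - y θ‖ ≤ C * ‖θ' - θ‖)
    (hrel : ∀ ρ : ℝ, ∃ C : ℝ, ∀ j θ θ', ‖θ‖ ≤ ρ → ‖θ'‖ ≤ ρ →
      ν j (T j (y θ') - T j (y θ) - (X j θ' - X j θ)) ≤ C * c j * ‖θ' - θ‖)
    (huniq : ∀ θ w, R w = 0 → (∃ C : ℝ, ∀ j, ν j (fderiv ℝ (T j) (y θ) w) ≤ C * c j) → w = 0) :
    ContDiff ℝ 1 y := by
  suffices h : ∀ θ₀, ∃ D : E →L[ℝ] F, HasStrictFDerivAt y D θ₀ by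
    choose D hD using h
    exact contDiff_one_of_hasStrictFDerivAt hD
  intro θ₀
  obtain ⟨C₁, hC₁⟩ := hlip (‖θ₀‖ + 1)
  obtain ⟨C₂, hC₂⟩ := hrel (‖θ₀‖ + 1)
  have hnear : ∀ᶠ θ in 𝓝 θ₀, ‖θ‖ ≤ ‖θ₀‖ + 1 := by
    have : Tendsto (fun θ : E => ‖θ‖) (𝓝 θ₀) (𝓝 ‖θ₀‖) := continuous_norm.tendsto θ₀
    exact this.eventually_le_const (by linarith)
  have hycont : ContinuousAt y θ₀ := by
    have h1 : Tendsto (fun θ => C₁ * ‖θ - θ₀‖) (𝓝 θ₀) (𝓝 0) := by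
      have : ContinuousAt (fun θ => C₁ * ‖θ - θ₀‖) θ₀ := by fun_prop
      simpa [ContinuousAt] using this
    rw [ContinuousAt, tendsto_iff_norm_sub_tendsto_zero]
    refine squeeze_zero' (Eventually.of_forall fun _ => norm_nonneg _) ?_ h1
    filter_upwards [hnear] with θ hθ
    exact hC₁ θ₀ θ (by linarith) hθ
  let Rel : E → F → Prop := fun e w => R w = fderiv ℝ ξ θ₀ e ∧
    ∃ C : ℝ, ∀ j, ν j (fderiv ℝ (T j) (y θ₀) w - fderiv ℝ (X j) θ₀ e) ≤ C * c j
  have relu : ∀ e w w', Rel e w → Rel e w' → w = w' := by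
    rintro e w w' ⟨h1, C, hC⟩ ⟨h2, C', hC'⟩
    refine sub_eq_zero.1 (huniq θ₀ _ (by rw [map_sub, h1, h2, sub_self]) ⟨C + C', fun j => ?_⟩)
    have := map_sub_le_add (ν j) (fderiv ℝ (T j) (y θ₀) w - fderiv ℝ (X j) θ₀ e)
      (fderiv ℝ (T j) (y θ₀) w' - fderiv ℝ (X j) θ₀ e)
    rw [sub_sub_sub_cancel_right, ← map_sub] at this
    linarith [hC j, hC' j]
  have sublim : ∀ (U : Ultrafilter (E × E × ℝ)) (a b : E × E × ℝ → E) (r : E × E × ℝ → ℝ) (e : E),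
      Tendsto a U (𝓝 θ₀) → Tendsto b U (𝓝 θ₀) → (∀ᶠ i in (U : Filter (E × E × ℝ)), 0 < r i) →
      Tendsto (fun i => (r i)⁻¹ • (b i - a i)) U (𝓝 e) →
      ∃ w, Tendsto (fun i => (r i)⁻¹ • (y (b i) - y (a i))) U (𝓝 w) ∧ Rel e w := by
    intro U a b r e ha hb hr he
    have hen : ∀ᶠ i in (U : Filter (E × E × ℝ)), ‖(r i)⁻¹ • (b i - a i)‖ ≤ ‖e‖ + 1 :=
      he.norm.eventually_le_const (by linarith)
    obtain ⟨w, hw⟩ := Ultrafilter.exists_tendsto_of_bounded U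
      (z := fun i => (r i)⁻¹ • (y (b i) - y (a i))) (C := |C₁| * (‖e‖ + 1)) (by
        filter_upwards [hen, hr, ha.eventually hnear, hb.eventually hnear] with i h1 h2 h3 h4
        have h5 := hC₁ _ _ h3 h4
        rw [norm_smul, norm_inv, Real.norm_eq_abs, abs_of_pos h2] at h1 ⊢
        calc _ ≤ (r i)⁻¹ * (|C₁| * ‖b i - a i‖) := by
              gcongr; exact h5.trans (by gcongr; exact le_abs_self _)
          _ = |C₁| * ((r i)⁻¹ * ‖b i - a i‖) := by ring
          _ ≤ _ := by gcongr)
    refine ⟨w, hw, ?_, |C₂| * (‖e‖ + 1), ?_⟩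
    · have h1 := HasStrictFDerivAt.tendsto_scaled (hξ.contDiffAt.hasStrictFDerivAt one_ne_zero)
        ha hb he
      refine tendsto_nhds_unique ((R.continuous.tendsto w).comp hw) (h1.congr fun i => ?_)
      simp only [Function.comp, map_smul, map_sub, hR]
    · intro j
      have h1 := HasStrictFDerivAt.tendsto_scaled
        ((hT j).contDiffAt.hasStrictFDerivAt one_ne_zero) (hycont.tendsto.comp ha)
        (hycont.tendsto.comp hb) hw
      have h2 := HasStrictFDerivAt.tendsto_scaled
        ((hX j).contDiffAt.hasStrictFDerivAt one_ne_zero) ha hb he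
      refine le_of_tendsto (((seminorm_continuous (ν j)).tendsto _).comp (h1.sub h2)) ?_
      filter_upwards [hen, hr, ha.eventually hnear, hb.eventually hnear] with i g1 g2 g3 g4
      have g5 := hC₂ j _ _ g3 g4
      simp only [Function.comp]
      rw [← smul_sub, map_smul_eq_mul]
      rw [norm_smul, norm_inv, Real.norm_eq_abs, abs_of_pos g2] at g1
      rw [norm_inv, Real.norm_eq_abs, abs_of_pos g2]
      calc _ ≤ (r i)⁻¹ * (|C₂| * c j * ‖b i - a i‖) := by
            gcongr
            refine g5.trans ?_
            have := hc j
            gcongr; exact le_abs_self _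
        _ = |C₂| * ((r i)⁻¹ * ‖b i - a i‖) * c j := by ring
        _ ≤ _ := by have := hc j; gcongr
  have relex : ∀ e, ∃ w, Rel e w := by
    intro e
    let U : Ultrafilter (E × E × ℝ) :=
      (Ultrafilter.of (𝓝[>] (0 : ℝ))).map fun t => (θ₀, θ₀ + t • e, t)
    have hU : ∀ {s : E × E × ℝ → Prop}, (∀ᶠ t in 𝓝[>] (0 : ℝ), s (θ₀, θ₀ + t • e, t)) →
        ∀ᶠ i in (U : Filter (E × E × ℝ)), s i := fun h => Ultrafilter.of_le _ h
    obtain ⟨w, -, hw⟩ := sublim U (fun p => p.1) (fun p => p.2.1) (fun p => p.2.2) e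
      (by
        refine tendsto_const_nhds.congr' ?_
        exact hU (s := fun i => θ₀ = i.1) (Eventually.of_forall fun t => rfl))
      (by
        have h1 : Tendsto (fun t : ℝ => θ₀ + t • e) (𝓝[>] 0) (𝓝 θ₀) :=
          (tendsto_line θ₀ e).mono_left (nhdsWithin_mono _ fun t ht => ne_of_gt ht)
        exact h1.mono_left (Ultrafilter.of_le _))
      (hU (s := fun i => 0 < i.2.2) self_mem_nhdsWithin)
      (by
        refine tendsto_const_nhds.congr' (hU (s := fun i => e = (i.2.2)⁻¹ • (i.2.1 - i.1)) ?_)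
        filter_upwards [self_mem_nhdsWithin] with t ht
        have ht' : t ≠ 0 := ne_of_gt ht
        simp [smul_smul, ht'])
    exact ⟨w, hw⟩
  choose D hD using relex
  have hadd : ∀ e e', D (e + e') = D e + D e' := by
    intro e e'
    obtain ⟨h1, C, hC⟩ := hD e
    obtain ⟨h2, C', hC'⟩ := hD e'
    refine relu (e + e') _ _ (hD _) ⟨by rw [map_add, map_add, h1, h2], C + C', fun j => ?_⟩
    rw [map_add, map_add, add_sub_add_comm]
    linarith [map_add_le_add (ν j) (fderiv ℝ (T j) (y θ₀) (D e) - fderiv ℝ (X j) θ₀ e)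
      (fderiv ℝ (T j) (y θ₀) (D e') - fderiv ℝ (X j) θ₀ e'), hC j, hC' j]
  have hsmul : ∀ (a : ℝ) e, D (a • e) = a • D e := by
    intro a e
    obtain ⟨h1, C, hC⟩ := hD e
    refine relu (a • e) _ _ (hD _) ⟨by rw [map_smul, map_smul, h1], |a| * C, fun j => ?_⟩
    rw [map_smul, map_smul, ← smul_sub, map_smul_eq_mul, Real.norm_eq_abs, mul_assoc]
    exact mul_le_mul_of_nonneg_left (hC j) (abs_nonneg a)
  let D' : E →L[ℝ] F := LinearMap.toContinuousLinearMap
    { toFun := D, map_add' := hadd, map_smul' := hsmul }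
  refine ⟨D', ?_⟩
  refine .of_isLittleO (Asymptotics.isLittleO_iff.2 fun ε hε => ?_)
  by_contra hbad
  rw [not_eventually] at hbad
  have hne : (𝓝 (θ₀, θ₀) ⊓ 𝓟 {p : E × E |
      ¬ ‖y p.1 - y p.2 - D' (p.1 - p.2)‖ ≤ ε * ‖p.1 - p.2‖}).NeBot :=
    frequently_mem_iff_neBot.1 hbad
  let V := Ultrafilter.of (𝓝 (θ₀, θ₀) ⊓ 𝓟 {p : E × E |
      ¬ ‖y p.1 - y p.2 - D' (p.1 - p.2)‖ ≤ ε * ‖p.1 - p.2‖})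
  have hV1 : (V : Filter (E × E)) ≤ 𝓝 (θ₀, θ₀) := (Ultrafilter.of_le _).trans inf_le_left
  have hV2 : ∀ᶠ p in (V : Filter (E × E)),
      ε * ‖p.1 - p.2‖ < ‖y p.1 - y p.2 - D' (p.1 - p.2)‖ := by
    have : {p : E × E | ¬ ‖y p.1 - y p.2 - D' (p.1 - p.2)‖ ≤ ε * ‖p.1 - p.2‖} ∈
        (V : Filter (E × E)) := (Ultrafilter.of_le _).trans inf_le_right (mem_principal_self _)
    filter_upwards [this] with p hp using not_le.1 hp
  have hV3 : ∀ᶠ p in (V : Filter (E × E)), 0 < ‖p.1 - p.2‖ := by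
    filter_upwards [hV2] with p hp
    rw [norm_pos_iff, sub_ne_zero]
    intro h
    simp [h] at hp
  obtain ⟨e, he⟩ := Ultrafilter.exists_tendsto_of_bounded V
    (z := fun p => ‖p.1 - p.2‖⁻¹ • (p.1 - p.2)) (C := 1) (by
      filter_upwards [hV3] with p hp
      rw [norm_smul, norm_inv, norm_norm, inv_mul_cancel₀ hp.ne'])
  obtain ⟨w, hw, hrel⟩ := sublim (V.map fun p : E × E => (p.2, p.1, ‖p.1 - p.2‖)) (fun p => p.1)
    (fun p => p.2.1) (fun p => p.2.2) e
    ((continuous_snd.tendsto (θ₀, θ₀)).mono_left hV1)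
    ((continuous_fst.tendsto (θ₀, θ₀)).mono_left hV1) hV3 he
  have hw' : Tendsto (fun p : E × E => ‖p.1 - p.2‖⁻¹ • (y p.1 - y p.2)) V (𝓝 w) := hw
  have hwe : w = D' e := relu e _ _ hrel (hD e)
  have h1 := (hw'.sub ((D'.continuous.tendsto e).comp he)).norm
  rw [hwe, sub_self, norm_zero] at h1
  obtain ⟨p, hp1, hp2, hp3⟩ := ((h1.eventually_lt_const hε).and (hV2.and hV3)).exists
  simp only [Function.comp, map_smul, ← smul_sub, norm_smul, norm_inv, norm_norm] at hp1
  rw [inv_mul_lt_iff₀ hp3, mul_comm] at hp1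
  linarith
end Implicit

/-- A nonautonomous perturbation of the identity, measured in moving norms, together with a
filtration by projections having prescribed growth rates. -/
structure Sys (E : Type*) [NormedAddCommGroup E] [NormedSpace ℝ E] where
  N : ℕ → Seminorm ℝ E
  pos : ∀ n x, N n x = 0 → x = 0
  f : ℕ → E → E
  contDiff_f : ∀ n, ContDiff ℝ 1 (f n)
  f_zero : ∀ n, f n 0 = 0
  fderiv_zero : ∀ n, fderiv ℝ (f n) 0 = 0
  η : ℝ
  L : ℝ
  δ : ℝ
  η_nonneg : 0 ≤ η
  L_nonneg : 0 ≤ L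
  δ_pos : 0 < δ
  fderiv_le : ∀ n x v, N (n + 1) (fderiv ℝ (f n) x v) ≤ η * N n v
  fderiv_sub_le : ∀ n x y v,
    N (n + 1) (fderiv ℝ (f n) x v - fderiv ℝ (f n) y v) ≤ L * N n (x - y) * N n v
  r : ℕ
  k : ℕ
  k_le : k ≤ r
  P : ℕ → E →L[ℝ] E
  P_zero : P 0 = 0
  P_r : ∀ x, P r x = x
  P_comp : ∀ i j x, P i (P j x) = P (min i j) x
  N_P : ∀ i n x, N n (P i x) ≤ N n x
  N_Q : ∀ i n x, N n (x - P i x) ≤ N n x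
  lo : ℕ → ℝ
  hi : ℕ → ℝ
  lo_pos : ∀ g ≤ r, 2 * δ < lo g
  lo_lt_hi : ∀ g ≤ r, lo g < hi g
  rate_P : ∀ g ≤ r, ∀ n x, N (n + 1) (P g x) ≤ (lo g - 2 * δ) * N n (P g x)
  rate_Q : ∀ g ≤ r, ∀ n x, (hi g + 2 * δ) * N n (x - P g x) ≤ N (n + 1) (x - P g x)
  hi_le_lo : ∀ i < r, hi i ≤ lo (i + 1)
  lo_k : lo k ≤ 1
  hi_k : 1 ≤ hi k
  lo_mul : lo k * lo r ≤ hi k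
  lo_le_mul : lo k ≤ hi k * hi 0
  band_stable : ∀ i < k, lo k * lo (i + 1) ≤ hi i
  band_unstable : ∀ i, k ≤ i → i < r → lo (i + 1) ≤ hi k * hi i
  small : 4000 * ((r : ℝ) + 1) * η ≤ δ

theorem scalar_bound {p q w : ℕ → ℝ} {γ δ η σ p₀ q₁ : ℝ} {m : ℕ} (hδ : 0 < δ) (hγ : δ ≤ γ)
    (hη : 0 ≤ η) (hηδ : 4 * η ≤ δ) (hσ : 0 ≤ σ) (hp₀ : 0 ≤ p₀) (hq₁ : 0 ≤ q₁)
    (hw : ∀ j, 0 < w j) (hws : ∀ j, w (j + 1) = γ * w j)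
    (hp : ∀ j < m, p (j + 1) ≤ (γ - δ) * p j + η * (p j + q j) + σ * w j)
    (hq : ∀ j < m, (γ + δ) * q j ≤ q (j + 1) + η * (p j + q j) + σ * w j)
    (hp0 : p 0 ≤ p₀ * w 0) (hqm : q m ≤ q₁ * w m) (hp' : ∀ j, 0 ≤ p j) (hq' : ∀ j, 0 ≤ q j) :
    ∀ j ≤ m, p j ≤ (p₀ + 2 * η / δ * (p₀ + q₁) + 2 * σ / δ) * w j ∧
      q j ≤ (q₁ + 2 * η / δ * (p₀ + q₁) + 2 * σ / δ) * w j ∧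
      p j + q j ≤ (2 * (p₀ + q₁) + 4 * σ / δ) * w j := by
  obtain ⟨j₀, hj₀, hmax⟩ := Finset.exists_max_image (Finset.range (m + 1))
    (fun j => (p j + q j) / w j) ⟨0, by simp⟩
  set M := (p j₀ + q j₀) / w j₀ with hM
  have hM0 : 0 ≤ M := div_nonneg (add_nonneg (hp' _) (hq' _)) (hw _).le
  have hle : ∀ j ≤ m, p j + q j ≤ M * w j := fun j hj => by
    have := hmax j (by simp; omega)
    rwa [div_le_iff₀ (hw j)] at this
  set X := η * M + σ with hX
  have hX0 : 0 ≤ X := by positivity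
  have hXd : X / δ * δ = X := div_mul_cancel₀ _ hδ.ne'
  have hXd0 : 0 ≤ X / δ := by positivity
  have hsrc : ∀ j ≤ m, η * (p j + q j) + σ * w j ≤ X * w j := fun j hj => by
    have := mul_le_mul_of_nonneg_left (hle j hj) hη
    rw [hX]; linarith
  have h1 : ∀ j ≤ m, p j ≤ (p₀ + X / δ) * w j := by
    intro j
    induction j with
    | zero => intro _; nlinarith [hw 0, mul_nonneg hXd0 (hw 0).le]
    | succ j ih =>
      intro hj
      have a1 := hp j (by omega)
      have a2 := hsrc j (by omega)
      have a3 := mul_le_mul_of_nonneg_left (ih (by omega)) (sub_nonneg.2 hγ)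
      rw [hws]
      have a4 : (γ - δ) * ((p₀ + X / δ) * w j) = (p₀ + X / δ) * (γ * w j) - δ * p₀ * w j
          - X / δ * δ * w j := by ring
      rw [a4, hXd] at a3
      have : 0 ≤ δ * p₀ * w j := by have := hw j; positivity
      linarith
  have h2 : ∀ i ≤ m, q (m - i) ≤ (q₁ + X / δ) * w (m - i) := by
    intro i
    induction i with
    | zero => intro _; simp only [Nat.sub_zero]; nlinarith [hw m, mul_nonneg hXd0 (hw m).le]
    | succ i ih =>
      intro hi
      have a1 := hq (m - (i + 1)) (by omega)
      have a2 := hsrc (m - (i + 1)) (by omega)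
      have a3 := ih (by omega)
      have e : m - i = m - (i + 1) + 1 := by omega
      rw [e, hws] at a3
      set j := m - (i + 1)
      have a4 : (q₁ + X / δ) * (γ * w j) + X * w j ≤ (γ + δ) * ((q₁ + X / δ) * w j) := by
        have : (γ + δ) * ((q₁ + X / δ) * w j) = (q₁ + X / δ) * (γ * w j) + δ * q₁ * w j
          + X / δ * δ * w j := by ring
        rw [this, hXd]
        have : 0 ≤ δ * q₁ * w j := by have := hw j; positivity
        linarith
      refine le_of_mul_le_mul_left ?_ (show 0 < γ + δ by linarith)
      linarith
  have h2' : ∀ j ≤ m, q j ≤ (q₁ + X / δ) * w j := fun j hj => by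
    have := h2 (m - j) (by omega)
    rwa [show m - (m - j) = j by omega] at this
  have hj₀m : j₀ ≤ m := by simp at hj₀; omega
  have hMle : M ≤ 2 * (p₀ + q₁) + 4 * σ / δ := by
    have a : M ≤ p₀ + q₁ + 2 * (X / δ) := by
      rw [hM, div_le_iff₀ (hw j₀)]
      linarith [h1 j₀ hj₀m, h2' j₀ hj₀m]
    have b : X / δ ≤ M / 4 + σ / δ := by
      have : η * M / δ ≤ M / 4 := by rw [div_le_iff₀ hδ]; nlinarith
      rw [hX, add_div]
      linarith
    have c : 4 * σ / δ = 4 * (σ / δ) := by ring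
    linarith
  have hXle : X / δ ≤ 2 * η / δ * (p₀ + q₁) + 2 * σ / δ := by
    have a : X ≤ η * (2 * (p₀ + q₁)) + 2 * σ := by
      have b := mul_le_mul_of_nonneg_left hMle hη
      have c : η * (4 * σ / δ) ≤ σ := by
        rw [← mul_div_assoc, div_le_iff₀ hδ]; nlinarith
      rw [hX]; linarith
    have e : 2 * η / δ * (p₀ + q₁) + 2 * σ / δ = (η * (2 * (p₀ + q₁)) + 2 * σ) / δ := by ring
    rw [e]
    gcongr
  intro j hj
  refine ⟨(h1 j hj).trans ?_, (h2' j hj).trans ?_, (hle j hj).trans ?_⟩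
  · exact mul_le_mul_of_nonneg_right (by linarith) (hw j).le
  · exact mul_le_mul_of_nonneg_right (by linarith) (hw j).le
  · exact mul_le_mul_of_nonneg_right hMle (hw j).le

namespace Sys
variable (S : Sys E)

/-- The relative size of the nonlinearity. -/
def κ : ℝ := 2 * S.η / S.δ

theorem κ_nonneg : 0 ≤ S.κ := div_nonneg (mul_nonneg zero_le_two S.η_nonneg) S.δ_pos.le

theorem κ_small : 2000 * ((S.r : ℝ) + 1) * S.κ ≤ 1 := by
  have := S.small
  unfold κ
  rw [← mul_div_assoc, div_le_one S.δ_pos]; linarith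

theorem κ_le : S.κ ≤ 1 / 2000 := by
  have := S.κ_small
  nlinarith [S.κ_nonneg, mul_nonneg (Nat.cast_nonneg (α := ℝ) S.r) S.κ_nonneg]

theorem η_le : 4 * S.η ≤ S.δ := by
  have := S.small
  nlinarith [S.η_nonneg, mul_nonneg (Nat.cast_nonneg (α := ℝ) S.r) S.η_nonneg]

theorem N_add (n : ℕ) (x y : E) : S.N n (x + y) ≤ S.N n x + S.N n y := map_add_le_add _ _ _
theorem N_sub (n : ℕ) (x y : E) : S.N n (x - y) ≤ S.N n x + S.N n y := map_sub_le_add _ _ _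
theorem N_nonneg (n : ℕ) (x : E) : 0 ≤ S.N n x := apply_nonneg _ _
theorem N_zero (n : ℕ) : S.N n 0 = 0 := map_zero _
theorem N_le_PQ (g n : ℕ) (x : E) : S.N n x ≤ S.N n (S.P g x) + S.N n (x - S.P g x) := by
  have := S.N_add n (S.P g x) (x - S.P g x)
  rwa [add_sub_cancel] at this

theorem finite_bound {g : ℕ} (hg : g ≤ S.r) {γ : ℝ} (hγ₁ : S.lo g - S.δ ≤ γ)
    (hγ₂ : γ ≤ S.hi g + S.δ) {t : ℕ → E} {n m : ℕ} {w : ℕ → ℝ} {σ p₀ q₁ : ℝ}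
    (hσ : 0 ≤ σ) (hp₀ : 0 ≤ p₀) (hq₁ : 0 ≤ q₁)
    (hw : ∀ j, 0 < w j) (hws : ∀ j, w (j + 1) = γ * w j)
    (hstep : ∀ i < m, S.N (n + i + 1) (t (i + 1) - t i) ≤ S.η * S.N (n + i) (t i) + σ * w i)
    (hp0 : S.N n (S.P g (t 0)) ≤ p₀ * w 0)
    (hqm : S.N (n + m) (t m - S.P g (t m)) ≤ q₁ * w m) :
    ∀ j ≤ m, S.N (n + j) (S.P g (t j)) ≤ (p₀ + S.κ * (p₀ + q₁) + 2 * σ / S.δ) * w j ∧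
      S.N (n + j) (t j - S.P g (t j)) ≤ (q₁ + S.κ * (p₀ + q₁) + 2 * σ / S.δ) * w j ∧
      S.N (n + j) (t j) ≤ (2 * (p₀ + q₁) + 4 * σ / S.δ) * w j := by
  have hstep' : ∀ i < m, S.N (n + i + 1) (t (i + 1) - t i) ≤
      S.η * (S.N (n + i) (S.P g (t i)) + S.N (n + i) (t i - S.P g (t i))) + σ * w i :=
    fun i hi => (hstep i hi).trans (by
      have := mul_le_mul_of_nonneg_left (S.N_le_PQ g (n + i) (t i)) S.η_nonneg
      linarith)
  have hlo := S.lo_pos g hg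
  have key := scalar_bound (p := fun j => S.N (n + j) (S.P g (t j)))
    (q := fun j => S.N (n + j) (t j - S.P g (t j))) (m := m) S.δ_pos
    (by linarith [S.δ_pos]) S.η_nonneg S.η_le hσ hp₀ hq₁ hw hws
    (fun j hj => ?_) (fun j hj => ?_) hp0 hqm (fun j => S.N_nonneg _ _) (fun j => S.N_nonneg _ _)
  · intro j hj
    obtain ⟨h1, h2, h3⟩ := key j hj
    exact ⟨h1, h2, (S.N_le_PQ g _ _).trans h3⟩
  · have a1 := S.rate_P g hg (n + j) (t j)
    have a2 := S.N_P g (n + j + 1) (t (j + 1) - t j)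
    have a3 := S.N_add (n + j + 1) (S.P g (t j)) (S.P g (t (j + 1) - t j))
    rw [← map_add, add_sub_cancel] at a3
    have a4 := hstep' j hj
    have a5 : (S.lo g - 2 * S.δ) * S.N (n + j) (S.P g (t j)) ≤
      (γ - S.δ) * S.N (n + j) (S.P g (t j)) :=
      mul_le_mul_of_nonneg_right (by linarith) (S.N_nonneg _ _)
    change S.N (n + j + 1) _ ≤ _
    linarith
  · have a1 := S.rate_Q g hg (n + j) (t j)
    have a2 := S.N_Q g (n + j + 1) (t (j + 1) - t j)
    have a3 := S.N_sub (n + j + 1) (t (j + 1) - S.P g (t (j + 1)))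
      ((t (j + 1) - t j) - S.P g (t (j + 1) - t j))
    have e : (t (j + 1) - S.P g (t (j + 1))) - ((t (j + 1) - t j) - S.P g (t (j + 1) - t j)) =
      t j - S.P g (t j) := by rw [map_sub]; abel
    rw [e] at a3
    have a4 := hstep' j hj
    have a5 : (γ + S.δ) * S.N (n + j) (t j - S.P g (t j)) ≤
      (S.hi g + 2 * S.δ) * S.N (n + j) (t j - S.P g (t j)) :=
      mul_le_mul_of_nonneg_right (by linarith) (S.N_nonneg _ _)
    change _ ≤ S.N (n + j + 1) _ + _ + _
    linarith

/-- Forward estimate: a solution growing slower than the weight is controlled by its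
slow component. -/
theorem forward_bound {g : ℕ} (hg : g ≤ S.r) {γ : ℝ} (hγ₁ : S.lo g - S.δ ≤ γ)
    (hγ₂ : γ ≤ S.hi g + S.δ) {t : ℕ → E} {n : ℕ} {σ C μ : ℝ}
    (hσ : 0 ≤ σ) (hμ : 0 ≤ μ) (hμγ : μ < γ) (hap : ∀ i, S.N (n + i) (t i) ≤ C * μ ^ i)
    (hstep : ∀ i, S.N (n + i + 1) (t (i + 1) - t i) ≤ S.η * S.N (n + i) (t i) + σ * γ ^ i) :
    S.N n (t 0 - S.P g (t 0)) ≤ S.κ * S.N n (S.P g (t 0)) + 2 * σ / S.δ ∧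
    ∀ i, S.N (n + i) (t i) ≤ (2 * S.N n (S.P g (t 0)) + 4 * σ / S.δ) * γ ^ i := by
  have hγ : 0 < γ := hμ.trans_lt hμγ
  have hC : 0 ≤ C := by have := (S.N_nonneg _ _).trans (hap 0); simpa using this
  set p₀ := S.N n (S.P g (t 0)) with hp₀
  have key : ∀ m, ∀ j ≤ m, _ := fun m => S.finite_bound hg hγ₁ hγ₂ (t := t) (n := n) (m := m)
    (w := fun j => γ ^ j) (σ := σ) (p₀ := p₀) (q₁ := C * (μ / γ) ^ m) hσ (S.N_nonneg _ _)
    (by positivity) (fun j => by positivity) (fun j => by ring) (fun i _ => hstep i)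
    (by simp [hp₀]) (by
      refine ((S.N_Q g _ _).trans (hap m)).trans (le_of_eq ?_)
      rw [div_pow]; field_simp)
  have hlim : Tendsto (fun m : ℕ => C * (μ / γ) ^ m) atTop (𝓝 0) := by
    have := (tendsto_pow_atTop_nhds_zero_of_lt_one (div_nonneg hμ hγ.le)
      ((div_lt_one hγ).2 hμγ)).const_mul C
    simpa using this
  refine ⟨?_, fun i => ?_⟩
  · have h1 : Tendsto (fun m : ℕ => C * (μ / γ) ^ m + S.κ * (p₀ + C * (μ / γ) ^ m)
        + 2 * σ / S.δ) atTop (𝓝 (0 + S.κ * (p₀ + 0) + 2 * σ / S.δ)) :=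
      (hlim.add ((hlim.const_add p₀).const_mul S.κ)).add_const _
    rw [zero_add, add_zero] at h1
    refine ge_of_tendsto' h1 fun m => ?_
    have := (key m 0 (Nat.zero_le _)).2.1
    simpa using this
  · have h1 : Tendsto (fun m : ℕ => (2 * (p₀ + C * (μ / γ) ^ m) + 4 * σ / S.δ) * γ ^ i) atTop
        (𝓝 ((2 * (p₀ + 0) + 4 * σ / S.δ) * γ ^ i)) :=
      (((hlim.const_add p₀).const_mul 2).add_const _).mul_const _
    rw [add_zero] at h1
    refine ge_of_tendsto h1 ?_
    filter_upwards [eventually_ge_atTop i] with m hm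
    exact (key m i hm).2.2

/-- Backward estimate: a solution with no initial slow component is controlled by its
fast component. -/
theorem backward_bound {g : ℕ} (hg : g ≤ S.r) {γ : ℝ} (hγ₁ : S.lo g - S.δ ≤ γ)
    (hγ₂ : γ ≤ S.hi g + S.δ) {t : ℕ → E} {n : ℕ} {σ : ℝ}
    (hσ : 0 ≤ σ) (h0 : S.P g (t 0) = 0)
    (hstep : ∀ j i, j + i + 1 = n →
      γ ^ (i + 1) * S.N (j + 1) (t (j + 1) - t j) ≤ γ ^ (i + 1) * (S.η * S.N j (t j)) + σ) :
    S.N n (S.P g (t n)) ≤ S.κ * S.N n (t n - S.P g (t n)) + 2 * σ / S.δ ∧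
    ∀ j i, j + i = n →
      γ ^ i * S.N j (t j) ≤ 2 * S.N n (t n - S.P g (t n)) + 4 * σ / S.δ := by
  have hγ : 0 < γ := by linarith [S.lo_pos g hg, S.δ_pos]
  have key := S.finite_bound hg hγ₁ hγ₂ (t := t) (n := 0) (m := n)
    (w := fun j => γ ^ j / γ ^ n) (σ := σ) (p₀ := 0)
    (q₁ := S.N n (t n - S.P g (t n))) hσ le_rfl (S.N_nonneg _ _)
    (fun j => by positivity) (fun j => by rw [pow_succ]; ring) (fun j hj => by
      have h1 := hstep j (n - j - 1) (by omega)
      have e : γ ^ n = γ ^ (n - j - 1 + 1) * γ ^ j := by rw [← pow_add]; congr 1; omega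
      have h2 : γ ^ j / γ ^ n * γ ^ (n - j - 1 + 1) = 1 := by
        rw [e]; field_simp
      simp only [Nat.zero_add]
      refine le_of_mul_le_mul_left ?_ (pow_pos hγ (n - j - 1 + 1))
      nlinarith)
    (by simp [h0, S.N_zero]) (by
      simp only [Nat.zero_add]
      rw [div_self (pow_pos hγ n).ne', mul_one])
  simp only [zero_add] at key
  refine ⟨?_, fun j i hj => ?_⟩
  · have := (key n le_rfl).1
    rwa [div_self (pow_pos hγ n).ne', mul_one] at this
  · have := (key j (by omega)).2.2
    have e : γ ^ n = γ ^ i * γ ^ j := by rw [← pow_add]; congr 1; omega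
    have h2 : γ ^ i * (γ ^ j / γ ^ n) = 1 := by rw [e]; field_simp
    have := mul_le_mul_of_nonneg_left this (pow_pos hγ i).le
    rwa [mul_left_comm, h2, mul_one] at this
end Sys

namespace Sys
variable (S : Sys E)

/-- The flow from time `0` to time `n`. -/
def Φ : ℕ → E → E
  | 0 => id
  | n + 1 => fun x => Φ n x + S.f n (Φ n x)

theorem Φ_zero (x : E) : S.Φ 0 x = x := rfl
theorem Φ_succ (n : ℕ) (x : E) : S.Φ (n + 1) x = S.Φ n x + S.f n (S.Φ n x) := rfl

theorem Φ_at_zero (n : ℕ) : S.Φ n 0 = 0 := by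
  induction n with
  | zero => rfl
  | succ n ih => rw [Φ_succ, ih, S.f_zero, add_zero]

theorem Φ_contDiff (n : ℕ) : ContDiff ℝ 1 (S.Φ n) := by
  induction n with
  | zero => exact contDiff_id
  | succ n ih => exact ih.add ((S.contDiff_f n).comp ih)

theorem f_hasFDerivAt (n : ℕ) (x : E) : HasFDerivAt (S.f n) (fderiv ℝ (S.f n) x) x :=
  ((S.contDiff_f n).differentiable one_ne_zero x).hasFDerivAt

section FD
variable [FiniteDimensional ℝ E]

theorem f_lip (n : ℕ) (x y : E) :
    S.N (n + 1) (S.f n y - S.f n x) ≤ S.η * S.N n (y - x) :=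
  seminorm_image_sub_le _ (S.f_hasFDerivAt n) x y fun _ _ => S.fderiv_le n _ _

theorem f_lip_local (n : ℕ) {ρ : ℝ} {x y : E} (hx : S.N n x ≤ ρ) (hy : S.N n y ≤ ρ) :
    S.N (n + 1) (S.f n y - S.f n x) ≤ S.L * ρ * S.N n (y - x) := by
  refine seminorm_image_sub_le _ (S.f_hasFDerivAt n) x y fun t ht => ?_
  have h1 := S.fderiv_sub_le n (x + t • (y - x)) 0 (y - x)
  rw [S.fderiv_zero, _root_.zero_apply, sub_zero, sub_zero] at h1
  have h2 : S.N n (x + t • (y - x)) ≤ ρ := by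
    have e : x + t • (y - x) = (1 - t) • x + t • y := by module
    rw [e]
    refine (S.N_add _ _ _).trans ?_
    rw [map_smul_eq_mul, map_smul_eq_mul, Real.norm_eq_abs, Real.norm_eq_abs,
      abs_of_nonneg ht.1, abs_of_nonneg (sub_nonneg.2 ht.2)]
    nlinarith [ht.1, ht.2]
  refine h1.trans ?_
  have := S.L_nonneg
  have := S.N_nonneg n (y - x)
  gcongr

theorem f_double_aux (n : ℕ) (a x y : E) :
    S.N (n + 1) (S.f n (y + a) - S.f n y - (S.f n (x + a) - S.f n x)) ≤
      S.L * S.N n (y - x) * S.N n a := by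
  have h : ∀ z, HasFDerivAt (fun z => S.f n (z + a) - S.f n z)
      (fderiv ℝ (S.f n) (z + a) - fderiv ℝ (S.f n) z) z := fun z =>
    ((hasFDerivAt_comp_add_right a).2 (S.f_hasFDerivAt n (z + a))).sub (S.f_hasFDerivAt n z)
  refine seminorm_image_sub_le (S.N (n + 1)) h x y fun t _ => ?_
  have h1 := S.fderiv_sub_le n (x + t • (y - x) + a) (x + t • (y - x)) (y - x)
  rw [add_sub_cancel_left] at h1
  rw [_root_.sub_apply]
  linarith

theorem f_double (n : ℕ) (x x' y y' : E) :
    S.N (n + 1) (S.f n y' - S.f n y - (S.f n x' - S.f n x)) ≤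
      S.η * S.N n (y' - y - (x' - x)) + S.L * S.N n (y - x) * S.N n (x' - x) := by
  have h1 := S.f_lip n (y + (x' - x)) y'
  have h2 := S.f_double_aux n (x' - x) x y
  have h3 := S.N_add (n + 1) (S.f n y' - S.f n (y + (x' - x)))
    (S.f n (y + (x' - x)) - S.f n y - (S.f n (x + (x' - x)) - S.f n x))
  have e : S.f n y' - S.f n (y + (x' - x)) +
    (S.f n (y + (x' - x)) - S.f n y - (S.f n (x + (x' - x)) - S.f n x)) =
    S.f n y' - S.f n y - (S.f n (x + (x' - x)) - S.f n x) := by abel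
  rw [e, add_sub_cancel] at h3
  rw [← sub_sub] at h1
  rw [add_sub_cancel] at h2
  linarith

theorem f_double_local (n : ℕ) (x x' y y' : E) :
    S.N (n + 1) (S.f n y' - S.f n y - (S.f n x' - S.f n x)) ≤
      S.L * (S.N n x + S.N n x' + S.N n y + S.N n y') * S.N n (y' - y - (x' - x))
        + S.L * S.N n (y - x) * S.N n (x' - x) := by
  have hb : S.N n (y + (x' - x)) ≤ S.N n x + S.N n x' + S.N n y + S.N n y' := by
    have h1 := S.N_add n y (x' - x)
    have h2 := S.N_sub n x' x
    linarith [S.N_nonneg n y']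
  have h1 := S.f_lip_local n hb (y := y')
    (by linarith [S.N_nonneg n x, S.N_nonneg n x', S.N_nonneg n y])
  have h2 := S.f_double_aux n (x' - x) x y
  have h3 := S.N_add (n + 1) (S.f n y' - S.f n (y + (x' - x)))
    (S.f n (y + (x' - x)) - S.f n y - (S.f n (x + (x' - x)) - S.f n x))
  have e : S.f n y' - S.f n (y + (x' - x)) +
    (S.f n (y + (x' - x)) - S.f n y - (S.f n (x + (x' - x)) - S.f n x)) =
    S.f n y' - S.f n y - (S.f n (x + (x' - x)) - S.f n x) := by abel
  rw [e, add_sub_cancel] at h3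
  rw [← sub_sub] at h1
  rw [add_sub_cancel] at h2
  linarith

theorem Φ_step (n : ℕ) (x y : E) :
    S.Φ (n + 1) y - S.Φ (n + 1) x - (S.Φ n y - S.Φ n x) =
      S.f n (S.Φ n y) - S.f n (S.Φ n x) := by
  rw [Φ_succ, Φ_succ]; abel

theorem Φ_step_le (n : ℕ) (x y : E) :
    S.N (n + 1) (S.Φ (n + 1) y - S.Φ (n + 1) x - (S.Φ n y - S.Φ n x)) ≤
      S.η * S.N n (S.Φ n y - S.Φ n x) := by
  rw [Φ_step]; exact S.f_lip _ _ _

theorem fderiv_Φ_step_le (n : ℕ) (x w : E) :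
    S.N (n + 1) (fderiv ℝ (S.Φ (n + 1)) x w - fderiv ℝ (S.Φ n) x w) ≤
      S.η * S.N n (fderiv ℝ (S.Φ n) x w) := by
  have hd : HasFDerivAt (S.Φ n) (fderiv ℝ (S.Φ n) x) x :=
    ((S.Φ_contDiff n).differentiable one_ne_zero x).hasFDerivAt
  have h1 : HasFDerivAt (S.Φ (n + 1)) (fderiv ℝ (S.Φ n) x +
      (fderiv ℝ (S.f n) (S.Φ n x)).comp (fderiv ℝ (S.Φ n) x)) x :=
    hd.add ((S.f_hasFDerivAt n _).comp x hd)
  rw [h1.fderiv]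
  simp only [_root_.add_apply, ContinuousLinearMap.comp_apply, add_sub_cancel_left]
  exact S.fderiv_le _ _ _

theorem growth_upper (n : ℕ) (x y : E) :
    S.N (n + 1) (S.Φ (n + 1) y - S.Φ (n + 1) x) ≤ S.lo S.r * S.N n (S.Φ n y - S.Φ n x) := by
  have h1 := S.Φ_step_le n x y
  have h2 := S.rate_P S.r le_rfl n (S.Φ n y - S.Φ n x)
  rw [S.P_r] at h2
  have h3 := S.N_add (n + 1) (S.Φ (n + 1) y - S.Φ (n + 1) x - (S.Φ n y - S.Φ n x))
    (S.Φ n y - S.Φ n x)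
  rw [sub_add_cancel] at h3
  nlinarith [S.η_le, S.δ_pos, S.N_nonneg n (S.Φ n y - S.Φ n x), S.η_nonneg]

theorem growth_lower (n : ℕ) (x y : E) :
    S.hi 0 * S.N n (S.Φ n y - S.Φ n x) ≤ S.N (n + 1) (S.Φ (n + 1) y - S.Φ (n + 1) x) := by
  have h1 := S.Φ_step_le n x y
  have h2 := S.rate_Q 0 (Nat.zero_le _) n (S.Φ n y - S.Φ n x)
  rw [S.P_zero, _root_.zero_apply, sub_zero] at h2
  have h3 := S.N_sub (n + 1) (S.Φ (n + 1) y - S.Φ (n + 1) x)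
    (S.Φ (n + 1) y - S.Φ (n + 1) x - (S.Φ n y - S.Φ n x))
  rw [sub_sub_cancel] at h3
  nlinarith [S.η_le, S.δ_pos, S.N_nonneg n (S.Φ n y - S.Φ n x), S.η_nonneg]

theorem lo_nonneg {g : ℕ} (hg : g ≤ S.r) : 0 < S.lo g := by linarith [S.lo_pos g hg, S.δ_pos]
theorem hi_nonneg {g : ℕ} (hg : g ≤ S.r) : 0 < S.hi g :=
  (S.lo_nonneg hg).trans (S.lo_lt_hi g hg)
theorem lo_sub_pos {g : ℕ} (hg : g ≤ S.r) : 0 < S.lo g - S.δ := by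
  linarith [S.lo_pos g hg, S.δ_pos]

theorem growth_upper_iter (n i : ℕ) (x y : E) :
    S.N (n + i) (S.Φ (n + i) y - S.Φ (n + i) x) ≤ S.lo S.r ^ i * S.N n (S.Φ n y - S.Φ n x) := by
  induction i with
  | zero => simp
  | succ i ih =>
    refine (S.growth_upper (n + i) x y).trans ?_
    have := mul_le_mul_of_nonneg_left ih (S.lo_nonneg le_rfl).le
    rw [pow_succ]; linarith

theorem growth_lower_iter (n i : ℕ) (x y : E) :
    S.hi 0 ^ i * S.N n (S.Φ n y - S.Φ n x) ≤ S.N (n + i) (S.Φ (n + i) y - S.Φ (n + i) x) := by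
  induction i with
  | zero => simp
  | succ i ih =>
    refine le_trans ?_ (S.growth_lower (n + i) x y)
    have := mul_le_mul_of_nonneg_left ih (S.hi_nonneg (Nat.zero_le S.r)).le
    rw [pow_succ]; linarith

theorem Φ_lower_lipschitz (n : ℕ) : ∃ C : ℝ, ∀ x y, ‖y - x‖ ≤ C * ‖S.Φ n y - S.Φ n x‖ := by
  obtain ⟨C, hC, h⟩ := exists_norm_le_seminorm (S.N 0) (S.pos 0)
  obtain ⟨C', hC', h'⟩ := exists_seminorm_le_norm (S.N n)
  have h0 := pow_pos (S.hi_nonneg (Nat.zero_le S.r)) n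
  refine ⟨C * (C' / S.hi 0 ^ n), fun x y => (h _).trans ?_⟩
  have h1 := (S.growth_lower_iter 0 n x y).trans ((congrArg (fun m =>
    S.N m (S.Φ m y - S.Φ m x)) (Nat.zero_add n)).le.trans (h' _))
  rw [mul_assoc]
  refine mul_le_mul_of_nonneg_left ?_ hC.le
  rw [div_mul_eq_mul_div, le_div_iff₀ h0, mul_comm]
  exact h1

/-- The flow as a bijection. -/
def Φe (n : ℕ) : E ≃ E := Equiv.ofBijective (S.Φ n) (by
  obtain ⟨C, hC⟩ := S.Φ_lower_lipschitz n
  refine ⟨fun x y h => ?_, surjective_of_lower_lipschitz (S.Φ_contDiff n) hC⟩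
  have := hC y x
  rw [h, sub_self, norm_zero, mul_zero] at this
  exact sub_eq_zero.1 (norm_le_zero_iff.1 this))

theorem Φe_apply (n : ℕ) (x : E) : S.Φe n x = S.Φ n x := rfl

theorem Φe_symm_contDiff (n : ℕ) : ContDiff ℝ 1 (S.Φe n).symm := by
  obtain ⟨C, hC⟩ := S.Φ_lower_lipschitz n
  exact contDiff_symm_of_lower_lipschitz _ (S.Φ_contDiff n)
    fun x => ⟨C, Eventually.of_forall fun y => hC x y⟩

/-- Two points lie on the same leaf of the `g`-th slow foliation. -/
def Slow (g : ℕ) (x y : E) : Prop :=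
  ∃ C, ∀ j, S.N j (S.Φ j y - S.Φ j x) ≤ C * (S.lo g - S.δ) ^ j

variable {S}

theorem Slow.refl (g : ℕ) (x : E) : S.Slow g x x := ⟨0, fun j => by simp⟩

theorem Slow.symm {g : ℕ} {x y : E} (h : S.Slow g x y) : S.Slow g y x := by
  obtain ⟨C, hC⟩ := h
  exact ⟨C, fun j => by rw [map_sub_rev]; exact hC j⟩

theorem Slow.trans {g : ℕ} {x y z : E} (h : S.Slow g x y) (h' : S.Slow g y z) : S.Slow g x z := by
  obtain ⟨C, hC⟩ := h
  obtain ⟨C', hC'⟩ := h'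
  refine ⟨C + C', fun j => ?_⟩
  have := S.N_add j (S.Φ j z - S.Φ j y) (S.Φ j y - S.Φ j x)
  rw [sub_add_sub_cancel] at this
  linarith [hC j, hC' j]

theorem Slow.mono {g g' : ℕ} (hg : g ≤ S.r) (hlo : S.lo g ≤ S.lo g') {x y : E}
    (h : S.Slow g x y) : S.Slow g' x y := by
  obtain ⟨C, hC⟩ := h
  have hC0 : 0 ≤ C := by have := (S.N_nonneg _ _).trans (hC 0); simpa using this
  refine ⟨C, fun j => (hC j).trans ?_⟩
  have := S.lo_sub_pos hg
  gcongr

/-- Growth along a leaf, from time `n`, in terms of the slow component. -/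
theorem Slow.bound {g : ℕ} (hg : g ≤ S.r) {x y : E} (h : S.Slow g x y) (n : ℕ) :
    S.N n (S.Φ n y - S.Φ n x - S.P g (S.Φ n y - S.Φ n x)) ≤
      S.κ * S.N n (S.P g (S.Φ n y - S.Φ n x)) ∧
    ∀ i, S.N (n + i) (S.Φ (n + i) y - S.Φ (n + i) x) ≤
      2 * S.N n (S.P g (S.Φ n y - S.Φ n x)) * S.lo g ^ i := by
  obtain ⟨C, hC⟩ := h
  have := S.forward_bound hg (γ := S.lo g) (by linarith [S.δ_pos])
    (by linarith [S.δ_pos, S.lo_lt_hi g hg]) (t := fun i => S.Φ (n + i) y - S.Φ (n + i) x)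
    (n := n) (σ := 0) (C := C * (S.lo g - S.δ) ^ n) (μ := S.lo g - S.δ) le_rfl
    (S.lo_sub_pos hg).le (by linarith [S.δ_pos])
    (fun i => by rw [mul_assoc, ← pow_add]; exact hC _)
    (fun i => by simpa [← add_assoc] using S.Φ_step_le (n + i) x y)
  simpa using this

theorem Slow.unique {g : ℕ} (hg : g ≤ S.r) {x y : E} (h : S.Slow g x y)
    (hP : S.P g x = S.P g y) : x = y := by
  have := (h.bound hg 0).2 0
  simp only [Φ_zero, map_sub, hP, sub_self, map_zero, mul_zero, zero_mul, add_zero] at this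
  have h2 : S.N 0 (S.Φ 0 y - S.Φ 0 x) = 0 := le_antisymm this (S.N_nonneg _ _)
  exact (sub_eq_zero.1 (S.pos 0 _ h2)).symm

variable (S)

theorem exists_leaf {g : ℕ} (hg : g ≤ S.r) (x ξ : E) :
    ∃ y, S.Slow g x y ∧ S.P g y = S.P g ξ := by
  have hγ := S.lo_nonneg hg
  have hex : ∀ m, ∃ y, S.P g y = S.P g ξ ∧
      S.Φ m y - S.P g (S.Φ m y) = S.Φ m x - S.P g (S.Φ m x) := by
    intro m
    let Θ : E → E := fun y => S.P g y + (S.Φ m y - S.P g (S.Φ m y))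
    have hΘ : ContDiff ℝ 1 Θ := (S.P g).contDiff.add
      ((S.Φ_contDiff m).sub ((S.P g).contDiff.comp (S.Φ_contDiff m)))
    have hPP : ∀ z, S.P g (S.P g z) = S.P g z := fun z => by rw [S.P_comp, min_self]
    have hPΘ : ∀ y, S.P g (Θ y) = S.P g y := fun y => by
      simp only [Θ, map_add, map_sub, hPP, sub_self, add_zero]
    have hQΘ : ∀ y, Θ y - S.P g (Θ y) = S.Φ m y - S.P g (S.Φ m y) := fun y => by
      rw [hPΘ]; simp only [Θ]; abel
    obtain ⟨C, hC, hC1⟩ := exists_norm_le_seminorm (S.N 0) (S.pos 0)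
    obtain ⟨C', hC', hC1'⟩ := exists_seminorm_le_norm (S.N m)
    obtain ⟨C0, hC0, hC01⟩ := exists_seminorm_le_norm (S.N 0)
    have hlow : ∀ y y', ‖y' - y‖ ≤ C * (2 * (C0 + C' / S.lo g ^ m)) * ‖Θ y' - Θ y‖ := by
      intro y y'
      have hp := pow_pos hγ m
      have := (S.finite_bound hg (γ := S.lo g) (by linarith [S.δ_pos])
        (by linarith [S.δ_pos, S.lo_lt_hi g hg]) (t := fun i => S.Φ i y' - S.Φ i y) (n := 0)
        (m := m) (w := fun i => S.lo g ^ i) (σ := 0) (p₀ := C0 * ‖Θ y' - Θ y‖)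
        (q₁ := C' / S.lo g ^ m * ‖Θ y' - Θ y‖) le_rfl (by positivity) (by positivity)
        (fun j => by positivity) (fun j => by ring)
        (fun i _ => by simpa using S.Φ_step_le i y y')
        (by
          simp only [Φ_zero, pow_zero, mul_one]
          rw [map_sub, ← hPΘ, ← hPΘ y, ← map_sub]
          exact (S.N_P g 0 _).trans (hC01 _))
        (by
          simp only [Nat.zero_add]
          have e : S.Φ m y' - S.Φ m y - S.P g (S.Φ m y' - S.Φ m y) =
              (Θ y' - Θ y) - S.P g (Θ y' - Θ y) := by
            rw [map_sub, map_sub, sub_sub_sub_comm, sub_sub_sub_comm (Θ y'), hQΘ, hQΘ]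
          rw [e]
          refine (S.N_Q g m _).trans ((hC1' _).trans (le_of_eq ?_))
          field_simp) 0 (Nat.zero_le _)).2.2
      simp only [add_zero, Φ_zero, mul_zero, zero_div, pow_zero, mul_one] at this
      refine (hC1 _).trans ?_
      rw [mul_assoc]
      refine mul_le_mul_of_nonneg_left (this.trans (le_of_eq ?_)) hC.le
      ring
    obtain ⟨y, hy⟩ := surjective_of_lower_lipschitz hΘ hlow
      (S.P g ξ + (S.Φ m x - S.P g (S.Φ m x)))
    have h1 : S.P g y = S.P g ξ := by
      rw [← hPΘ, hy]; simp only [map_add, map_sub, hPP, sub_self, add_zero]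
    exact ⟨y, h1, by rw [← hQΘ, hPΘ, h1, hy]; abel⟩
  choose y hy1 hy2 using hex
  have hb : ∀ m, ∀ j ≤ m, S.N j (S.Φ j (y m) - S.Φ j x) ≤
      2 * S.N 0 (S.P g (ξ - x)) * (S.lo g - S.δ) ^ j := by
    intro m j hj
    have := (S.finite_bound hg (γ := S.lo g - S.δ) le_rfl
        (by linarith [S.δ_pos, S.lo_lt_hi g hg]) (t := fun i => S.Φ i (y m) - S.Φ i x) (n := 0)
        (m := m) (w := fun i => (S.lo g - S.δ) ^ i) (σ := 0) (p₀ := S.N 0 (S.P g (ξ - x)))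
        (q₁ := 0) le_rfl (S.N_nonneg _ _) le_rfl
        (fun j => pow_pos (S.lo_sub_pos hg) j) (fun j => by ring)
        (fun i _ => by simpa using S.Φ_step_le i x (y m))
        (by
          simp only [Φ_zero, pow_zero, mul_one]
          rw [map_sub (S.P g), hy1, ← map_sub (S.P g)])
        (by
          rw [map_sub (S.P g), sub_sub_sub_comm, hy2, sub_self, map_zero, zero_mul]) j hj).2.2
    simpa using this
  obtain ⟨C, hC, hC1⟩ := exists_norm_le_seminorm (S.N 0) (S.pos 0)
  have : ProperSpace E := FiniteDimensional.proper_real E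
  obtain ⟨z, -, φ, hφ, hz⟩ := tendsto_subseq_of_bounded
    (Metric.isBounded_closedBall (x := (0 : E))
      (r := C * (2 * S.N 0 (S.P g (ξ - x)) + S.N 0 x))) (x := y) (fun m => by
      rw [mem_closedBall_zero_iff]
      refine (hC1 _).trans (mul_le_mul_of_nonneg_left ?_ hC.le)
      have h1 := hb m 0 (Nat.zero_le _)
      have h2 := S.N_add 0 (y m - x) x
      simp only [Φ_zero, pow_zero, mul_one] at h1
      rw [sub_add_cancel] at h2
      linarith)
  refine ⟨z, ⟨2 * S.N 0 (S.P g (ξ - x)), fun j => ?_⟩, ?_⟩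
  · have hc : Continuous fun z => S.N j (S.Φ j z - S.Φ j x) :=
      (seminorm_continuous _).comp ((S.Φ_contDiff j).continuous.sub continuous_const)
    refine le_of_tendsto ((hc.tendsto z).comp hz) ?_
    filter_upwards [eventually_ge_atTop j] with m hm
    exact hb _ j (hm.trans (hφ.id_le m))
  · refine tendsto_nhds_unique (((S.P g).continuous.tendsto z).comp hz) ?_
    simp only [Function.comp_def, hy1]
    exact tendsto_const_nhds

/-- The point of the `g`-leaf through `x` whose slow component is that of `ξ`. -/
def leaf (g : ℕ) (x ξ : E) : E := Classical.epsilon fun y => S.Slow g x y ∧ S.P g y = S.P g ξ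

theorem leaf_slow {g : ℕ} (hg : g ≤ S.r) (x ξ : E) : S.Slow g x (S.leaf g x ξ) :=
  (Classical.epsilon_spec (S.exists_leaf hg x ξ)).1

theorem P_leaf {g : ℕ} (hg : g ≤ S.r) (x ξ : E) : S.P g (S.leaf g x ξ) = S.P g ξ :=
  (Classical.epsilon_spec (S.exists_leaf hg x ξ)).2

theorem leaf_eq {g : ℕ} (hg : g ≤ S.r) {x ξ y : E} (h : S.Slow g x y) (hP : S.P g y = S.P g ξ) :
    S.leaf g x ξ = y :=
  ((S.leaf_slow hg x ξ).symm.trans h).unique hg ((S.P_leaf hg x ξ).trans hP.symm)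
end FD
end Sys

namespace Sys
variable (S : Sys E)
section FD
variable [FiniteDimensional ℝ E]

/-- Backward estimate for a pair of orbits whose initial points have the same slow component. -/
theorem fast_bound {g : ℕ} (hg : g ≤ S.r) {x y : E} (h : S.P g (y - x) = 0) (n : ℕ) :
    S.N n (S.P g (S.Φ n y - S.Φ n x)) ≤
      S.κ * S.N n (S.Φ n y - S.Φ n x - S.P g (S.Φ n y - S.Φ n x)) ∧
    ∀ j i, j + i = n → S.hi g ^ i * S.N j (S.Φ j y - S.Φ j x) ≤
      2 * S.N n (S.Φ n y - S.Φ n x - S.P g (S.Φ n y - S.Φ n x)) := by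
  have := S.backward_bound hg (γ := S.hi g) (by linarith [S.δ_pos, S.lo_lt_hi g hg])
    (by linarith [S.δ_pos]) (t := fun i => S.Φ i y - S.Φ i x) (n := n) (σ := 0) le_rfl
    h (fun j i _ => by
      rw [add_zero]
      exact mul_le_mul_of_nonneg_left (S.Φ_step_le j x y) (pow_pos (S.hi_nonneg hg) _).le)
  simpa using this

/-- Size of the projection of an orbit along the slow foliation onto the fast axis. -/
theorem fast_proj_size {g : ℕ} (hg : g ≤ S.r) {x y : E} (h : S.Slow g x y) (hy : S.P g y = 0)
    (n : ℕ) {ρ : ℝ} (hx : S.N n (S.Φ n x) ≤ ρ) :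
    S.N n (S.Φ n y) ≤ 3 * ρ ∧
      ∀ i, S.N (n + i) (S.Φ (n + i) y - S.Φ (n + i) x) ≤ 4 * ρ * S.lo g ^ i := by
  obtain ⟨h1, h2⟩ := h.bound hg n
  have h3 := (S.fast_bound hg (x := 0) (y := y) (by rw [sub_zero, hy]) n).1
  rw [Φ_at_zero, sub_zero] at h3
  have h4 := S.N_sub n (S.P g (S.Φ n y)) (S.P g (S.Φ n x))
  rw [← map_sub (S.P g)] at h4
  have h5 := S.N_P g n (S.Φ n x)
  have h6 := S.N_Q g n (S.Φ n x)
  have h7 := S.N_add n (S.Φ n y - S.Φ n x - S.P g (S.Φ n y - S.Φ n x))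
    (S.Φ n x - S.P g (S.Φ n x))
  have e : S.Φ n y - S.Φ n x - S.P g (S.Φ n y - S.Φ n x) + (S.Φ n x - S.P g (S.Φ n x)) =
      S.Φ n y - S.P g (S.Φ n y) := by rw [map_sub (S.P g)]; abel
  rw [e] at h7
  have h8 := S.N_le_PQ g n (S.Φ n y)
  have k0 := S.κ_nonneg
  have k1 := S.κ_le
  set a := S.N n (S.P g (S.Φ n y - S.Φ n x))
  have ha0 : 0 ≤ a := S.N_nonneg _ _
  have hρ : 0 ≤ ρ := (S.N_nonneg _ _).trans hx
  have hq : S.N n (S.Φ n y - S.P g (S.Φ n y)) ≤ 1 / 2000 * a + ρ := by nlinarith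
  have hp : S.N n (S.P g (S.Φ n y)) ≤ 1 / 2000 * (1 / 2000 * a + ρ) := by
    refine h3.trans (mul_le_mul k1 hq (S.N_nonneg _ _) (by norm_num))
  have ha : a ≤ 2 * ρ := by linarith
  refine ⟨by linarith, fun i => (h2 i).trans ?_⟩
  exact mul_le_mul_of_nonneg_right (by linarith) (pow_pos (S.lo_nonneg hg) i).le

/-- Distortion of the projection along the slow foliation onto the fast axis. -/
theorem fast_proj_diff {g : ℕ} (hg : g ≤ S.r) {x x' y y' : E} (h : S.Slow g x y)
    (h' : S.Slow g x' y') (hy : S.P g y = 0) (hy' : S.P g y' = 0) (n : ℕ) {ρ D β γ : ℝ}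
    (hx : S.N n (S.Φ n x) ≤ ρ) (hβ : 0 ≤ β) (hβγ : S.lo g * β ≤ γ) (hγ₁ : S.lo g ≤ γ)
    (hγ₂ : γ ≤ S.hi g)
    (hD : ∀ i, S.N (n + i) (S.Φ (n + i) x' - S.Φ (n + i) x) ≤ D * β ^ i) :
    let σ := 8 * S.L * ρ * D / S.δ
    let t := fun j => S.Φ j y' - S.Φ j y - (S.Φ j x' - S.Φ j x)
    S.N n (t n - S.P g (t n)) ≤ 2 * S.κ * (D + σ) + σ ∧
    S.N n (S.P g (S.Φ n y' - S.Φ n y)) ≤ 2 * S.κ * (D + σ) + σ ∧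
    ∀ i, S.N (n + i) (t (n + i)) ≤ (4 * D + 4 * σ) * γ ^ i := by
  intro σ t
  have hρ : 0 ≤ ρ := (S.N_nonneg _ _).trans hx
  have hD0 : 0 ≤ D := by have := (S.N_nonneg _ _).trans (hD 0); simpa using this
  have hL := S.L_nonneg
  have hδ := S.δ_pos
  have hσ : 0 ≤ σ := by positivity
  obtain ⟨-, hsz⟩ := S.fast_proj_size hg h hy n hx
  obtain ⟨C, hC⟩ := h
  obtain ⟨C', hC'⟩ := h'
  have hfw := S.forward_bound hg (γ := γ) (by linarith) (by linarith)
    (t := fun i => t (n + i)) (n := n) (σ := 4 * S.L * ρ * D) (μ := S.lo g - S.δ)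
    (C := (C + C') * (S.lo g - S.δ) ^ n) (by positivity) (S.lo_sub_pos hg).le (by linarith)
    (fun i => by
      rw [mul_assoc, ← pow_add]
      have h1 := S.N_sub (n + i) (S.Φ (n + i) y' - S.Φ (n + i) x')
        (S.Φ (n + i) y - S.Φ (n + i) x)
      have e : S.Φ (n + i) y' - S.Φ (n + i) x' - (S.Φ (n + i) y - S.Φ (n + i) x) =
        t (n + i) := by simp only [t]; abel
      rw [e] at h1
      linarith [hC (n + i), hC' (n + i)])
    (fun i => by
      have h1 := S.f_double (n + i) (S.Φ (n + i) x) (S.Φ (n + i) x') (S.Φ (n + i) y)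
        (S.Φ (n + i) y')
      have e : t (n + (i + 1)) - t (n + i) = S.f (n + i) (S.Φ (n + i) y') -
          S.f (n + i) (S.Φ (n + i) y) - (S.f (n + i) (S.Φ (n + i) x') -
          S.f (n + i) (S.Φ (n + i) x)) := by
        simp only [t, ← add_assoc, Φ_succ]; abel
      rw [e]
      refine h1.trans ?_
      have h2 : S.L * S.N (n + i) (S.Φ (n + i) y - S.Φ (n + i) x) *
          S.N (n + i) (S.Φ (n + i) x' - S.Φ (n + i) x) ≤
          S.L * (4 * ρ * S.lo g ^ i) * (D * β ^ i) := by
        have := S.lo_nonneg hg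
        have := S.N_nonneg (n + i) (S.Φ (n + i) x' - S.Φ (n + i) x)
        gcongr
        · exact hsz i
        · exact hD i
      have h3 : (S.lo g * β) ^ i ≤ γ ^ i :=
        pow_le_pow_left₀ (mul_nonneg (S.lo_nonneg hg).le hβ) hβγ i
      have h4 := mul_le_mul_of_nonneg_left h3 (show 0 ≤ 4 * S.L * ρ * D by positivity)
      rw [mul_pow] at h4
      linarith)
  simp only [add_zero] at hfw
  have e1 : 2 * (4 * S.L * ρ * D) / S.δ = σ := by simp only [σ]; ring
  have e2 : 4 * (4 * S.L * ρ * D) / S.δ = 2 * σ := by simp only [σ]; ring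
  rw [e1, e2] at hfw
  obtain ⟨f1, f2⟩ := hfw
  have h3 := (S.fast_bound hg (x := y) (y := y') (by rw [map_sub, hy, hy', sub_zero]) n).1
  have hD' := hD 0
  simp only [add_zero, pow_zero, mul_one] at hD'
  have h5 := (S.N_P g n (S.Φ n x' - S.Φ n x)).trans hD'
  have h6 := (S.N_Q g n (S.Φ n x' - S.Φ n x)).trans hD'
  have h4 := S.N_sub n (S.P g (S.Φ n y' - S.Φ n y)) (S.P g (S.Φ n x' - S.Φ n x))
  rw [← map_sub (S.P g)] at h4
  change S.N n (S.P g (t n)) ≤ _ at h4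
  have h7 := S.N_add n (t n - S.P g (t n))
    (S.Φ n x' - S.Φ n x - S.P g (S.Φ n x' - S.Φ n x))
  have e : t n - S.P g (t n) + (S.Φ n x' - S.Φ n x - S.P g (S.Φ n x' - S.Φ n x)) =
      S.Φ n y' - S.Φ n y - S.P g (S.Φ n y' - S.Φ n y) := by
    simp only [t]; rw [map_sub (S.P g) (S.Φ n y' - S.Φ n y)]; abel
  rw [e] at h7
  have k0 := S.κ_nonneg
  have k1 := S.κ_le
  set a := S.N n (S.P g (t n))
  have ha0 : 0 ≤ a := S.N_nonneg _ _
  set q := S.N n (S.Φ n y' - S.Φ n y - S.P g (S.Φ n y' - S.Φ n y))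
  have hκa := mul_le_mul_of_nonneg_right k1 ha0
  have hq : q ≤ 1 / 2000 * a + σ + D := by linarith
  have hκq := mul_le_mul_of_nonneg_left hq k0
  have hκq' : S.κ * (1 / 2000 * a + σ + D) ≤ 1 / 2000 * (1 / 2000 * a + σ + D) := by gcongr
  have ha : a ≤ 2 * D + σ := by linarith
  have hκ2 := mul_le_mul_of_nonneg_left ha k0
  refine ⟨by nlinarith, by nlinarith, fun i => (f2 i).trans ?_⟩
  exact mul_le_mul_of_nonneg_right (by linarith) (pow_nonneg (by linarith [S.lo_nonneg hg]) i)

/-- Size of the projection of an orbit along the fast foliation onto the slow leaf of `0`. -/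
theorem slow_proj_size {g : ℕ} (hg : g ≤ S.r) {x y : E} (h : S.Slow g 0 y)
    (hy : S.P g (y - x) = 0) (n : ℕ) {ρ : ℝ} (hx : S.N n (S.Φ n x) ≤ ρ) :
    S.N n (S.Φ n y) ≤ 3 * ρ ∧
      ∀ j i, j + i = n → S.hi g ^ i * S.N j (S.Φ j y - S.Φ j x) ≤ 4 * ρ := by
  have h3 := (h.bound hg n).1
  rw [Φ_at_zero, sub_zero] at h3
  obtain ⟨h1, h2⟩ := S.fast_bound hg hy n
  have h4 := S.N_sub n (S.Φ n y - S.P g (S.Φ n y)) (S.Φ n x - S.P g (S.Φ n x))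
  have e0 : S.Φ n y - S.P g (S.Φ n y) - (S.Φ n x - S.P g (S.Φ n x)) =
    S.Φ n y - S.Φ n x - S.P g (S.Φ n y - S.Φ n x) := by rw [map_sub (S.P g)]; abel
  rw [e0] at h4
  have h5 := S.N_P g n (S.Φ n x)
  have h6 := S.N_Q g n (S.Φ n x)
  have h7 := S.N_add n (S.P g (S.Φ n y - S.Φ n x)) (S.P g (S.Φ n x))
  rw [← map_add (S.P g), sub_add_cancel] at h7
  have h8 := S.N_le_PQ g n (S.Φ n y)
  have k0 := S.κ_nonneg
  have k1 := S.κ_le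
  set a := S.N n (S.Φ n y - S.Φ n x - S.P g (S.Φ n y - S.Φ n x))
  have ha0 : 0 ≤ a := S.N_nonneg _ _
  have hρ : 0 ≤ ρ := (S.N_nonneg _ _).trans hx
  have hq : S.N n (S.P g (S.Φ n y)) ≤ 1 / 2000 * a + ρ := by nlinarith
  have hp : S.N n (S.Φ n y - S.P g (S.Φ n y)) ≤ 1 / 2000 * (1 / 2000 * a + ρ) := by
    refine h3.trans (mul_le_mul k1 hq (S.N_nonneg _ _) (by norm_num))
  have ha : a ≤ 2 * ρ := by linarith
  exact ⟨by linarith, fun j i hj => (h2 j i hj).trans (by linarith)⟩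

/-- Distortion of the projection along the fast foliation onto the slow leaf of `0`. -/
theorem slow_proj_diff {g : ℕ} (hg : g ≤ S.r) {x x' y y' : E} (h : S.Slow g 0 y)
    (h' : S.Slow g 0 y') (hy : S.P g (y - x) = 0) (hy' : S.P g (y' - x') = 0) (n : ℕ)
    {ρ D β γ : ℝ} (hx : S.N n (S.Φ n x) ≤ ρ) (hβγ : γ ≤ S.hi g * β)
    (hγ₁ : S.lo g ≤ γ) (hγ₂ : γ ≤ S.hi g)
    (hD : ∀ j i, j + i = n → β ^ i * S.N j (S.Φ j x' - S.Φ j x) ≤ D) :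
    let σ := 8 * S.L * ρ * D / S.δ
    let t := fun j => S.Φ j y' - S.Φ j y - (S.Φ j x' - S.Φ j x)
    S.N n (S.P g (t n)) ≤ 2 * S.κ * (D + σ) + σ ∧
    S.N n (S.Φ n y' - S.Φ n y - S.P g (S.Φ n y' - S.Φ n y)) ≤ 2 * S.κ * (D + σ) + σ ∧
    ∀ j i, j + i = n → γ ^ i * S.N j (t j) ≤ 4 * D + 4 * σ := by
  intro σ t
  have hρ : 0 ≤ ρ := (S.N_nonneg _ _).trans hx
  have hD' := hD n 0 rfl
  simp only [pow_zero, one_mul] at hD'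
  have hD0 : 0 ≤ D := (S.N_nonneg _ _).trans hD'
  have hL := S.L_nonneg
  have hδ := S.δ_pos
  have hσ : 0 ≤ σ := by positivity
  have hγ0 : 0 < γ := (S.lo_nonneg hg).trans_le hγ₁
  obtain ⟨-, hsz⟩ := S.slow_proj_size hg h hy n hx
  have hbw := S.backward_bound hg (γ := γ) (by linarith) (by linarith)
    (t := t) (n := n) (σ := 4 * S.L * ρ * D) (by positivity)
    (by
      have e : t 0 = y' - x' - (y - x) := by simp only [t, Φ_zero]; abel
      rw [e, map_sub, hy, hy', sub_zero])
    (fun j i hj => by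
      have h1 := S.f_double j (S.Φ j x) (S.Φ j x') (S.Φ j y) (S.Φ j y')
      have e : t (j + 1) - t j = S.f j (S.Φ j y') - S.f j (S.Φ j y) -
          (S.f j (S.Φ j x') - S.f j (S.Φ j x)) := by
        simp only [t, Φ_succ]; abel
      rw [e]
      refine (mul_le_mul_of_nonneg_left h1 (pow_pos hγ0 (i + 1)).le).trans ?_
      rw [mul_add]
      refine add_le_add le_rfl ?_
      have h2 := hsz j (i + 1) hj
      have h3 := hD j (i + 1) hj
      have h4 : γ ^ (i + 1) ≤ S.hi g ^ (i + 1) * β ^ (i + 1) := by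
        rw [← mul_pow]; exact pow_le_pow_left₀ hγ0.le hβγ _
      have hy0 := S.N_nonneg j (S.Φ j y - S.Φ j x)
      have hx0 := S.N_nonneg j (S.Φ j x' - S.Φ j x)
      have hβ0 : 0 ≤ β := by
        by_contra hβ
        nlinarith [S.hi_nonneg hg]
      have h5 : (S.hi g ^ (i + 1) * S.N j (S.Φ j y - S.Φ j x)) *
          (β ^ (i + 1) * S.N j (S.Φ j x' - S.Φ j x)) ≤ 4 * ρ * D :=
        mul_le_mul h2 h3 (by positivity) (by positivity)
      calc γ ^ (i + 1) * (S.L * S.N j (S.Φ j y - S.Φ j x) * S.N j (S.Φ j x' - S.Φ j x))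
          ≤ (S.hi g ^ (i + 1) * β ^ (i + 1)) *
            (S.L * S.N j (S.Φ j y - S.Φ j x) * S.N j (S.Φ j x' - S.Φ j x)) := by gcongr
        _ = S.L * ((S.hi g ^ (i + 1) * S.N j (S.Φ j y - S.Φ j x)) *
          (β ^ (i + 1) * S.N j (S.Φ j x' - S.Φ j x))) := by ring
        _ ≤ S.L * (4 * ρ * D) := by gcongr
        _ = _ := by ring)
  have e1 : 2 * (4 * S.L * ρ * D) / S.δ = σ := by simp only [σ]; ring
  have e2 : 4 * (4 * S.L * ρ * D) / S.δ = 2 * σ := by simp only [σ]; ring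
  rw [e1, e2] at hbw
  obtain ⟨f1, f2⟩ := hbw
  have h3 := ((h.symm.trans h').bound hg n).1
  have h5 := (S.N_P g n (S.Φ n x' - S.Φ n x)).trans hD'
  have h6 := (S.N_Q g n (S.Φ n x' - S.Φ n x)).trans hD'
  have h4 := S.N_sub n (S.Φ n y' - S.Φ n y - S.P g (S.Φ n y' - S.Φ n y))
    (S.Φ n x' - S.Φ n x - S.P g (S.Φ n x' - S.Φ n x))
  have e0 : S.Φ n y' - S.Φ n y - S.P g (S.Φ n y' - S.Φ n y) -
    (S.Φ n x' - S.Φ n x - S.P g (S.Φ n x' - S.Φ n x)) = t n - S.P g (t n) := by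
    simp only [t]; rw [map_sub (S.P g) (S.Φ n y' - S.Φ n y)]; abel
  rw [e0] at h4
  have h7 := S.N_add n (S.P g (t n)) (S.P g (S.Φ n x' - S.Φ n x))
  rw [← map_add (S.P g)] at h7
  have e : t n + (S.Φ n x' - S.Φ n x) = S.Φ n y' - S.Φ n y := by simp only [t]; abel
  rw [e] at h7
  have k0 := S.κ_nonneg
  have k1 := S.κ_le
  set a := S.N n (t n - S.P g (t n))
  have ha0 : 0 ≤ a := S.N_nonneg _ _
  set q := S.N n (S.P g (S.Φ n y' - S.Φ n y))
  have hκa := mul_le_mul_of_nonneg_right k1 ha0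
  have hq : q ≤ 1 / 2000 * a + σ + D := by linarith
  have hκq := mul_le_mul_of_nonneg_left hq k0
  have hκq' : S.κ * (1 / 2000 * a + σ + D) ≤ 1 / 2000 * (1 / 2000 * a + σ + D) := by gcongr
  have ha : a ≤ 2 * D + σ := by linarith
  have hκ2 := mul_le_mul_of_nonneg_left ha k0
  exact ⟨by nlinarith, by nlinarith, fun j i hj => (f2 j i hj).trans (by linarith)⟩

end FD
end Sys

namespace Sys
variable (S : Sys E)

/-- The projection onto the `i`-th spectral band. -/
def band (i : ℕ) : E →L[ℝ] E := S.P (i + 1) - S.P i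

theorem band_apply (i : ℕ) (x : E) : S.band i x = S.P (i + 1) x - S.P i x := rfl

theorem P_band_of_le {i g : ℕ} (h : g ≤ i) (x : E) : S.P g (S.band i x) = 0 := by
  rw [band_apply, map_sub, S.P_comp, S.P_comp, min_eq_left h, min_eq_left (by omega), sub_self]

theorem P_band_of_lt {i g : ℕ} (h : i < g) (x : E) : S.P g (S.band i x) = S.band i x := by
  rw [band_apply, map_sub, S.P_comp, S.P_comp, min_eq_right h.le, min_eq_right (by omega)]

theorem band_eq_Q (i : ℕ) (x : E) : S.band i x = S.P (i + 1) (x - S.P i x) := by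
  rw [band_apply, map_sub, S.P_comp, min_eq_right (by omega)]

theorem band_eq_P (i : ℕ) (x : E) :
    S.band i x = S.P (i + 1) x - S.P i (S.P (i + 1) x) := by
  rw [band_apply, S.P_comp, min_eq_left (by omega)]

theorem N_band_le_Q (i n : ℕ) (x : E) : S.N n (S.band i x) ≤ S.N n (x - S.P i x) := by
  rw [band_eq_Q]; exact S.N_P _ _ _

theorem N_band_le_P (i n : ℕ) (x : E) : S.N n (S.band i x) ≤ S.N n (S.P (i + 1) x) := by
  rw [band_eq_P]; exact S.N_Q _ _ _

theorem N_band (i n : ℕ) (x : E) : S.N n (S.band i x) ≤ S.N n x :=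
  (S.N_band_le_P i n x).trans (S.N_P _ _ _)

theorem sum_band (a : ℕ) (x : E) : ∑ i ∈ Finset.range a, S.band i x = S.P a x := by
  simp only [band_apply]
  rw [Finset.sum_range_sub (fun i => S.P i x), S.P_zero]
  simp

theorem sum_band_Ico (x : E) : ∑ i ∈ Finset.Ico S.k S.r, S.band i x = x - S.P S.k x := by
  rw [Finset.sum_Ico_eq_sub _ S.k_le, sum_band, sum_band, S.P_r]

theorem lo_mono {i j : ℕ} (h : i ≤ j) (hj : j ≤ S.r) : S.lo i ≤ S.lo j := by
  induction j, h using Nat.le_induction with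
  | base => exact le_rfl
  | succ j h ih =>
    exact (ih (by omega)).trans ((S.lo_lt_hi j (by omega)).le.trans (S.hi_le_lo j (by omega)))

theorem hi_mono {i j : ℕ} (h : i ≤ j) (hj : j ≤ S.r) : S.hi i ≤ S.hi j := by
  induction j, h using Nat.le_induction with
  | base => exact le_rfl
  | succ j h ih =>
    exact (ih (by omega)).trans ((S.hi_le_lo j (by omega)).trans (S.lo_lt_hi _ hj).le)

section FD
variable [FiniteDimensional ℝ E]

/-- Projection along the `g`-slow foliation onto the fast axis. -/
def q (g : ℕ) (x : E) : E := S.leaf g x 0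

/-- Projection along the fast directions onto the `g`-slow leaf of the origin. -/
def p (g : ℕ) (x : E) : E := S.leaf g 0 x

variable {S}

theorem q_slow {g : ℕ} (hg : g ≤ S.r) (x : E) : S.Slow g x (S.q g x) := S.leaf_slow hg x 0
theorem P_q {g : ℕ} (hg : g ≤ S.r) (x : E) : S.P g (S.q g x) = 0 := by
  rw [q, S.P_leaf hg, map_zero]
theorem p_slow {g : ℕ} (hg : g ≤ S.r) (x : E) : S.Slow g 0 (S.p g x) := S.leaf_slow hg 0 x
theorem P_p {g : ℕ} (hg : g ≤ S.r) (x : E) : S.P g (S.p g x) = S.P g x := S.P_leaf hg 0 x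
theorem P_p_sub {g : ℕ} (hg : g ≤ S.r) (x : E) : S.P g (S.p g x - x) = 0 := by
  rw [map_sub, P_p hg, sub_self]

/-- `s` is the asymptotic `i`-th component of the orbit of `v`. -/
def IsShadow (S : Sys E) (i : ℕ) (v s : E) : Prop :=
  S.P i s = 0 ∧ S.P (i + 1) s = s ∧ ∃ C, ∀ j,
    S.N j (s - S.band i (S.Φ j (S.q i v) - S.Φ j (S.q (i + 1) v))) ≤ C * S.hi i ^ j

theorem exists_isShadow {i : ℕ} (hi : i < S.k) {v : E} (hv : S.Slow S.k 0 v) :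
    ∃ s, S.IsShadow i v s := by
  have hk := S.k_le
  set u := S.q i v with hu
  set w := S.q (i + 1) v with hw
  have hvu : S.Slow (i + 1) v u := (q_slow (by omega) v).mono (by omega)
    (S.lo_mono (by omega) (by omega))
  have hvw : S.Slow (i + 1) v w := q_slow (by omega) v
  have hlo := S.lo_mono (show i + 1 ≤ S.k by omega) hk
  have h1 := (hvw.symm.trans hvu).bound (by omega) 0
  have h2 := (hv.trans (hvu.mono (by omega) hlo)).bound hk 0
  have h3 := (hv.trans (hvw.mono (by omega) hlo)).bound hk 0
  obtain ⟨-, h1⟩ := h1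
  obtain ⟨-, h2⟩ := h2
  obtain ⟨-, h3⟩ := h3
  simp only [Φ_at_zero, sub_zero, zero_add] at h1 h2 h3
  set a := S.N 0 (S.P (i + 1) (S.Φ 0 u - S.Φ 0 w))
  set b := S.N 0 (S.P S.k (S.Φ 0 u))
  set c := S.N 0 (S.P S.k (S.Φ 0 w))
  have ha : 0 ≤ a := S.N_nonneg _ _
  have hb : 0 ≤ b := S.N_nonneg _ _
  have hc : 0 ≤ c := S.N_nonneg _ _
  set σ := S.L * (2 * (b + c)) * (2 * a)
  have hL := S.L_nonneg
  have hσ : 0 ≤ σ := by positivity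
  have hlok := S.lo_nonneg hk
  have hloi := S.lo_nonneg (show i + 1 ≤ S.r by omega)
  let C : ℕ → E := fun j => S.band i (S.Φ j u - S.Φ j w)
  have hstep : ∀ j, S.N (j + 1) (C (j + 1) - C j) ≤ σ * S.hi i ^ j := by
    intro j
    have e : C (j + 1) - C j = S.band i (S.f j (S.Φ j u) - S.f j (S.Φ j w)) := by
      simp only [C, ← map_sub, Φ_step]
    rw [e]
    refine (S.N_band _ _ _).trans ?_
    have hb1 : S.N j (S.Φ j w) ≤ 2 * (b + c) * S.lo S.k ^ j :=
      (h3 j).trans (mul_le_mul_of_nonneg_right (by linarith) (by positivity))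
    have hb2 : S.N j (S.Φ j u) ≤ 2 * (b + c) * S.lo S.k ^ j :=
      (h2 j).trans (mul_le_mul_of_nonneg_right (by linarith) (by positivity))
    refine (S.f_lip_local j hb1 hb2).trans ?_
    calc S.L * (2 * (b + c) * S.lo S.k ^ j) * S.N j (S.Φ j u - S.Φ j w)
        ≤ S.L * (2 * (b + c) * S.lo S.k ^ j) * (2 * a * S.lo (i + 1) ^ j) := by
          gcongr; exact h1 j
      _ = σ * (S.lo S.k * S.lo (i + 1)) ^ j := by rw [mul_pow]; ring
      _ ≤ σ * S.hi i ^ j := by gcongr; exact S.band_stable i hi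
  have hir : i ≤ S.r := by omega
  have hbd : ∀ m, ∀ j ≤ m, S.N j (C m - C j) ≤ 4 * σ / S.δ * S.hi i ^ j := by
    intro m j hj
    have := (S.finite_bound hir (γ := S.hi i) (by linarith [S.lo_lt_hi i hir, S.δ_pos])
      (by linarith [S.δ_pos]) (t := fun j => C m - C j) (n := 0) (m := m)
      (w := fun j => S.hi i ^ j) (σ := σ) (p₀ := 0) (q₁ := 0) hσ le_rfl le_rfl
      (fun j => pow_pos (S.hi_nonneg hir) j) (fun j => by ring)
      (fun l _ => by
        rw [sub_sub_sub_cancel_left, map_sub_rev, zero_add]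
        have := mul_nonneg S.η_nonneg (S.N_nonneg l (C m - C l))
        linarith [hstep l])
      (by simp [C, P_band_of_le])
      (by simp) j hj).2.2
    simpa using this
  obtain ⟨c1, hc1, hC1⟩ := exists_norm_le_seminorm (S.N 0) (S.pos 0)
  have : ProperSpace E := FiniteDimensional.proper_real E
  obtain ⟨z, -, φ, hφ, hz⟩ := tendsto_subseq_of_bounded
    (Metric.isBounded_closedBall (x := (0 : E))
      (r := c1 * (4 * σ / S.δ + S.N 0 (C 0)))) (x := C) (fun m => by
      rw [mem_closedBall_zero_iff]
      refine (hC1 _).trans (mul_le_mul_of_nonneg_left ?_ hc1.le)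
      have h1 := hbd m 0 (Nat.zero_le _)
      have h2 := S.N_add 0 (C m - C 0) (C 0)
      rw [pow_zero, mul_one] at h1
      rw [sub_add_cancel] at h2
      linarith)
  refine ⟨z, ?_, ?_, 4 * σ / S.δ, fun j => ?_⟩
  · refine tendsto_nhds_unique (((S.P i).continuous.tendsto z).comp hz) ?_
    simp only [Function.comp_def, C, P_band_of_le _ le_rfl]
    exact tendsto_const_nhds
  · refine tendsto_nhds_unique (((S.P (i + 1)).continuous.tendsto z).comp hz) ?_
    simp only [Function.comp_def, C, P_band_of_lt _ (Nat.lt_succ_self i)]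
    exact hz
  · have hc : Continuous fun z => S.N j (z - C j) :=
      (seminorm_continuous _).comp (continuous_id.sub continuous_const)
    refine le_of_tendsto ((hc.tendsto z).comp hz) ?_
    filter_upwards [eventually_ge_atTop j] with m hm
    exact hbd _ j (hm.trans (hφ.id_le m))

/-- The relative size of the nonlinear errors on a ball of radius `ρ`. -/
def err (S : Sys E) (ρ : ℝ) : ℝ :=
  (8 * S.κ + 2000 * (S.L * ρ / S.δ)) * (1 + 8 * (S.L * ρ / S.δ))

theorem orbit_bound {g : ℕ} (hg : g ≤ S.r) {x y : E} (h : S.Slow g x y) (n : ℕ) {D : ℝ}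
    (hD : S.N n (S.Φ n y - S.Φ n x) ≤ D) (i : ℕ) :
    S.N (n + i) (S.Φ (n + i) y - S.Φ (n + i) x) ≤ 2 * D * S.lo g ^ i := by
  refine ((h.bound hg n).2 i).trans ?_
  refine mul_le_mul_of_nonneg_right ?_ (pow_pos (S.lo_nonneg hg) i).le
  linarith [S.N_P g n (S.Φ n y - S.Φ n x)]

/-- Asymptotic components depend on the orbit through its current `i`-th component, up to a small
error; also a decay estimate for the deviation. -/
theorem shadow_diff {i : ℕ} (hi : i < S.k) {v v' s s' : E} (hv : S.Slow S.k 0 v)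
    (hv' : S.Slow S.k 0 v') (hs : S.IsShadow i v s) (hs' : S.IsShadow i v' s') (n : ℕ)
    {ρ D : ℝ} (hx : S.N n (S.Φ n v) ≤ ρ) (hx' : S.N n (S.Φ n v') ≤ ρ)
    (hD : S.N n (S.Φ n v' - S.Φ n v) ≤ D) :
    let e := S.L * ρ / S.δ
    (∀ j, S.N (n + j) (s' - s - (S.band i (S.Φ (n + j) (S.q i v') - S.Φ (n + j) (S.q (i + 1) v'))
      - S.band i (S.Φ (n + j) (S.q i v) - S.Φ (n + j) (S.q (i + 1) v)))) ≤
        2000 * e * (1 + 8 * e) * D * (S.hi i + S.δ) ^ j) ∧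
    S.N n (s' - s - S.band i (S.Φ n v' - S.Φ n v)) ≤ S.err ρ * D := by
  intro e
  have hk := S.k_le
  have hir : i ≤ S.r := by omega
  have hir' : i + 1 ≤ S.r := by omega
  have hρ : 0 ≤ ρ := (S.N_nonneg _ _).trans hx
  have hD0 : 0 ≤ D := (S.N_nonneg _ _).trans hD
  have hL := S.L_nonneg
  have hδ := S.δ_pos
  have he : 0 ≤ e := by positivity
  set u := S.q i v
  set w := S.q (i + 1) v
  set u' := S.q i v'
  set w' := S.q (i + 1) v'
  have hvu : S.Slow i v u := q_slow hir v
  have hvw : S.Slow (i + 1) v w := q_slow hir' v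
  have hvu' : S.Slow i v' u' := q_slow hir v'
  have hvw' : S.Slow (i + 1) v' w' := q_slow hir' v'
  have hlok := S.lo_nonneg hk
  have hlo1 := S.lo_nonneg hir'
  have hlo0 := S.lo_nonneg hir
  have hlo01 := S.lo_mono (show i ≤ i + 1 by omega) hir'
  have hlo1k := S.lo_mono (show i + 1 ≤ S.k by omega) hk
  have hΔ := orbit_bound hk (hv.symm.trans hv') n hD
  have hΔ1 : ∀ j, S.N (n + j) (S.Φ (n + j) v' - S.Φ (n + j) v) ≤ 2 * D * 1 ^ j := fun j =>
    (hΔ j).trans (by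
      have := pow_le_pow_left₀ hlok.le S.lo_k j
      gcongr)
  have hsz : ∀ j, S.N (n + j) (S.Φ (n + j) v) ≤ 2 * ρ * S.lo S.k ^ j := fun j => by
    simpa [Φ_at_zero] using orbit_bound hk hv n (D := ρ) (by simpa [Φ_at_zero] using hx) j
  have hsz' : ∀ j, S.N (n + j) (S.Φ (n + j) v') ≤ 2 * ρ * S.lo S.k ^ j := fun j => by
    simpa [Φ_at_zero] using orbit_bound hk hv' n (D := ρ) (by simpa [Φ_at_zero] using hx') j
  have su := fun j => (S.fast_proj_size hir hvu (P_q hir v) (n + j) (hsz j)).1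
  have su' := fun j => (S.fast_proj_size hir hvu' (P_q hir v') (n + j) (hsz' j)).1
  have sw := fun j => (S.fast_proj_size hir' hvw (P_q hir' v) (n + j) (hsz j)).1
  have sw' := fun j => (S.fast_proj_size hir' hvw' (P_q hir' v') (n + j) (hsz' j)).1
  have du := (S.fast_proj_size hir hvu (P_q hir v) n hx).2
  have dw := (S.fast_proj_size hir' hvw (P_q hir' v) n hx).2
  obtain ⟨du1, -, du3⟩ := S.fast_proj_diff hir hvu hvu' (P_q hir v) (P_q hir v') n hx zero_le_one
    (mul_one _).le le_rfl (S.lo_lt_hi i hir).le hΔ1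
  obtain ⟨-, dw2, dw3⟩ := S.fast_proj_diff hir' hvw hvw' (P_q hir' v) (P_q hir' v') n hx
    zero_le_one (mul_one _).le le_rfl (S.lo_lt_hi _ hir').le hΔ1
  have eσ : 8 * S.L * ρ * (2 * D) / S.δ = 16 * e * D := by simp only [e]; ring
  rw [eσ] at du1 du3 dw2 dw3
  set M := 2 * D * (1 + 8 * e) with hM
  have hM0 : 0 ≤ M := by positivity
  have eM : 4 * (2 * D) + 4 * (16 * e * D) = 4 * M := by rw [hM]; ring
  have eM' : 2 * D + 16 * e * D = M := by rw [hM]; ring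
  rw [eM] at du3 dw3
  rw [eM'] at du1 dw2
  let c : ℕ → E := fun j => S.band i (S.Φ j u' - S.Φ j w') - S.band i (S.Φ j u - S.Φ j w)
  have hc : ∀ j, c j = S.band i (S.Φ j u' - S.Φ j u - (S.Φ j w' - S.Φ j w)) := fun j => by
    simp only [c]; rw [← map_sub (S.band i)]; congr 1; abel
  have hcs : ∀ j, c (j + 1) - c j = S.band i (S.f j (S.Φ j u') - S.f j (S.Φ j u) -
      (S.f j (S.Φ j w') - S.f j (S.Φ j w))) := fun j => by
    rw [hc, hc, ← map_sub (S.band i), ← Φ_step, ← Φ_step]; congr 1; abel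
  have hsrc : ∀ j, S.N (n + j + 1) (c (n + j + 1) - c (n + j)) ≤
      240 * S.L * ρ * M * S.hi i ^ j := fun j => by
    rw [hcs]
    refine (S.N_band _ _ _).trans ((S.f_double_local _ _ _ _ _).trans ?_)
    have p1 : S.lo i ^ j ≤ S.lo (i + 1) ^ j := by gcongr
    have p2 : S.lo (i + 1) ^ j ≤ S.lo S.k ^ j := by gcongr
    have a1 := S.N_sub (n + j) (S.Φ (n + j) u' - S.Φ (n + j) u - (S.Φ (n + j) v' - S.Φ (n + j) v))
      (S.Φ (n + j) w' - S.Φ (n + j) w - (S.Φ (n + j) v' - S.Φ (n + j) v))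
    rw [sub_sub_sub_cancel_right] at a1
    have a2 := S.N_sub (n + j) (S.Φ (n + j) u - S.Φ (n + j) v) (S.Φ (n + j) w - S.Φ (n + j) v)
    rw [sub_sub_sub_cancel_right] at a2
    have a3 := S.N_add (n + j) (S.Φ (n + j) w' - S.Φ (n + j) w - (S.Φ (n + j) v' - S.Φ (n + j) v))
      (S.Φ (n + j) v' - S.Φ (n + j) v)
    rw [sub_add_cancel] at a3
    have b1 : S.N (n + j) (S.Φ (n + j) u' - S.Φ (n + j) u - (S.Φ (n + j) w' - S.Φ (n + j) w)) ≤
        8 * M * S.lo (i + 1) ^ j := by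
      have := du3 j
      have := dw3 j
      have := mul_le_mul_of_nonneg_left p1 (show 0 ≤ 4 * M by positivity)
      linarith
    have b2 : S.N (n + j) (S.Φ (n + j) u - S.Φ (n + j) w) ≤ 8 * ρ * S.lo (i + 1) ^ j := by
      have := du j
      have := dw j
      have := mul_le_mul_of_nonneg_left p1 (show 0 ≤ 4 * ρ by positivity)
      linarith
    have b3 : S.N (n + j) (S.Φ (n + j) w' - S.Φ (n + j) w) ≤ 5 * M * S.lo S.k ^ j := by
      have := dw3 j
      have := hΔ j
      have h1 := mul_le_mul_of_nonneg_left p2 (show 0 ≤ 4 * M by positivity)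
      have h2 : 2 * D * S.lo S.k ^ j ≤ M * S.lo S.k ^ j := by
        refine mul_le_mul_of_nonneg_right ?_ (by positivity)
        rw [hM]; nlinarith [mul_nonneg hD0 he]
      linarith
    have b4 : S.N (n + j) (S.Φ (n + j) w) + S.N (n + j) (S.Φ (n + j) w') +
        S.N (n + j) (S.Φ (n + j) u) + S.N (n + j) (S.Φ (n + j) u') ≤
        24 * ρ * S.lo S.k ^ j := by
      linarith [su j, su' j, sw j, sw' j]
    calc _ ≤ S.L * (24 * ρ * S.lo S.k ^ j) * (8 * M * S.lo (i + 1) ^ j) +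
          S.L * (8 * ρ * S.lo (i + 1) ^ j) * (5 * M * S.lo S.k ^ j) := by
          gcongr
      _ = 232 * S.L * ρ * M * (S.lo S.k * S.lo (i + 1)) ^ j := by rw [mul_pow]; ring
      _ ≤ 240 * S.L * ρ * M * S.hi i ^ j := by
          gcongr
          · norm_num
          · exact S.band_stable i hi
  obtain ⟨hs1, hs2, C, hC⟩ := hs
  obtain ⟨hs1', hs2', C', hC'⟩ := hs'
  have hτ : ∀ j, S.P i (s' - s - c j) = 0 := fun j => by
    rw [map_sub, map_sub, hs1, hs1', hc, S.P_band_of_le le_rfl]; simp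
  have hhi := S.hi_nonneg hir
  have hfw := S.forward_bound hir (γ := S.hi i + S.δ) (by linarith [S.lo_lt_hi i hir]) le_rfl
    (t := fun j => s' - s - c (n + j)) (n := n) (σ := 240 * S.L * ρ * M) (μ := S.hi i)
    (C := (C + C') * S.hi i ^ n) (by positivity) hhi.le (by linarith)
    (fun j => by
      rw [mul_assoc, ← pow_add]
      have h1 := S.N_sub (n + j) (s' - S.band i (S.Φ (n + j) u' - S.Φ (n + j) w'))
        (s - S.band i (S.Φ (n + j) u - S.Φ (n + j) w))
      rw [sub_sub_sub_comm] at h1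
      linarith [hC (n + j), hC' (n + j)])
    (fun j => by
      rw [sub_sub_sub_cancel_left, map_sub_rev, ← add_assoc]
      have h1 := mul_nonneg S.η_nonneg (S.N_nonneg (n + j) (s' - s - c (n + j)))
      have h2 : 240 * S.L * ρ * M * S.hi i ^ j ≤ 240 * S.L * ρ * M * (S.hi i + S.δ) ^ j := by
        gcongr; linarith
      linarith [hsrc j])
  simp only [add_zero, hτ, S.N_zero, mul_zero, zero_add] at hfw
  have e2 : 4 * (240 * S.L * ρ * M) / S.δ = 1920 * e * (1 + 8 * e) * D := by
    simp only [hM, e]; ring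
  rw [e2] at hfw
  obtain ⟨-, hfw⟩ := hfw
  have he2 : 1920 * e * (1 + 8 * e) * D ≤ 2000 * e * (1 + 8 * e) * D := by
    gcongr; norm_num
  refine ⟨fun j => (hfw j).trans ?_, ?_⟩
  · exact mul_le_mul_of_nonneg_right he2 (by positivity)
  · have h0 := hfw 0
    rw [add_zero, pow_zero, mul_one] at h0
    have h1 := (S.N_band_le_Q i n _).trans du1
    have h2 := (S.N_band_le_P i n _).trans dw2
    have h3 := S.N_sub n (S.band i (S.Φ n u' - S.Φ n u - (S.Φ n v' - S.Φ n v)))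
      (S.band i (S.Φ n w' - S.Φ n w))
    have h4 := S.N_add n (s' - s - c n) (S.band i (S.Φ n u' - S.Φ n u - (S.Φ n v' - S.Φ n v)) -
      S.band i (S.Φ n w' - S.Φ n w))
    have e3 : s' - s - c n + (S.band i (S.Φ n u' - S.Φ n u - (S.Φ n v' - S.Φ n v)) -
      S.band i (S.Φ n w' - S.Φ n w)) = s' - s - S.band i (S.Φ n v' - S.Φ n v) := by
      rw [hc]; simp only [map_sub]; abel
    rw [e3] at h4
    have e4 : S.err ρ * D = 4 * S.κ * M + 2000 * e * (1 + 8 * e) * D := by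
      simp only [err, hM, e]; ring
    have e5 : 0 ≤ e * e * D := by positivity
    rw [e4]
    nlinarith

end FD
end Sys

namespace Sys
variable {S : Sys E}
section FD
variable [FiniteDimensional ℝ E]

theorem orbit_bound_back {g : ℕ} (hg : g ≤ S.r) {x y : E} (h : S.P g (y - x) = 0) (n : ℕ)
    {D : ℝ} (hD : S.N n (S.Φ n y - S.Φ n x) ≤ D) (j i : ℕ) (hj : j + i = n) :
    S.hi g ^ i * S.N j (S.Φ j y - S.Φ j x) ≤ 2 * D := by
  refine ((S.fast_bound hg h n).2 j i hj).trans ?_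
  linarith [S.N_Q g n (S.Φ n y - S.Φ n x)]

set_option maxHeartbeats 1000000 in
/-- The unstable components of the conjugacy are close to the components of the orbit. -/
theorem unstable_diff {i : ℕ} (hki : S.k ≤ i) (hi : i < S.r) {u u' : E} (hu : S.P S.k u = 0)
    (hu' : S.P S.k u' = 0) (n : ℕ) {ρ D : ℝ} (hx : S.N n (S.Φ n u) ≤ ρ)
    (hx' : S.N n (S.Φ n u') ≤ ρ) (hD : S.N n (S.Φ n u' - S.Φ n u) ≤ D) :
    S.N n (S.band i (u' - S.p i u' - (u - S.p i u)) - S.band i (S.Φ n u' - S.Φ n u)) ≤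
      S.err ρ * D := by
  have hk := S.k_le
  have hir : i ≤ S.r := hi.le
  have hir' : i + 1 ≤ S.r := hi
  have hρ : 0 ≤ ρ := (S.N_nonneg _ _).trans hx
  have hD0 : 0 ≤ D := (S.N_nonneg _ _).trans hD
  have hL := S.L_nonneg
  have hδ := S.δ_pos
  set e := S.L * ρ / S.δ with he_def
  have he : 0 ≤ e := by positivity
  set y := S.p (i + 1) u
  set z := S.p i u
  set y' := S.p (i + 1) u'
  set z' := S.p i u'
  have hy : S.P (i + 1) (y - u) = 0 := P_p_sub hir' u
  have hz : S.P i (z - u) = 0 := P_p_sub hir u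
  have hy' : S.P (i + 1) (y' - u') = 0 := P_p_sub hir' u'
  have hz' : S.P i (z' - u') = 0 := P_p_sub hir u'
  have hhk := S.hi_nonneg hk
  have hh1 := S.hi_nonneg hir'
  have hh0 := S.hi_nonneg hir
  have hh01 := S.hi_mono (show i ≤ i + 1 by omega) hir'
  have hhk0 := S.hi_mono hki hir
  have hΔ := orbit_bound_back hk (x := u) (y := u') (by rw [map_sub, hu, hu', sub_zero]) n hD
  have hΔ1 : ∀ j l, j + l = n → (1 : ℝ) ^ l * S.N j (S.Φ j u' - S.Φ j u) ≤ 2 * D :=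
    fun j l hl => (mul_le_mul_of_nonneg_right (pow_le_pow_left₀ zero_le_one S.hi_k l)
      (S.N_nonneg _ _)).trans (hΔ j l hl)
  have hsz : ∀ j l, j + l = n → S.hi S.k ^ l * S.N j (S.Φ j u) ≤ 2 * ρ := fun j l hl => by
    simpa [Φ_at_zero] using orbit_bound_back hk (x := 0) (y := u) (by rw [sub_zero, hu]) n
      (D := ρ) (by simpa [Φ_at_zero] using hx) j l hl
  have hsz' : ∀ j l, j + l = n → S.hi S.k ^ l * S.N j (S.Φ j u') ≤ 2 * ρ := fun j l hl => by
    simpa [Φ_at_zero] using orbit_bound_back hk (x := 0) (y := u') (by rw [sub_zero, hu']) n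
      (D := ρ) (by simpa [Φ_at_zero] using hx') j l hl
  have sz : ∀ {g : ℕ} (hg : g ≤ S.r) {x : E}
      (h : ∀ j l, j + l = n → S.hi S.k ^ l * S.N j (S.Φ j x) ≤ 2 * ρ) (j l : ℕ) (hl : j + l = n),
      S.hi S.k ^ l * S.N j (S.Φ j (S.p g x)) ≤ 6 * ρ := by
    intro g hg x h j l hl
    have hp := pow_pos hhk l
    have h1 := (S.slow_proj_size hg (p_slow hg x) (P_p_sub hg x) j le_rfl).1
    nlinarith [h j l hl, mul_le_mul_of_nonneg_left h1 hp.le]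
  have sy := sz hir' hsz
  have sy' := sz hir' hsz'
  have sw := sz hir hsz
  have sw' := sz hir hsz'
  have dy := (S.slow_proj_size hir' (p_slow hir' u) hy n hx).2
  have dz := (S.slow_proj_size hir (p_slow hir u) hz n hx).2
  obtain ⟨dy1, -, dy3⟩ := S.slow_proj_diff hir' (p_slow hir' u) (p_slow hir' u') hy hy' n hx
    (mul_one _).ge (S.lo_lt_hi _ hir').le le_rfl hΔ1
  obtain ⟨-, dz2, dz3⟩ := S.slow_proj_diff hir (p_slow hir u) (p_slow hir u') hz hz' n hx
    (mul_one _).ge (S.lo_lt_hi _ hir).le le_rfl hΔ1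
  have eσ : 8 * S.L * ρ * (2 * D) / S.δ = 16 * e * D := by simp only [he_def]; ring
  rw [eσ] at dy1 dy3 dz2 dz3
  set M := 2 * D * (1 + 8 * e) with hM
  have hM0 : 0 ≤ M := by positivity
  have eM : 4 * (2 * D) + 4 * (16 * e * D) = 4 * M := by rw [hM]; ring
  have eM' : 2 * D + 16 * e * D = M := by rw [hM]; ring
  rw [eM] at dy3 dz3
  rw [eM'] at dy1 dz2
  let c : ℕ → E := fun j => S.band i (S.Φ j y' - S.Φ j y - (S.Φ j z' - S.Φ j z))
  have hcs : ∀ j, c (j + 1) - c j = S.band i (S.f j (S.Φ j y') - S.f j (S.Φ j y) -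
      (S.f j (S.Φ j z') - S.f j (S.Φ j z))) := fun j => by
    simp only [c]
    rw [← map_sub (S.band i), ← Φ_step, ← Φ_step]; congr 1; abel
  have hsrc : ∀ j l, j + l + 1 = n → S.lo (i + 1) ^ (l + 1) * S.N (j + 1) (c (j + 1) - c j) ≤
      240 * S.L * ρ * M := fun j l hl => by
    rw [hcs]
    have hb := (S.N_band i _ _).trans
      (S.f_double_local j (S.Φ j z) (S.Φ j z') (S.Φ j y) (S.Φ j y'))
    have p0 : S.lo (i + 1) ^ (l + 1) ≤ S.hi S.k ^ (l + 1) * S.hi i ^ (l + 1) := by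
      rw [← mul_pow]
      exact pow_le_pow_left₀ (S.lo_nonneg hir').le (S.band_unstable i hki hi) _
    have p1 : S.hi i ^ (l + 1) ≤ S.hi (i + 1) ^ (l + 1) := by gcongr
    have p2 : S.hi S.k ^ (l + 1) ≤ S.hi i ^ (l + 1) := by gcongr
    have q1 := sy j (l + 1) hl
    have q2 := sy' j (l + 1) hl
    have q3 := sw j (l + 1) hl
    have q4 := sw' j (l + 1) hl
    have q5 := dy j (l + 1) hl
    have q6 := dz j (l + 1) hl
    have q7 := dy3 j (l + 1) hl
    have q8 := dz3 j (l + 1) hl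
    have q9 := hΔ j (l + 1) hl
    set A := S.hi S.k ^ (l + 1)
    set B := S.hi i ^ (l + 1)
    set B' := S.hi (i + 1) ^ (l + 1)
    have hA : 0 < A := by positivity
    have hB : 0 < B := by positivity
    have a1 := S.N_sub j (S.Φ j y' - S.Φ j y - (S.Φ j u' - S.Φ j u))
      (S.Φ j z' - S.Φ j z - (S.Φ j u' - S.Φ j u))
    rw [sub_sub_sub_cancel_right] at a1
    have a2 := S.N_sub j (S.Φ j y - S.Φ j u) (S.Φ j z - S.Φ j u)
    rw [sub_sub_sub_cancel_right] at a2
    have a3 := S.N_add j (S.Φ j z' - S.Φ j z - (S.Φ j u' - S.Φ j u)) (S.Φ j u' - S.Φ j u)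
    rw [sub_add_cancel] at a3
    have b1 : B * S.N j (S.Φ j y' - S.Φ j y - (S.Φ j z' - S.Φ j z)) ≤ 8 * M := by
      have := mul_le_mul_of_nonneg_left a1 hB.le
      have := mul_le_mul_of_nonneg_right p1
        (S.N_nonneg j (S.Φ j y' - S.Φ j y - (S.Φ j u' - S.Φ j u)))
      linarith
    have b2 : B * S.N j (S.Φ j y - S.Φ j z) ≤ 8 * ρ := by
      have := mul_le_mul_of_nonneg_left a2 hB.le
      have := mul_le_mul_of_nonneg_right p1 (S.N_nonneg j (S.Φ j y - S.Φ j u))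
      linarith
    have b3 : A * S.N j (S.Φ j z' - S.Φ j z) ≤ 5 * M := by
      have := mul_le_mul_of_nonneg_left a3 hA.le
      have := mul_le_mul_of_nonneg_right p2
        (S.N_nonneg j (S.Φ j z' - S.Φ j z - (S.Φ j u' - S.Φ j u)))
      have : 2 * D ≤ M := by rw [hM]; nlinarith [mul_nonneg hD0 he]
      linarith
    have b4 : A * (S.N j (S.Φ j z) + S.N j (S.Φ j z') + S.N j (S.Φ j y) + S.N j (S.Φ j y')) ≤
        24 * ρ := by linarith
    set n1 := S.N j (S.Φ j y' - S.Φ j y - (S.Φ j z' - S.Φ j z))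
    set n2 := S.N j (S.Φ j y - S.Φ j z)
    set n3 := S.N j (S.Φ j z' - S.Φ j z)
    set n4 := S.N j (S.Φ j z) + S.N j (S.Φ j z') + S.N j (S.Φ j y) + S.N j (S.Φ j y')
    have g1 : 0 ≤ n1 := S.N_nonneg _ _
    have g2 : 0 ≤ n2 := S.N_nonneg _ _
    have g3 : 0 ≤ n3 := S.N_nonneg _ _
    have g4 : 0 ≤ n4 := by
      have := S.N_nonneg j
      simp only [n4]; linarith [this (S.Φ j z), this (S.Φ j z'), this (S.Φ j y), this (S.Φ j y')]
    have c1 := mul_le_mul b4 b1 (by positivity) (by positivity)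
    have c2 := mul_le_mul b2 b3 (by positivity) (by positivity)
    calc _ ≤ (A * B) * (S.L * n4 * n1 + S.L * n2 * n3) :=
          mul_le_mul p0 hb (S.N_nonneg _ _) (by positivity)
      _ = S.L * (A * n4 * (B * n1) + B * n2 * (A * n3)) := by ring
      _ ≤ S.L * (24 * ρ * (8 * M) + 8 * ρ * (5 * M)) := by gcongr
      _ ≤ 240 * S.L * ρ * M := by
        have : 0 ≤ S.L * ρ * M := by positivity
        nlinarith
  have hP : ∀ x, S.P (i + 1) (S.band i x) = S.band i x := fun x => S.P_band_of_lt (by omega) x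
  have hbw := S.backward_bound hir' (γ := S.lo (i + 1)) (by linarith)
    (by linarith [S.lo_lt_hi _ hir'])
    (t := fun j => c j - c 0) (n := n) (σ := 240 * S.L * ρ * M) (by positivity)
    (by simp)
    (fun j l hl => by
      rw [sub_sub_sub_cancel_right]
      have h1 := hsrc j l hl
      have h2 : 0 ≤ S.lo (i + 1) ^ (l + 1) * (S.η * S.N j (c j - c 0)) :=
        mul_nonneg (pow_nonneg (S.lo_nonneg hir').le _)
          (mul_nonneg S.η_nonneg (S.N_nonneg _ _))
      linarith)
  have e2 : 4 * (240 * S.L * ρ * M) / S.δ = 1920 * e * (1 + 8 * e) * D := by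
    simp only [hM, he_def]; ring
  rw [e2] at hbw
  have h0 := hbw.2 n 0 rfl
  have e3 : S.P (i + 1) (c n - c 0) = c n - c 0 := by rw [map_sub]; simp only [c, hP]
  rw [e3, sub_self, S.N_zero, pow_zero] at h0
  have e4 : c 0 = S.band i (u' - z' - (u - z)) := by
    have h1 : ∀ x, S.band i (S.p (i + 1) x) = S.band i x := fun x => by
      rw [S.band_eq_P, P_p hir', ← S.band_eq_P]
    simp only [c, Φ_zero, map_sub]
    rw [h1, h1]; abel
  have h1 := (S.N_band_le_P i n _).trans dy1
  have h2 := (S.N_band_le_Q i n _).trans dz2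
  have h3 := S.N_sub n (S.band i (S.Φ n y' - S.Φ n y - (S.Φ n u' - S.Φ n u)))
    (S.band i (S.Φ n z' - S.Φ n z))
  have h4 := S.N_sub n (S.band i (S.Φ n y' - S.Φ n y - (S.Φ n u' - S.Φ n u)) -
      S.band i (S.Φ n z' - S.Φ n z)) (c n - c 0)
  have e5 : S.band i (S.Φ n y' - S.Φ n y - (S.Φ n u' - S.Φ n u)) -
      S.band i (S.Φ n z' - S.Φ n z) - (c n - c 0) =
      S.band i (u' - z' - (u - z)) - S.band i (S.Φ n u' - S.Φ n u) := by
    rw [e4]; simp only [c, map_sub]; abel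
  rw [e5] at h4
  have e6 : S.err ρ * D = 4 * S.κ * M + 2000 * e * (1 + 8 * e) * D := by
    simp only [err, hM, he_def]; ring
  have e7 : 0 ≤ e * e * D := by positivity
  have e8 : 0 ≤ e * D := by positivity
  rw [e6]
  nlinarith

end FD
end Sys

namespace Sys
variable {S : Sys E}
section FD
variable [FiniteDimensional ℝ E]

/-- The asymptotic `i`-th component of a point of the slow leaf of the origin. -/
def shadow (S : Sys E) (i : ℕ) (v : E) : E := Classical.epsilon fun s => S.IsShadow i v s

theorem shadow_spec {i : ℕ} (hi : i < S.k) {v : E} (hv : S.Slow S.k 0 v) :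
    S.IsShadow i v (S.shadow i v) := Classical.epsilon_spec (exists_isShadow hi hv)

/-- The conjugacy at time `0`. -/
def H (S : Sys E) (x : E) : E :=
  ∑ i ∈ Finset.range S.k, S.shadow i (S.p S.k x) +
    ∑ i ∈ Finset.Ico S.k S.r, S.band i (S.q S.k x - S.p i (S.q S.k x))

theorem p_diff (x x' : E) (n : ℕ) {ρ : ℝ} (hx : S.N n (S.Φ n x) ≤ ρ) :
    let D := S.N n (S.Φ n x' - S.Φ n x)
    let σ := 8 * S.L * ρ * D / S.δ
    S.N n (S.P S.k (S.Φ n (S.p S.k x') - S.Φ n (S.p S.k x) - (S.Φ n x' - S.Φ n x))) ≤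
      2 * S.κ * (D + σ) + σ ∧
    S.N n (S.Φ n (S.p S.k x') - S.Φ n (S.p S.k x)) ≤ 5 * D + 4 * σ := by
  intro D σ
  have hk := S.k_le
  obtain ⟨h1, -, h3⟩ := S.slow_proj_diff hk (p_slow hk x) (p_slow hk x') (P_p_sub hk x)
    (P_p_sub hk x') n hx (β := S.hi 0) (γ := S.lo S.k) (D := D) S.lo_le_mul le_rfl
    (S.lo_lt_hi _ hk).le (fun j i hj => by
      have := S.growth_lower_iter j i x x'
      rwa [hj] at this)
  have h4 := h3 n 0 rfl
  have h5 := S.N_add n (S.Φ n (S.p S.k x') - S.Φ n (S.p S.k x) - (S.Φ n x' - S.Φ n x))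
    (S.Φ n x' - S.Φ n x)
  rw [sub_add_cancel] at h5
  rw [pow_zero, one_mul] at h4
  exact ⟨h1, by linarith⟩

theorem q_diff (x x' : E) (n : ℕ) {ρ : ℝ} (hx : S.N n (S.Φ n x) ≤ ρ) :
    let D := S.N n (S.Φ n x' - S.Φ n x)
    let σ := 8 * S.L * ρ * D / S.δ
    let t := S.Φ n (S.q S.k x') - S.Φ n (S.q S.k x) - (S.Φ n x' - S.Φ n x)
    S.N n (t - S.P S.k t) ≤ 2 * S.κ * (D + σ) + σ ∧
    S.N n (S.Φ n (S.q S.k x') - S.Φ n (S.q S.k x)) ≤ 5 * D + 4 * σ := by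
  intro D σ t
  have hk := S.k_le
  obtain ⟨h1, -, h3⟩ := S.fast_proj_diff hk (q_slow hk x) (q_slow hk x') (P_q hk x)
    (P_q hk x') n hx (β := S.lo S.r) (γ := S.hi S.k) (D := D) (S.lo_nonneg le_rfl).le S.lo_mul
    (S.lo_lt_hi _ hk).le le_rfl (fun i => by
      have := S.growth_upper_iter n i x x'
      rwa [mul_comm] at this)
  have h4 := h3 0
  have h5 := S.N_add n (S.Φ n (S.q S.k x') - S.Φ n (S.q S.k x) - (S.Φ n x' - S.Φ n x))
    (S.Φ n x' - S.Φ n x)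
  rw [sub_add_cancel] at h5
  simp only [pow_zero, mul_one, add_zero] at h4
  exact ⟨h1, by linarith⟩

theorem N_sum (n : ℕ) {ι : Type*} (A : ι → E) (s : Finset ι) :
    S.N n (∑ i ∈ s, A i) ≤ ∑ i ∈ s, S.N n (A i) :=
  Finset.le_sum_of_subadditive _ (map_zero _).le (map_add_le_add _) _ _

/-- The conjugacy is near the time-`n` flow on small balls. -/
theorem H_near (n : ℕ) {ρ : ℝ} (hρ : 1000000 * ((S.r : ℝ) + 1) * (S.L * (3 * ρ) / S.δ) ≤ 1)
    {x x' : E} (hx : S.N n (S.Φ n x) ≤ ρ) (hx' : S.N n (S.Φ n x') ≤ ρ) :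
    S.N n (S.H x' - S.H x - (S.Φ n x' - S.Φ n x)) ≤ 1 / 2 * S.N n (S.Φ n x' - S.Φ n x) := by
  have hk := S.k_le
  have hρ0 : 0 ≤ ρ := (S.N_nonneg _ _).trans hx
  have hL := S.L_nonneg
  have hδ := S.δ_pos
  obtain ⟨p1, p2⟩ := p_diff x x' n hx
  obtain ⟨q1, q2⟩ := q_diff x x' n hx
  set D := S.N n (S.Φ n x' - S.Φ n x)
  have hD : 0 ≤ D := S.N_nonneg _ _
  set e := S.L * (3 * ρ) / S.δ with he_def
  have he : 0 ≤ e := by positivity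
  have eσ : 8 * S.L * ρ * D / S.δ = 8 / 3 * e * D := by simp only [he_def]; ring
  rw [eσ] at p1 p2 q1 q2
  have hr0 : (0 : ℝ) ≤ S.r := Nat.cast_nonneg _
  have hκ0 := S.κ_nonneg
  have hκ := S.κ_small
  have hκ1 := S.κ_le
  have he1 : e ≤ 1 / 1000000 := by nlinarith
  have hre : (S.r : ℝ) * e ≤ 1 / 1000000 := by nlinarith
  have hrκ : (S.r : ℝ) * S.κ ≤ 1 / 2000 := by nlinarith
  have heD : e * D ≤ 1 / 1000000 * D := mul_le_mul_of_nonneg_right he1 hD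
  have hv3 := (S.slow_proj_size hk (p_slow hk x) (P_p_sub hk x) n hx).1
  have hv3' := (S.slow_proj_size hk (p_slow hk x') (P_p_sub hk x') n hx').1
  have hu3 := (S.fast_proj_size hk (q_slow hk x) (P_q hk x) n hx).1
  have hu3' := (S.fast_proj_size hk (q_slow hk x') (P_q hk x') n hx').1
  set v := S.p S.k x
  set v' := S.p S.k x'
  set u := S.q S.k x
  set u' := S.q S.k x'
  have p2' : S.N n (S.Φ n v' - S.Φ n v) ≤ 6 * D := by linarith
  have q2' : S.N n (S.Φ n u' - S.Φ n u) ≤ 6 * D := by linarith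
  have herr : (S.r : ℝ) * (S.err (3 * ρ) * (6 * D)) ≤ 1 / 4 * D := by
    have h1 : (S.r : ℝ) * S.err (3 * ρ) ≤ 7 / 1000 := by
      have : (S.r : ℝ) * S.err (3 * ρ) = (8 * (S.r * S.κ) + 2000 * (S.r * e)) * (1 + 8 * e) := by
        simp only [err, he_def]; ring
      rw [this]
      calc _ ≤ (8 * (1 / 2000) + 2000 * (1 / 1000000)) * (1 + 8 * (1 / 1000000) : ℝ) := by
            gcongr
        _ ≤ _ := by norm_num
    calc _ = (S.r : ℝ) * S.err (3 * ρ) * (6 * D) := by ring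
      _ ≤ 7 / 1000 * (6 * D) := by gcongr
      _ ≤ _ := by linarith
  set A : ℕ → E := fun i => S.shadow i v' - S.shadow i v - S.band i (S.Φ n v' - S.Φ n v)
  set B : ℕ → E := fun i => S.band i (u' - S.p i u' - (u - S.p i u)) -
    S.band i (S.Φ n u' - S.Φ n u)
  have hA : ∀ i ∈ Finset.range S.k, S.N n (A i) ≤ S.err (3 * ρ) * (6 * D) := fun i hi => by
    have hi := Finset.mem_range.1 hi
    exact (shadow_diff hi (p_slow hk x) (p_slow hk x') (shadow_spec hi (p_slow hk x))
      (shadow_spec hi (p_slow hk x')) n hv3 hv3' p2').2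
  have hB : ∀ i ∈ Finset.Ico S.k S.r, S.N n (B i) ≤ S.err (3 * ρ) * (6 * D) := fun i hi => by
    have hi := Finset.mem_Ico.1 hi
    exact unstable_diff hi.1 hi.2 (P_q hk x) (P_q hk x') n hu3 hu3' q2'
  have hA' := (N_sum n A (Finset.range S.k)).trans (Finset.sum_le_sum hA)
  have hB' := (N_sum n B (Finset.Ico S.k S.r)).trans (Finset.sum_le_sum hB)
  rw [Finset.sum_const, Finset.card_range, nsmul_eq_mul] at hA'
  rw [Finset.sum_const, Nat.card_Ico, nsmul_eq_mul, Nat.cast_sub hk] at hB'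
  set tp := S.Φ n v' - S.Φ n v - (S.Φ n x' - S.Φ n x)
  set tq := S.Φ n u' - S.Φ n u - (S.Φ n x' - S.Φ n x)
  have e1 : S.H x' - S.H x - (S.Φ n x' - S.Φ n x) = (∑ i ∈ Finset.range S.k, A i +
      ∑ i ∈ Finset.Ico S.k S.r, B i) + (S.P S.k tp + (tq - S.P S.k tq)) := by
    have a1 : ∑ i ∈ Finset.range S.k, A i = ∑ i ∈ Finset.range S.k, S.shadow i v' -
        ∑ i ∈ Finset.range S.k, S.shadow i v - S.P S.k (S.Φ n v' - S.Φ n v) := by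
      simp only [A, Finset.sum_sub_distrib, sum_band]
    have a2 : ∑ i ∈ Finset.Ico S.k S.r, B i = ∑ i ∈ Finset.Ico S.k S.r, S.band i (u' - S.p i u') -
        ∑ i ∈ Finset.Ico S.k S.r, S.band i (u - S.p i u) -
        (S.Φ n u' - S.Φ n u - S.P S.k (S.Φ n u' - S.Φ n u)) := by
      simp only [B, Finset.sum_sub_distrib, sum_band_Ico]
      simp only [map_sub, Finset.sum_sub_distrib]
    rw [a1, a2]
    simp only [tp, tq, map_sub, H]
    abel
  rw [e1]
  have m1 := S.N_add n (∑ i ∈ Finset.range S.k, A i + ∑ i ∈ Finset.Ico S.k S.r, B i)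
    (S.P S.k tp + (tq - S.P S.k tq))
  have m2 := S.N_add n (∑ i ∈ Finset.range S.k, A i) (∑ i ∈ Finset.Ico S.k S.r, B i)
  have m3 := S.N_add n (S.P S.k tp) (tq - S.P S.k tq)
  have hκD : S.κ * (D + 8 / 3 * e * D) ≤ 1 / 2000 * (D + 8 / 3 * e * D) :=
    mul_le_mul_of_nonneg_right hκ1 (by positivity)
  linarith

theorem eq_zero_of_fderiv_bound {g : ℕ} (hg : g ≤ S.r) {μ : ℝ} (hμ₁ : S.lo g ≤ μ)
    (hμ₂ : μ ≤ S.hi g) {y w : E} (hP : S.P g w = 0)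
    (h : ∃ C, ∀ j, S.N j (fderiv ℝ (S.Φ j) y w) ≤ C * μ ^ j) : w = 0 := by
  obtain ⟨C, hC⟩ := h
  have e0 : fderiv ℝ (S.Φ 0) y w = w := by
    rw [show S.Φ 0 = id from rfl, fderiv_id, ContinuousLinearMap.id_apply]
  have := (S.forward_bound hg (γ := μ + S.δ) (by linarith [S.δ_pos]) (by linarith)
    (t := fun j => fderiv ℝ (S.Φ j) y w) (n := 0) (σ := 0) (C := C) (μ := μ) le_rfl
    (by linarith [S.lo_nonneg hg]) (by linarith [S.δ_pos])
    (fun j => by simpa using hC j)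
    (fun j => by simpa using S.fderiv_Φ_step_le j y w)).2 0
  simp only [e0, hP, S.N_zero] at this
  refine S.pos 0 w (le_antisymm ?_ (S.N_nonneg _ _))
  simpa using this

theorem exists_lip_P (S : Sys E) (g : ℕ) :
    ∃ C, 0 < C ∧ ∀ θ θ', S.N 0 (S.P g (θ' - θ)) ≤ C * ‖θ' - θ‖ := by
  obtain ⟨C, hC, h⟩ := exists_seminorm_le_norm (S.N 0)
  exact ⟨C, hC, fun θ θ' => (S.N_P g 0 _).trans (h _)⟩

theorem p_diff_zero {g : ℕ} (hg : g ≤ S.r) (θ θ' : E) (j : ℕ) :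
    S.N j (S.Φ j (S.p g θ') - S.Φ j (S.p g θ)) ≤ 2 * S.N 0 (S.P g (θ' - θ)) * S.lo g ^ j := by
  have := (((p_slow hg θ).symm.trans (p_slow hg θ')).bound hg 0).2 j
  rwa [Φ_zero, Φ_zero, map_sub (S.P g), P_p hg, P_p hg, ← map_sub (S.P g), zero_add] at this

theorem p_contDiff {g : ℕ} (hg : g ≤ S.r) : ContDiff ℝ 1 (S.p g) := by
  obtain ⟨C, hC, hC1⟩ := exists_lip_P S g
  obtain ⟨C', hC', hC1'⟩ := exists_norm_le_seminorm (S.N 0) (S.pos 0)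
  have hlo := S.lo_nonneg hg
  refine contDiff_of_implicit (T := S.Φ) (X := fun _ _ => (0 : E)) (ν := S.N)
    (c := fun j => S.lo g ^ j) (fun j => by positivity) (R := S.P g) (ξ := fun θ => S.P g θ)
    S.Φ_contDiff (fun _ => contDiff_const) (S.P g).contDiff (fun θ => P_p hg θ)
    (fun ρ => ⟨C' * (2 * C), fun θ θ' _ _ => ?_⟩)
    (fun ρ => ⟨2 * C, fun j θ θ' _ _ => ?_⟩)
    (fun θ w hw h => eq_zero_of_fderiv_bound hg le_rfl (S.lo_lt_hi g hg).le hw h)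
  · have h1 := p_diff_zero hg θ θ' 0
    rw [pow_zero, mul_one, Φ_zero, Φ_zero] at h1
    calc _ ≤ C' * S.N 0 (S.p g θ' - S.p g θ) := hC1' _
      _ ≤ C' * (2 * (C * ‖θ' - θ‖)) := by
        gcongr; exact h1.trans (by linarith [hC1 θ θ'])
      _ = _ := by ring
  · have h1 := p_diff_zero hg θ θ' j
    rw [sub_self, sub_zero]
    calc _ ≤ 2 * S.N 0 (S.P g (θ' - θ)) * S.lo g ^ j := h1
      _ ≤ 2 * (C * ‖θ' - θ‖) * S.lo g ^ j := by gcongr; exact hC1 θ θ'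
      _ = _ := by ring

theorem q_comp_contDiff {g : ℕ} (hg : g ≤ S.r) {x : E → E} (hx : ContDiff ℝ 1 x) {β γ C : ℝ}
    (hβ : 0 ≤ β) (hβγ : S.lo g * β ≤ γ) (hγ₁ : S.lo g ≤ γ) (hγ₂ : γ ≤ S.hi g)
    (hC : 0 ≤ C)
    (hxβ : ∀ θ θ' j, S.N j (S.Φ j (x θ') - S.Φ j (x θ)) ≤ C * ‖θ' - θ‖ * β ^ j) :
    ContDiff ℝ 1 fun θ => S.q g (x θ) := by
  obtain ⟨C', hC', hC1'⟩ := exists_norm_le_seminorm (S.N 0) (S.pos 0)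
  have hL := S.L_nonneg
  have hδ := S.δ_pos
  have hγ : 0 < γ := (S.lo_nonneg hg).trans_le hγ₁
  let ρ' : ℝ → ℝ := fun ρ => S.N 0 (x 0) + C * ρ
  have hρ' : ∀ ρ θ, ‖θ‖ ≤ ρ → S.N 0 (x θ) ≤ ρ' ρ := fun ρ θ h => by
    have h1 := hxβ 0 θ 0
    rw [pow_zero, mul_one, Φ_zero, Φ_zero, sub_zero] at h1
    have h2 := S.N_add 0 (x θ - x 0) (x 0)
    rw [sub_add_cancel] at h2
    have := mul_le_mul_of_nonneg_left h hC
    simp only [ρ']; linarith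
  let M : ℝ → ℝ := fun ρ => 4 * C + 4 * (8 * S.L * ρ' ρ * C / S.δ)
  have key : ∀ ρ θ θ', ‖θ‖ ≤ ρ → ∀ j, S.N j (S.Φ j (S.q g (x θ')) - S.Φ j (S.q g (x θ)) -
      (S.Φ j (x θ') - S.Φ j (x θ))) ≤ M ρ * γ ^ j * ‖θ' - θ‖ := fun ρ θ θ' h j => by
    have := (S.fast_proj_diff hg (q_slow hg (x θ)) (q_slow hg (x θ')) (P_q hg _) (P_q hg _) 0
      (hρ' ρ θ h) hβ hβγ hγ₁ hγ₂ (D := C * ‖θ' - θ‖)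
      (fun i => by simpa using hxβ θ θ' i)).2.2 j
    rw [zero_add] at this
    refine this.trans (le_of_eq ?_)
    simp only [M]; ring
  refine contDiff_of_implicit (T := S.Φ) (X := fun j θ => S.Φ j (x θ)) (ν := S.N)
    (c := fun j => γ ^ j) (fun j => by positivity) (R := S.P g) (ξ := fun θ => (0 : E))
    S.Φ_contDiff (fun j => (S.Φ_contDiff j).comp hx) contDiff_const (fun θ => P_q hg _)
    (fun ρ => ⟨C' * (M ρ + C), fun θ θ' h _ => ?_⟩)
    (fun ρ => ⟨M ρ, fun j θ θ' h _ => key ρ θ θ' h j⟩)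
    (fun θ w hw h => eq_zero_of_fderiv_bound hg hγ₁ hγ₂ hw h)
  have h1 := key ρ θ θ' h 0
  have h2 := hxβ θ θ' 0
  simp only [pow_zero, mul_one, Φ_zero] at h1 h2
  have h3 := S.N_add 0 (S.q g (x θ') - S.q g (x θ) - (x θ' - x θ)) (x θ' - x θ)
  rw [sub_add_cancel] at h3
  calc _ ≤ C' * S.N 0 (S.q g (x θ') - S.q g (x θ)) := hC1' _
    _ ≤ C' * ((M ρ + C) * ‖θ' - θ‖) := by gcongr; linarith
    _ = _ := by ring

theorem q_contDiff : ContDiff ℝ 1 (S.q S.k) := by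
  obtain ⟨C, hC, hC1⟩ := exists_seminorm_le_norm (S.N 0)
  have hlo := S.lo_nonneg (le_refl S.r)
  refine q_comp_contDiff S.k_le (x := fun θ => θ) contDiff_id hlo.le S.lo_mul
    (S.lo_lt_hi _ S.k_le).le le_rfl hC.le fun θ θ' j => ?_
  have := S.growth_upper_iter 0 j θ θ'
  rw [zero_add, Φ_zero, Φ_zero, mul_comm] at this
  exact this.trans (mul_le_mul_of_nonneg_right (hC1 _) (by positivity))

theorem q_p_contDiff {g : ℕ} (hg : g ≤ S.r) : ContDiff ℝ 1 fun θ => S.q g (S.p S.k θ) := by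
  have hk := S.k_le
  obtain ⟨C, hC, hC1⟩ := exists_lip_P S S.k
  refine q_comp_contDiff hg (p_contDiff hk) zero_le_one (mul_one _).le le_rfl
    (S.lo_lt_hi g hg).le (C := 2 * C) (by positivity) fun θ θ' j => ?_
  refine (p_diff_zero hk θ θ' j).trans ?_
  have := S.lo_nonneg hk
  calc _ ≤ 2 * (C * ‖θ' - θ‖) * 1 ^ j := by
        gcongr
        · exact hC1 θ θ'
        · exact S.lo_k
    _ = _ := by ring

theorem eq_zero_of_growth {g : ℕ} (hg : g ≤ S.r) {w : E} (hP : S.P g w = 0)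
    (h : ∃ C, ∀ j, S.N j w ≤ C * (S.hi g + S.δ) ^ j) : w = 0 := by
  obtain ⟨C, hC⟩ := h
  have hδ := S.δ_pos
  have hhi := S.hi_nonneg hg
  have hlow : ∀ j, (S.hi g + 2 * S.δ) ^ j * S.N 0 w ≤ S.N j w := fun j => by
    induction j with
    | zero => simp
    | succ j ih =>
      have h1 := S.rate_Q g hg j w
      rw [hP, sub_zero] at h1
      have h2 := mul_le_mul_of_nonneg_left ih (show 0 ≤ S.hi g + 2 * S.δ by linarith)
      rw [pow_succ]; linarith
  have hle : ∀ j : ℕ, S.N 0 w ≤ C * ((S.hi g + S.δ) / (S.hi g + 2 * S.δ)) ^ j := fun j => by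
    have hp : 0 < (S.hi g + 2 * S.δ) ^ j := by positivity
    rw [div_pow, ← mul_div_assoc, le_div_iff₀ hp]
    linarith [hlow j, hC j]
  have hlim := (tendsto_pow_atTop_nhds_zero_of_lt_one
    (show 0 ≤ (S.hi g + S.δ) / (S.hi g + 2 * S.δ) by positivity)
    ((div_lt_one (by positivity)).2 (by linarith))).const_mul C
  rw [mul_zero] at hlim
  exact S.pos 0 w (le_antisymm (ge_of_tendsto' hlim hle) (S.N_nonneg _ _))

theorem shadow_p_contDiff {i : ℕ} (hi : i < S.k) :
    ContDiff ℝ 1 fun θ => S.shadow i (S.p S.k θ) := by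
  have hk := S.k_le
  have hir : i ≤ S.r := by omega
  obtain ⟨C, hC, hC1⟩ := exists_lip_P S S.k
  obtain ⟨C', hC', hC1'⟩ := exists_norm_le_seminorm (S.N 0) (S.pos 0)
  have hL := S.L_nonneg
  have hδ := S.δ_pos
  have hhi := S.hi_nonneg hir
  have hp0 : S.p S.k 0 = 0 := S.leaf_eq hk (Slow.refl _ _) rfl
  have hlip : ∀ θ θ', S.N 0 (S.p S.k θ' - S.p S.k θ) ≤ 2 * C * ‖θ' - θ‖ := fun θ θ' => by
    have := p_diff_zero hk θ θ' 0
    rw [pow_zero, mul_one, Φ_zero, Φ_zero] at this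
    linarith [hC1 θ θ']
  have hsz : ∀ ρ θ, ‖θ‖ ≤ ρ → S.N 0 (S.p S.k θ) ≤ 2 * C * ρ := fun ρ θ h => by
    have := hlip 0 θ
    rw [hp0, sub_zero, sub_zero] at this
    exact this.trans (by gcongr)
  have key := fun ρ θ θ' (h : ‖θ‖ ≤ ρ) (h' : ‖θ'‖ ≤ ρ) =>
    shadow_diff hi (p_slow hk θ) (p_slow hk θ') (shadow_spec hi (p_slow hk θ))
      (shadow_spec hi (p_slow hk θ')) 0 (hsz ρ θ h) (hsz ρ θ' h') (hlip θ θ')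
  refine contDiff_of_implicit (T := fun _ y => y)
    (X := fun j θ => S.band i (S.Φ j (S.q i (S.p S.k θ)) - S.Φ j (S.q (i + 1) (S.p S.k θ))))
    (ν := S.N) (c := fun j => (S.hi i + S.δ) ^ j) (fun j => by positivity) (R := S.P i)
    (ξ := fun θ => (0 : E)) (fun _ => contDiff_id)
    (fun j => (S.band i).contDiff.comp
      (((S.Φ_contDiff j).comp (q_p_contDiff hir)).sub
        ((S.Φ_contDiff j).comp (q_p_contDiff (by omega)))))
    contDiff_const (fun θ => (shadow_spec hi (p_slow hk θ)).1)
    (fun ρ => ⟨C' * ((S.err (2 * C * ρ) + 1) * (2 * C)), fun θ θ' h h' => ?_⟩)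
    (fun ρ => ⟨2000 * (S.L * (2 * C * ρ) / S.δ) * (1 + 8 * (S.L * (2 * C * ρ) / S.δ)) * (2 * C),
      fun j θ θ' h h' => ?_⟩)
    (fun θ w hw h => eq_zero_of_growth hir hw (by simpa using h))
  · have h1 := (key ρ θ θ' h h').2
    simp only [Φ_zero] at h1
    have h2 := (S.N_band i 0 _).trans (hlip θ θ')
    have h3 := S.N_add 0 (S.shadow i (S.p S.k θ') - S.shadow i (S.p S.k θ) -
      S.band i (S.p S.k θ' - S.p S.k θ)) (S.band i (S.p S.k θ' - S.p S.k θ))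
    rw [sub_add_cancel] at h3
    calc _ ≤ C' * S.N 0 (S.shadow i (S.p S.k θ') - S.shadow i (S.p S.k θ)) := hC1' _
      _ ≤ C' * (S.err (2 * C * ρ) * (2 * C * ‖θ' - θ‖) + 2 * C * ‖θ' - θ‖) := by
        gcongr; linarith
      _ = _ := by ring
  · have h1 := (key ρ θ θ' h h').1 j
    rw [zero_add] at h1
    exact h1.trans (le_of_eq (by ring))

theorem H_contDiff : ContDiff ℝ 1 S.H := by
  refine (ContDiff.sum fun i hi => shadow_p_contDiff (Finset.mem_range.1 hi)).add
    (ContDiff.sum fun i hi => (S.band i).contDiff.comp (q_contDiff.sub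
      ((p_contDiff ?_).comp q_contDiff)))
  exact (Finset.mem_Ico.1 hi).2.le

end FD
end Sys

namespace Sys
variable {S : Sys E}
section FD
variable [FiniteDimensional ℝ E]

/-- The stable part of the conjugacy. -/
def stab (S : Sys E) (v : E) : E := ∑ i ∈ Finset.range S.k, S.shadow i v

/-- The unstable part of the conjugacy. -/
def unst (S : Sys E) (x : E) : E := x - ∑ i ∈ Finset.Ico S.k S.r, S.band i (S.p i x)

theorem q_of_slow {g : ℕ} (hg : g ≤ S.r) {v : E} (hv : S.Slow g 0 v) : S.q g v = 0 :=
  S.leaf_eq hg hv.symm rfl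

theorem p_of_slow {g : ℕ} (hg : g ≤ S.r) {v : E} (hv : S.Slow g 0 v) : S.p g v = v :=
  S.leaf_eq hg hv rfl

theorem p_at_zero {g : ℕ} (hg : g ≤ S.r) : S.p g 0 = 0 := p_of_slow hg (Slow.refl g 0)

theorem unst_at_zero : S.unst 0 = 0 := by
  rw [unst, Finset.sum_eq_zero, sub_zero]
  intro i hi
  rw [p_at_zero (Finset.mem_Ico.1 hi).2.le, map_zero]

theorem H_eq (x : E) : S.H x = S.stab (S.p S.k x) + S.unst (S.q S.k x) := by
  have h := S.sum_band_Ico (S.q S.k x)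
  rw [P_q S.k_le, sub_zero] at h
  simp only [H, stab, unst, map_sub, Finset.sum_sub_distrib, h]

theorem P_unst (x : E) : S.P S.k (S.unst x) = S.P S.k x := by
  rw [unst, map_sub, map_sum, Finset.sum_eq_zero, sub_zero]
  intro i hi
  exact S.P_band_of_le (Finset.mem_Ico.1 hi).1 _

theorem P_stab {v : E} (hv : S.Slow S.k 0 v) : S.P S.k (S.stab v) = S.stab v := by
  rw [stab, map_sum]
  refine Finset.sum_congr rfl fun i hi => ?_
  have hi := Finset.mem_range.1 hi
  have h := (shadow_spec hi hv).2.1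
  rw [← h, S.P_comp, min_eq_right (by omega)]

theorem P_H (x : E) : S.P S.k (S.H x) = S.stab (S.p S.k x) := by
  rw [H_eq, map_add, P_stab (p_slow S.k_le x), P_unst, P_q S.k_le, add_zero]

theorem H_of_slow {v : E} (hv : S.Slow S.k 0 v) : S.H v = S.stab v := by
  rw [H_eq, p_of_slow S.k_le hv, q_of_slow S.k_le hv, unst_at_zero, add_zero]

theorem H_sub_P_H (x : E) : S.H x - S.P S.k (S.H x) = S.unst (S.q S.k x) := by
  rw [P_H, H_eq, add_sub_cancel_left]

theorem unst_near (x x' : E) :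
    S.N 0 (S.unst x' - S.unst x - (x' - x)) ≤ 1 / 2 * S.N 0 (x' - x) := by
  have e : S.unst x' - S.unst x - (x' - x) =
      -∑ i ∈ Finset.Ico S.k S.r, S.band i (S.p i x' - S.p i x) := by
    simp only [unst, map_sub, Finset.sum_sub_distrib]
    abel
  rw [e, map_neg_eq_map]
  have h : ∀ i ∈ Finset.Ico S.k S.r, S.N 0 (S.band i (S.p i x' - S.p i x)) ≤
      S.κ * S.N 0 (x' - x) := fun i hi => by
    have hir := (Finset.mem_Ico.1 hi).2.le
    have h1 := (((p_slow hir x).symm.trans (p_slow hir x')).bound hir 0).1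
    rw [Φ_zero, Φ_zero] at h1
    refine ((S.N_band_le_Q i 0 _).trans h1).trans ?_
    rw [map_sub, P_p hir, P_p hir, ← map_sub]
    exact mul_le_mul_of_nonneg_left (S.N_P i 0 _) S.κ_nonneg
  have h2 := (N_sum 0 _ _).trans (Finset.sum_le_sum h)
  rw [Finset.sum_const, Nat.card_Ico, nsmul_eq_mul, Nat.cast_sub S.k_le] at h2
  refine h2.trans ?_
  rw [← mul_assoc]
  refine mul_le_mul_of_nonneg_right ?_ (S.N_nonneg _ _)
  have := S.κ_small
  nlinarith [S.κ_nonneg, mul_nonneg (Nat.cast_nonneg (α := ℝ) S.k) S.κ_nonneg,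
    mul_nonneg (Nat.cast_nonneg (α := ℝ) S.r) S.κ_nonneg]

theorem unst_lower (x x' : E) : S.N 0 (x' - x) ≤ 2 * S.N 0 (S.unst x' - S.unst x) := by
  have h1 := S.N_sub 0 (S.unst x' - S.unst x) (S.unst x' - S.unst x - (x' - x))
  rw [sub_sub_cancel] at h1
  linarith [unst_near (S := S) x x']

theorem exists_unst (w : E) : ∃ u, S.unst u = w := by
  have hc : Continuous S.unst := continuous_id.sub (continuous_finsetSum _ fun i hi =>
    (S.band i).continuous.comp (p_contDiff (Finset.mem_Ico.1 hi).2.le).continuous)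
  obtain ⟨x, -, h⟩ := exists_preimage_of_near_id (S.N 0) (S.pos 0) hc unst_at_zero
    (ρ := 2 * S.N 0 w) (s := w) (fun x y _ _ => unst_near x y) (by linarith)
  exact ⟨x, h⟩

variable (S) in
/-- Radii on which the conjugacy is near the flow. -/
def Radius (ρ : ℝ) : Prop :=
  0 < ρ ∧ 1000000 * ((S.r : ℝ) + 1) * (S.L * (3 * ρ) / S.δ) ≤ 1

variable (S) in
theorem exists_radius : ∃ ρ, S.Radius ρ := by
  have hL := S.L_nonneg
  have hδ := S.δ_pos
  refine ⟨S.δ / (3000000 * ((S.r : ℝ) + 1) * (S.L + 1)), by positivity, ?_⟩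
  have : 1000000 * ((S.r : ℝ) + 1) * (S.L * (3 * (S.δ / (3000000 * ((S.r : ℝ) + 1) * (S.L + 1))))
      / S.δ) = S.L / (S.L + 1) := by
    field_simp
    ring
  rw [this, div_le_one (by linarith)]
  linarith

theorem H_lower {ρ : ℝ} (hρ : S.Radius ρ) {n : ℕ} {x x' : E} (hx : S.N n (S.Φ n x) ≤ ρ)
    (hx' : S.N n (S.Φ n x') ≤ ρ) :
    S.N n (S.Φ n x' - S.Φ n x) ≤ 2 * S.N n (S.H x' - S.H x) := by
  have h1 := S.N_sub n (S.H x' - S.H x) (S.H x' - S.H x - (S.Φ n x' - S.Φ n x))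
  rw [sub_sub_cancel] at h1
  linarith [H_near n hρ.2 hx hx']

theorem H_upper {ρ : ℝ} (hρ : S.Radius ρ) {n : ℕ} {x x' : E} (hx : S.N n (S.Φ n x) ≤ ρ)
    (hx' : S.N n (S.Φ n x') ≤ ρ) :
    S.N n (S.H x' - S.H x) ≤ 2 * S.N n (S.Φ n x' - S.Φ n x) := by
  have h1 := S.N_add n (S.H x' - S.H x - (S.Φ n x' - S.Φ n x)) (S.Φ n x' - S.Φ n x)
  rw [sub_add_cancel] at h1
  linarith [H_near n hρ.2 hx hx', S.N_nonneg n (S.Φ n x' - S.Φ n x)]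

theorem Φ_eq_of_N {n : ℕ} {x x' : E} (h : S.N n (S.Φ n x' - S.Φ n x) = 0) : x' = x :=
  (S.Φe n).injective (sub_eq_zero.1 (S.pos n _ h))

theorem lo_sub_lt_one : S.lo S.k - S.δ < 1 := by linarith [S.lo_k, S.δ_pos]

theorem Slow.eventually_small {v : E} (hv : S.Slow S.k 0 v) {ρ : ℝ} (hρ : 0 < ρ) :
    ∀ᶠ n in atTop, S.N n (S.Φ n v) < ρ := by
  obtain ⟨C, hC⟩ := hv
  have h := (tendsto_pow_atTop_nhds_zero_of_lt_one (S.lo_sub_pos S.k_le).le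
    (lo_sub_lt_one (S := S))).const_mul C
  rw [mul_zero] at h
  filter_upwards [h.eventually_lt_const hρ] with n hn
  have := hC n
  rw [Φ_at_zero, sub_zero] at this
  exact this.trans_lt hn

theorem H_at_zero : S.H 0 = 0 := by
  rw [H_of_slow (Slow.refl _ _), stab]
  refine Finset.sum_eq_zero fun i hi => ?_
  have hi := Finset.mem_range.1 hi
  have hk := S.k_le
  have h0 := Slow.refl (S := S) S.k 0
  have hs : S.IsShadow i 0 0 := by
    refine ⟨map_zero _, map_zero _, 0, fun j => ?_⟩
    rw [q_of_slow (by omega) (Slow.refl _ _), q_of_slow (by omega) (Slow.refl _ _)]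
    simp
  have := (shadow_diff hi h0 h0 hs (shadow_spec hi h0) 0 (ρ := 0) (D := 0)
    (by rw [Φ_at_zero, S.N_zero]) (by rw [Φ_at_zero, S.N_zero])
    (by rw [Φ_at_zero, sub_zero, S.N_zero])).2
  rw [sub_self, map_zero, sub_zero, sub_zero, mul_zero] at this
  exact S.pos 0 _ (le_antisymm this (S.N_nonneg _ _))

theorem H_preimage {ρ : ℝ} (hρ : S.Radius ρ) {n : ℕ} {s : E} (hs : S.N n s ≤ ρ / 2) :
    ∃ x, S.N n (S.Φ n x) ≤ ρ ∧ S.H x = s := by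
  have hΦ : ∀ z, S.Φ n ((S.Φe n).symm z) = z := (S.Φe n).apply_symm_apply
  obtain ⟨y, hy, h⟩ := exists_preimage_of_near_id (S.N n) (S.pos n)
    (g := fun z => S.H ((S.Φe n).symm z)) (ρ := ρ) (s := s)
    (H_contDiff.continuous.comp (S.Φe_symm_contDiff n).continuous)
    (by rw [(S.Φe n).symm_apply_eq.2 (S.Φ_at_zero n).symm, H_at_zero])
    (fun x y hx hy => by
      have := H_near n hρ.2 (x := (S.Φe n).symm x) (x' := (S.Φe n).symm y)
        (by rwa [hΦ]) (by rwa [hΦ])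
      rwa [hΦ, hΦ] at this) hs
  exact ⟨_, by rwa [hΦ], h⟩

theorem H_injective : Function.Injective S.H := by
  intro x x' h
  obtain ⟨ρ, hρ⟩ := S.exists_radius
  have hv := p_slow S.k_le x
  have hv' := p_slow S.k_le x'
  have h1 : S.H (S.p S.k x) = S.H (S.p S.k x') := by
    rw [H_of_slow hv, H_of_slow hv', ← P_H, ← P_H, h]
  obtain ⟨n, hn, hn'⟩ := ((hv.eventually_small hρ.1).and (hv'.eventually_small hρ.1)).exists
  have h2 := H_lower hρ hn.le hn'.le
  rw [h1, sub_self, S.N_zero, mul_zero] at h2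
  have h3 : S.p S.k x' = S.p S.k x := Φ_eq_of_N (le_antisymm h2 (S.N_nonneg _ _))
  have h4 := unst_lower (S := S) (S.q S.k x) (S.q S.k x')
  rw [← H_sub_P_H, ← H_sub_P_H, h, sub_self, S.N_zero, mul_zero] at h4
  have h5 : S.q S.k x' = S.q S.k x :=
    sub_eq_zero.1 (S.pos 0 _ (le_antisymm h4 (S.N_nonneg _ _)))
  refine Slow.unique S.k_le ((q_slow S.k_le x).trans ?_) ?_
  · rw [← h5]; exact (q_slow S.k_le x').symm
  · rw [← P_p S.k_le x, ← P_p S.k_le x', h3]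

theorem H_surjective : Function.Surjective S.H := by
  intro y
  obtain ⟨ρ, hρ⟩ := S.exists_radius
  have hk := S.k_le
  have hdecay : ∀ n, S.N n (S.P S.k y) ≤ S.N 0 (S.P S.k y) * (S.lo S.k - S.δ) ^ n := fun n => by
    induction n with
    | zero => simp
    | succ n ih =>
      refine (S.rate_P S.k hk n y).trans ?_
      rw [pow_succ]
      have h1 := mul_le_mul_of_nonneg_left ih (S.lo_sub_pos hk).le
      have h2 := mul_nonneg S.δ_pos.le (S.N_nonneg n (S.P S.k y))
      linarith
  have hlim := (tendsto_pow_atTop_nhds_zero_of_lt_one (S.lo_sub_pos hk).le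
    (lo_sub_lt_one (S := S))).const_mul (S.N 0 (S.P S.k y))
  rw [mul_zero] at hlim
  obtain ⟨n, hn⟩ := (hlim.eventually_lt_const (half_pos hρ.1)).exists
  obtain ⟨x₁, -, hx₁⟩ := H_preimage hρ ((hdecay n).trans hn.le)
  obtain ⟨u, hu⟩ := exists_unst (S := S) (y - S.P S.k y)
  have hPu : S.P S.k u = 0 := by
    rw [← P_unst, hu, map_sub, S.P_comp, min_self, sub_self]
  refine ⟨S.leaf S.k u (S.p S.k x₁), ?_⟩
  set x := S.leaf S.k u (S.p S.k x₁) with hx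
  have hq : S.q S.k x = u := S.leaf_eq hk (S.leaf_slow hk u _).symm (by rw [hPu, map_zero])
  have hp : S.p S.k x = S.p S.k x₁ :=
    S.leaf_eq hk (p_slow hk x₁) (S.P_leaf hk u (S.p S.k x₁)).symm
  rw [H_eq, hq, hp, hu, ← P_H, hx₁, S.P_comp, min_self, add_sub_cancel]

theorem leaf_lower (x x' : E) :
    S.N 0 (x' - x) ≤ 2 * S.N 0 (S.P S.k (x' - x)) +
      (1 + 8 * S.L * S.N 0 (S.P S.k (S.q S.k x - x)) / S.δ) *
        S.N 0 (S.q S.k x' - S.q S.k x) := by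
  have hk := S.k_le
  have hL := S.L_nonneg
  have hδ := S.δ_pos
  have hlo := S.lo_nonneg hk
  have hlor := S.lo_nonneg le_rfl
  set u := S.q S.k x
  set u' := S.q S.k x'
  have hs := q_slow hk x
  have hs' := q_slow hk x'
  set t : ℕ → E := fun j => S.Φ j x' - S.Φ j x - (S.Φ j u' - S.Φ j u) with ht
  set c := 2 * S.N 0 (S.P S.k (u - x)) with hc
  have hc0 : 0 ≤ c := mul_nonneg zero_le_two (S.N_nonneg _ _)
  have hD0 : 0 ≤ S.N 0 (u' - u) := S.N_nonneg _ _
  obtain ⟨C, hC⟩ := hs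
  obtain ⟨C', hC'⟩ := hs'
  have hxu : ∀ j, S.N j (S.Φ j u - S.Φ j x) ≤ c * S.lo S.k ^ j := fun j => by
    have := (Slow.bound hk ⟨C, hC⟩ 0).2 j
    rwa [Φ_zero, Φ_zero, zero_add] at this
  have hstep : ∀ i, S.N (0 + i + 1) (t (i + 1) - t i) ≤
      S.η * S.N (0 + i) (t i) + S.L * c * S.N 0 (u' - u) * S.hi S.k ^ i := fun i => by
    rw [zero_add]
    have e : t (i + 1) - t i = S.f i (S.Φ i x') - S.f i (S.Φ i x) -
        (S.f i (S.Φ i u') - S.f i (S.Φ i u)) := by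
      simp only [ht, ← Φ_step]; abel
    rw [e]
    refine (S.f_double i _ _ _ _).trans (add_le_add le_rfl ?_)
    rw [map_sub_rev]
    have h1 := S.growth_upper_iter 0 i u u'
    rw [Φ_zero, Φ_zero, zero_add] at h1
    calc S.L * S.N i (S.Φ i u - S.Φ i x) * S.N i (S.Φ i u' - S.Φ i u)
        ≤ S.L * (c * S.lo S.k ^ i) * (S.lo S.r ^ i * S.N 0 (u' - u)) := by
          gcongr
          · exact hxu i
      _ = S.L * c * S.N 0 (u' - u) * (S.lo S.k * S.lo S.r) ^ i := by rw [mul_pow]; ring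
      _ ≤ _ := by
          have := S.lo_mul
          gcongr
  have hb := (S.forward_bound hk (γ := S.hi S.k) (by linarith [S.lo_lt_hi _ hk]) (by linarith)
    (t := t) (n := 0) (σ := S.L * c * S.N 0 (u' - u)) (C := C + C') (μ := S.lo S.k - S.δ)
    (by positivity) (S.lo_sub_pos hk).le (by linarith [S.lo_lt_hi _ hk]) (fun i => by
      rw [zero_add]
      have e : t i = (S.Φ i u - S.Φ i x) - (S.Φ i u' - S.Φ i x') := by simp only [ht]; abel
      rw [e]
      refine (S.N_sub _ _ _).trans ?_
      linarith [hC i, hC' i]) hstep).2 0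
  have e0 : t 0 = (x' - x) - (u' - u) := rfl
  rw [pow_zero, mul_one, e0, map_sub (S.P S.k) (x' - x), map_sub (S.P S.k) u', P_q hk, P_q hk,
    sub_zero, sub_zero] at hb
  have h1 := S.N_add 0 ((x' - x) - (u' - u)) (u' - u)
  rw [sub_add_cancel] at h1
  have e1 : (1 + 8 * S.L * S.N 0 (S.P S.k (u - x)) / S.δ) * S.N 0 (u' - u) =
      S.N 0 (u' - u) + 4 * (S.L * c * S.N 0 (u' - u)) / S.δ := by
    rw [hc]; ring
  rw [e1]
  simp only [zero_add] at hb
  linarith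

/-- The conjugacy as a bijection. -/
def He (S : Sys E) : E ≃ E := Equiv.ofBijective S.H ⟨H_injective, H_surjective⟩

theorem He_symm_contDiff : ContDiff ℝ 1 S.He.symm := by
  refine contDiff_symm_of_lower_lipschitz _ H_contDiff fun x => ?_
  obtain ⟨ρ, hρ⟩ := S.exists_radius
  have hk := S.k_le
  obtain ⟨n, hn⟩ := ((p_slow hk x).eventually_small hρ.1).exists
  obtain ⟨C₀, hC₀, h₀⟩ := exists_seminorm_le_norm (S.N 0)
  obtain ⟨C₀', hC₀', h₀'⟩ := exists_norm_le_seminorm (S.N 0) (S.pos 0)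
  obtain ⟨Cn, hCn, h_n⟩ := exists_seminorm_le_norm (S.N n)
  have hhi := pow_pos (S.hi_nonneg (Nat.zero_le S.r)) n
  have hL := S.L_nonneg
  have hδ := S.δ_pos
  set A := 1 + 8 * S.L * S.N 0 (S.P S.k (S.q S.k x - x)) / S.δ with hA
  have hA0 : 0 ≤ A := by
    have := S.N_nonneg 0 (S.P S.k (S.q S.k x - x))
    positivity
  refine ⟨C₀' * (2 * (2 * Cn / S.hi 0 ^ n) + A * (2 * C₀)), ?_⟩
  have hc : Continuous fun y => S.N n (S.Φ n (S.p S.k y)) :=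
    (seminorm_continuous _).comp ((S.Φ_contDiff n).continuous.comp (p_contDiff hk).continuous)
  filter_upwards [hc.continuousAt.eventually_lt_const hn] with x' hx'
  change ‖x' - x‖ ≤ _ * ‖S.H x' - S.H x‖
  have h1 := H_lower hρ hn.le hx'.le
  rw [H_of_slow (p_slow hk x), H_of_slow (p_slow hk x'), ← P_H, ← P_H, ← map_sub] at h1
  have h2 := (S.growth_lower_iter 0 n (S.p S.k x) (S.p S.k x'))
  rw [zero_add, Φ_zero, Φ_zero] at h2
  have h3 : S.N 0 (S.P S.k (x' - x)) ≤ 2 * Cn / S.hi 0 ^ n * ‖S.H x' - S.H x‖ := by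
    rw [map_sub, ← P_p hk x, ← P_p hk x', ← map_sub, div_mul_eq_mul_div, le_div_iff₀ hhi]
    have := S.N_P S.k 0 (S.p S.k x' - S.p S.k x)
    have := mul_le_mul_of_nonneg_left this hhi.le
    have := S.N_P S.k n (S.H x' - S.H x)
    linarith [h_n (S.H x' - S.H x)]
  have h4 : S.N 0 (S.q S.k x' - S.q S.k x) ≤ 2 * C₀ * ‖S.H x' - S.H x‖ := by
    have h5 := unst_lower (S := S) (S.q S.k x) (S.q S.k x')
    have e : S.unst (S.q S.k x') - S.unst (S.q S.k x) =
        (S.H x' - S.H x) - S.P S.k (S.H x' - S.H x) := by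
      rw [← H_sub_P_H, ← H_sub_P_H, map_sub]; abel
    rw [e] at h5
    linarith [S.N_Q S.k 0 (S.H x' - S.H x), h₀ (S.H x' - S.H x)]
  have h5 := leaf_lower (S := S) x x'
  rw [← hA] at h5
  have h6 := mul_le_mul_of_nonneg_left h4 hA0
  have h7 := h₀' (x' - x)
  rw [mul_assoc C₀']
  refine h7.trans (mul_le_mul_of_nonneg_left ?_ hC₀'.le)
  linarith

variable (S) in
/-- Existence of the linearization for systems in normalized form. -/
theorem exists_linearization : ∃ h : ℕ → (E ≃ E),
    (∀ n, ContDiff ℝ 1 (h n) ∧ ContDiff ℝ 1 (h n).symm) ∧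
    (∀ n x, h (n + 1) (x + S.f n x) = h n x) ∧
    ∃ ρ, 0 < ρ ∧ ∀ n x, S.N n x ≤ ρ → ∀ v,
      S.N n (fderiv ℝ (h n) x v) ≤ 2 * S.N n v ∧
      S.N n (fderiv ℝ (h n).symm x v) ≤ 2 * S.N n v := by
  obtain ⟨ρ, hρ⟩ := S.exists_radius
  have hρ0 := hρ.1
  have hΦ : ∀ n z, S.Φ n ((S.Φe n).symm z) = z := fun n => (S.Φe n).apply_symm_apply
  have hcd : ∀ n, ContDiff ℝ 1 ((S.Φe n).symm.trans S.He) ∧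
      ContDiff ℝ 1 ((S.Φe n).symm.trans S.He).symm := fun n =>
    ⟨H_contDiff.comp (S.Φe_symm_contDiff n), (S.Φ_contDiff n).comp He_symm_contDiff⟩
  refine ⟨fun n => (S.Φe n).symm.trans S.He, hcd, fun n x => ?_, ρ / 4, by positivity,
    fun n x hx v => ⟨?_, ?_⟩⟩
  · change S.He ((S.Φe (n + 1)).symm _) = S.He ((S.Φe n).symm x)
    congr 1
    rw [Equiv.symm_apply_eq, Φe_apply, Φ_succ, hΦ]
  · refine seminorm_fderiv_le _ _ (((hcd n).1.differentiable one_ne_zero x).hasFDerivAt) ?_ v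
    have hx' : S.N n x < ρ := by linarith
    filter_upwards [(seminorm_continuous (S.N n)).continuousAt.eventually_lt_const hx'] with y hy
    have := H_upper hρ (n := n) (x := (S.Φe n).symm x) (x' := (S.Φe n).symm y)
      (by rw [hΦ]; exact hx'.le) (by rw [hΦ]; exact hy.le)
    rwa [hΦ, hΦ] at this
  · refine seminorm_fderiv_le _ _ (((hcd n).2.differentiable one_ne_zero x).hasFDerivAt) ?_ v
    have hx' : S.N n x < ρ / 2 := by linarith
    filter_upwards [(seminorm_continuous (S.N n)).continuousAt.eventually_lt_const hx'] with y hy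
    obtain ⟨z, hz, rfl⟩ := H_preimage hρ hx'.le
    obtain ⟨z', hz', rfl⟩ := H_preimage hρ hy.le
    have e : ∀ z, ((S.Φe n).symm.trans S.He).symm (S.H z) = S.Φ n z := fun z => by
      rw [Equiv.symm_apply_eq]
      change S.H z = S.H ((S.Φe n).symm (S.Φe n z))
      rw [Equiv.symm_apply_apply]
    rw [e, e]
    exact H_lower hρ hz hz'

end FD
end Sys

section Dich

/-- A projection with dichotomy rates separated by `τ`, for a trivial cocycle measured in the
moving seminorms `ν n`. -/
def Dich (ν : ℕ → Seminorm ℝ E) (τ : ℝ) (P : E →L[ℝ] E) : Prop :=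
  (∀ x, P (P x) = P x) ∧ ∃ K θ : ℝ, 0 < K ∧ 1 < θ ∧ ∀ n i x,
    ν (n + i) (P x) ≤ K * (τ / θ) ^ i * ν n x ∧
      (τ * θ) ^ i * ν n (x - P x) ≤ K * ν (n + i) x

/-- Vectors growing at most like `τ ^ m`. -/
def slowSpace (ν : ℕ → Seminorm ℝ E) (τ : ℝ) : Submodule ℝ E where
  carrier := {x | ∃ C, ∀ m, ν m x ≤ C * τ ^ m}
  zero_mem' := ⟨0, fun m => by simp⟩
  add_mem' := by
    rintro x y ⟨C, hC⟩ ⟨C', hC'⟩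
    refine ⟨C + C', fun m => (map_add_le_add _ _ _).trans ?_⟩
    linarith [hC m, hC' m]
  smul_mem' := by
    rintro c x ⟨C, hC⟩
    refine ⟨‖c‖ * C, fun m => ?_⟩
    rw [map_smul_eq_mul, mul_assoc]
    exact mul_le_mul_of_nonneg_left (hC m) (norm_nonneg _)

variable {ν : ℕ → Seminorm ℝ E}

theorem slowSpace_mono {τ τ' : ℝ} (hτ : 0 ≤ τ) (h : τ ≤ τ') :
    slowSpace ν τ ≤ slowSpace ν τ' := by
  rintro x ⟨C, hC⟩
  have hC0 : 0 ≤ C := by have := (apply_nonneg (ν 0) x).trans (hC 0); simpa using this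
  refine ⟨C, fun m => (hC m).trans ?_⟩
  gcongr

theorem eq_zero_of_le_pow {p K q : ℝ} (hp : 0 ≤ p) (hq : 0 ≤ q) (hq1 : q < 1)
    (h : ∀ m : ℕ, p ≤ K * q ^ m) : p = 0 := by
  have h1 := (tendsto_pow_atTop_nhds_zero_of_lt_one hq hq1).const_mul K
  rw [mul_zero] at h1
  exact le_antisymm (ge_of_tendsto' h1 h) hp

theorem Dich.mem_slowSpace_iff (hν : ∀ x, ν 0 x = 0 → x = 0) {τ : ℝ} (hτ : 0 < τ)
    {P : E →L[ℝ] E} (h : Dich ν τ P) :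
    ∃ θ : ℝ, 1 < θ ∧ ∀ τ', τ / θ < τ' → τ' < τ * θ → ∀ x, x ∈ slowSpace ν τ' ↔ P x = x := by
  obtain ⟨-, K, θ, hK, hθ, h⟩ := h
  have hθ0 : 0 < θ := by linarith
  refine ⟨θ, hθ, fun τ' h1 h2 x => ⟨?_, fun hx => ?_⟩⟩
  · rintro ⟨C, hC⟩
    have hτ' : 0 < τ' := (div_pos hτ hθ0).trans h1
    have h3 : ν 0 (x - P x) = 0 := by
      refine eq_zero_of_le_pow (K := K * C) (q := τ' / (τ * θ)) (apply_nonneg _ _) (by positivity)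
        ((div_lt_one (by positivity)).2 h2) fun m => ?_
      have h4 := (h 0 m x).2
      rw [zero_add] at h4
      rw [div_pow, mul_div_assoc', le_div_iff₀ (by positivity)]
      have h5 := mul_le_mul_of_nonneg_left (hC m) hK.le
      linarith
    exact (sub_eq_zero.1 (hν _ h3)).symm
  · refine ⟨K * ν 0 x, fun m => ?_⟩
    have h4 := (h 0 m x).1
    rw [zero_add, hx] at h4
    refine h4.trans ?_
    have : (τ / θ) ^ m ≤ τ' ^ m := by gcongr
    have h5 := mul_le_mul_of_nonneg_left this (mul_nonneg hK.le (apply_nonneg (ν 0) x))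
    linarith

theorem slowSpace_eqOn (hν : ∀ x, ν 0 x = 0 → x = 0) {J : Set ℝ} (hJ : J.OrdConnected)
    (h : ∀ τ ∈ J, 0 < τ ∧ ∃ P, Dich ν τ P) {τ τ' : ℝ} (hτ : τ ∈ J) (hτ' : τ' ∈ J) :
    slowSpace ν τ = slowSpace ν τ' := by
  refine hJ.isPreconnected.induction₂ (fun a b => slowSpace ν a = slowSpace ν b)
    (fun a ha => ?_) (fun _ _ _ _ _ _ h h' => h.trans h') (fun _ _ _ _ h => h.symm) hτ hτ'
  obtain ⟨ha0, P, hP⟩ := h a ha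
  obtain ⟨θ, hθ, hθ'⟩ := hP.mem_slowSpace_iff hν ha0
  have h1 : a / θ < a := div_lt_self ha0 hθ
  have h2 : a < a * θ := lt_mul_of_one_lt_right ha0 hθ
  filter_upwards [mem_nhdsWithin_of_mem_nhds (Ioo_mem_nhds h1 h2)] with b hb
  ext x
  rw [hθ' a h1 h2, hθ' b hb.1 hb.2]

theorem Dich.congr_range [FiniteDimensional ℝ E] (hν : ∀ x, ν 0 x = 0 → x = 0) {τ : ℝ}
    (hτ : 0 < τ) {P P' : E →L[ℝ] E} (h : Dich ν τ P) (h1 : ∀ x, P (P' x) = P' x)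
    (h2 : ∀ x, P' (P x) = P x) : Dich ν τ P' := by
  obtain ⟨hP, K, θ, hK, hθ, h⟩ := h
  have hθ0 : 0 < θ := by linarith
  obtain ⟨C₁, hC₁, hC₁'⟩ := exists_seminorm_le_norm ((ν 0).comp P'.toLinearMap)
  obtain ⟨C₂, hC₂, hC₂'⟩ := exists_norm_le_seminorm (ν 0) hν
  have hb : ∀ x, ν 0 (P' x) ≤ C₁ * C₂ * ν 0 x := fun x => (hC₁' x).trans (by
    rw [mul_assoc]; exact mul_le_mul_of_nonneg_left (hC₂' x) hC₁.le)
  set D := K * (C₁ * C₂) * K with hD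
  have hD0 : 0 < D := by positivity
  have hQ : ∀ n x, ν n (P' (x - P x)) ≤ D * ν n (x - P x) := fun n x => by
    set y := x - P x with hy
    have hPy : P y = 0 := by rw [hy, map_sub, hP, sub_self]
    have a1 := (h 0 n (P' y)).1
    rw [h1, zero_add] at a1
    have a2 := (h 0 n y).2
    rw [hPy, sub_zero, zero_add] at a2
    have a3 : (τ / θ) ^ n ≤ (τ * θ) ^ n := by
      have : τ / θ ≤ τ * θ := (div_le_self hτ.le hθ.le).trans (le_mul_of_one_le_right hτ.le hθ.le)
      gcongr
    calc ν n (P' y) ≤ K * (τ / θ) ^ n * ν 0 (P' y) := a1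
      _ ≤ K * (τ * θ) ^ n * (C₁ * C₂ * ν 0 y) := by
          gcongr
          exact hb y
      _ = K * (C₁ * C₂) * ((τ * θ) ^ n * ν 0 y) := by ring
      _ ≤ K * (C₁ * C₂) * (K * ν n y) := by gcongr
      _ = D * ν n y := by rw [hD]; ring
  have hQ0 : ∀ n x, ν n (x - P x) ≤ K * ν n x := fun n x => by
    have := (h n 0 x).2
    rwa [pow_zero, one_mul, add_zero] at this
  have hP0 : ∀ n x, ν n (P x) ≤ K * ν n x := fun n x => by
    have := (h n 0 x).1
    rwa [pow_zero, mul_one, add_zero] at this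
  have hP'0 : ∀ n x, ν n (P' x) ≤ (K + D * K) * ν n x := fun n x => by
    have e : P' x = P x + P' (x - P x) := by rw [map_sub, h2]; abel
    have h3 := map_add_le_add (ν n) (P x) (P' (x - P x))
    rw [← e] at h3
    have := mul_le_mul_of_nonneg_left (hQ0 n x) hD0.le
    linarith [hP0 n x, hQ n x]
  refine ⟨fun x => by rw [← h1 x, h2], K * (K + D * K) + (K + D * K), θ, by positivity, hθ,
    fun n i x => ⟨?_, ?_⟩⟩
  · have a1 := (h n i (P' x)).1
    rw [h1] at a1
    have hx := apply_nonneg (ν n) x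
    calc ν (n + i) (P' x) ≤ K * (τ / θ) ^ i * ν n (P' x) := a1
      _ ≤ K * (τ / θ) ^ i * ((K + D * K) * ν n x) := by
          gcongr
          exact hP'0 n x
      _ = K * (K + D * K) * ((τ / θ) ^ i * ν n x) := by ring
      _ ≤ (K * (K + D * K) + (K + D * K)) * ((τ / θ) ^ i * ν n x) := by
          gcongr
          linarith [mul_pos hD0 hK]
      _ = _ := by ring
  · have e : x - P' x = (x - P x) - P' (x - P x) := by rw [map_sub P', h2]; abel
    have hx := apply_nonneg (ν (n + i)) x
    have a1 : ν n (x - P' x) ≤ (1 + D) * ν n (x - P x) := by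
      rw [e]
      refine (map_sub_le_add _ _ _).trans ?_
      linarith [hQ n x]
    calc (τ * θ) ^ i * ν n (x - P' x) ≤ (τ * θ) ^ i * ((1 + D) * ν n (x - P x)) := by gcongr
      _ = (1 + D) * ((τ * θ) ^ i * ν n (x - P x)) := by ring
      _ ≤ (1 + D) * (K * ν (n + i) x) := mul_le_mul_of_nonneg_left (h n i x).2 (by positivity)
      _ = (K + D * K) * ν (n + i) x := by ring
      _ ≤ _ := mul_le_mul_of_nonneg_right
          (by linarith [mul_pos hK (add_pos hK (mul_pos hD0 hK))]) hx

/-- Adapted (Lyapunov) seminorms, realizing the growth rates in one step. -/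
theorem exists_adapted (μ : ℕ → Seminorm ℝ E) {K a b : ℝ} (ha : 0 < a) (hab : a ≤ b)
    (h : ∀ n j x, μ (n + j) x ≤ K * b ^ j * μ n x ∧ a ^ j * μ n x ≤ K * μ (n + j) x) :
    ∃ s : ℕ → Seminorm ℝ E, ∀ n x, μ n x ≤ s n x ∧ s n x ≤ K * μ n x ∧
      a * s n x ≤ s (n + 1) x ∧ s (n + 1) x ≤ b * s n x := by
  have hb : 0 < b := ha.trans_le hab
  let w : ℕ → ℕ → ℝ := fun m n => (b⁻¹) ^ (m - n) * a ^ (n - m)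
  have hw : ∀ m n, 0 < w m n := fun m n => by positivity
  have hws : ∀ m n, a * w m n ≤ w m (n + 1) ∧ w m (n + 1) ≤ b * w m n := fun m n => by
    rcases Nat.lt_or_ge n m with hmn | hmn
    · obtain ⟨j, rfl⟩ := Nat.exists_eq_add_of_lt hmn
      have e1 : w (n + j + 1) n = b⁻¹ ^ (j + 1) := by
        simp only [w]
        rw [show n + j + 1 - n = j + 1 by omega, show n - (n + j + 1) = 0 by omega, pow_zero,
          mul_one]
      have e2 : w (n + j + 1) (n + 1) = b⁻¹ ^ j := by
        simp only [w]
        rw [show n + j + 1 - (n + 1) = j by omega, show n + 1 - (n + j + 1) = 0 by omega,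
          pow_zero, mul_one]
      have e3 : b * w (n + j + 1) n = w (n + j + 1) (n + 1) := by
        rw [e1, e2, pow_succ]; field_simp
      exact ⟨e3 ▸ mul_le_mul_of_nonneg_right hab (hw _ _).le, e3.ge⟩
    · have e3 : w m (n + 1) = a * w m n := by
        simp only [w]
        rw [show m - (n + 1) = 0 by omega, show m - n = 0 by omega,
          show n + 1 - m = n - m + 1 by omega, pow_succ]
        ring
      exact ⟨e3.ge, e3 ▸ mul_le_mul_of_nonneg_right hab (hw _ _).le⟩
  have hbound : ∀ n m x, w m n * μ m x ≤ K * μ n x := fun n m x => by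
    rcases Nat.le_total n m with hmn | hmn
    · obtain ⟨j, rfl⟩ := Nat.exists_eq_add_of_le hmn
      have e1 : w (n + j) n = b⁻¹ ^ j := by
        simp only [w]
        rw [show n + j - n = j by omega, show n - (n + j) = 0 by omega, pow_zero, mul_one]
      rw [e1, inv_pow, inv_mul_le_iff₀ (by positivity)]
      linarith [(h n j x).1]
    · obtain ⟨j, rfl⟩ := Nat.exists_eq_add_of_le hmn
      have e1 : w m (m + j) = a ^ j := by
        simp only [w]
        rw [show m + j - m = j by omega, show m - (m + j) = 0 by omega, pow_zero, one_mul]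
      rw [e1]
      exact (h m j x).2
  let p : ℕ → ℕ → Seminorm ℝ E := fun n m => (w m n).toNNReal • μ m
  have hp : ∀ n m x, p n m x = w m n * μ m x := fun n m x => by
    simp only [p, _root_.smul_apply, NNReal.smul_def, Real.coe_toNNReal _ (hw m n).le,
      smul_eq_mul]
  have hbdd : ∀ n x, BddAbove (range fun m => p n m x) := fun n x =>
    ⟨K * μ n x, by rintro _ ⟨m, rfl⟩; exact (hp n m x).le.trans (hbound n m x)⟩
  have hs : ∀ n x, (⨆ m, p n m) x = ⨆ m, p n m x := fun n x =>
    Seminorm.iSup_apply (Seminorm.bddAbove_range_iff.2 (hbdd n))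
  have hle : ∀ n m x, w m n * μ m x ≤ (⨆ m, p n m) x := fun n m x => by
    rw [hs, ← hp]
    exact le_ciSup (hbdd n x) m
  have hge : ∀ n x C, (∀ m, w m n * μ m x ≤ C) → (⨆ m, p n m) x ≤ C := fun n x C hC => by
    rw [hs]
    exact ciSup_le fun m => (hp n m x).le.trans (hC m)
  refine ⟨fun n => ⨆ m, p n m, fun n x => ⟨?_, hge n x _ fun m => hbound n m x, ?_, ?_⟩⟩
  · have := hle n n x
    simpa [w] using this
  · rw [← le_div_iff₀' ha]
    refine hge n x _ fun m => ?_
    rw [le_div_iff₀' ha, ← mul_assoc]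
    exact (mul_le_mul_of_nonneg_right (hws m n).1 (apply_nonneg _ _)).trans (hle (n + 1) m x)
  · refine hge (n + 1) x _ fun m => ?_
    have h1 := mul_le_mul_of_nonneg_right (hws m n).2 (apply_nonneg (μ m) x)
    have h2 := mul_le_mul_of_nonneg_left (hle n m x) hb.le
    linarith

end Dich

section Cocycle
variable {B : ℕ → (E ≃L[ℝ] E)} {N : ℕ → E → ℝ}

theorem fwd_succ (A : ℕ → (E ≃L[ℝ] E)) (n j : ℕ) (x : E) :
    fwd A n (j + 1) x = A (n + j) (fwd A n j x) := rfl

theorem fwd_add (A : ℕ → (E ≃L[ℝ] E)) (n i j : ℕ) (x : E) :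
    fwd A n (i + j) x = fwd A (n + i) j (fwd A n i x) := by
  induction j with
  | zero => rfl
  | succ j ih => rw [← add_assoc, fwd_succ, ih, fwd_succ, add_assoc]

theorem coc_add (A : ℕ → (E ≃L[ℝ] E)) (n i : ℕ) : coc A (n + i) n = fwd A n i := by
  simp [coc]

theorem coc_add_symm (A : ℕ → (E ≃L[ℝ] E)) (n i : ℕ) : coc A n (n + i) = (fwd A n i).symm := by
  rcases Nat.eq_zero_or_pos i with rfl | hi
  · simp only [coc, add_zero, le_refl, if_true, Nat.sub_self]
    rfl
  · simp [coc, hi.ne']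

theorem fwd_scale {τ : ℝ} (hτ : 0 < τ) (m : ℕ) (x : E) :
    fwd (fun n => scale τ⁻¹ (B n)) 0 m x = (τ⁻¹) ^ m • fwd B 0 m x := by
  induction m with
  | zero => simp [fwd]
  | succ m ih =>
    rw [fwd_succ, ih, fwd_succ]
    have hτ' : τ⁻¹ ≠ 0 := inv_ne_zero hτ.ne'
    change smulCLE τ⁻¹ (B (0 + m) _) = _
    rw [smulCLE, dif_neg hτ', map_smul, pow_succ', mul_smul]
    rfl

theorem fwd_proj {A : ℕ → (E ≃L[ℝ] E)} {P : ℕ → (E →L[ℝ] E)}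
    (h : ∀ n, ((A n : E →L[ℝ] E)).comp (P n) = (P (n + 1)).comp (A n : E →L[ℝ] E)) (n : ℕ) (x : E) :
    fwd A 0 n (P 0 x) = P n (fwd A 0 n x) := by
  induction n with
  | zero => rfl
  | succ n ih =>
    rw [fwd_succ, fwd_succ, ih, zero_add]
    exact DFunLike.congr_fun (h n) (fwd A 0 n x)

/-- The norms pulled back to time `0` along the cocycle. -/
def pull (B : ℕ → (E ≃L[ℝ] E)) (hN : ∀ n, IsNormOn (N n)) (n : ℕ) : Seminorm ℝ E :=
  Seminorm.of (fun x => N n (fwd B 0 n x))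
    (fun x y => by rw [map_add]; exact (hN n).2.2.2 _ _)
    (fun a x => by rw [map_smul]; exact (hN n).2.2.1 _ _)

theorem pull_apply (hN : ∀ n, IsNormOn (N n)) (n : ℕ) (x : E) :
    pull B hN n x = N n (fwd B 0 n x) := rfl

theorem eq_zero_of_pull (hN : ∀ n, IsNormOn (N n)) (n : ℕ) (x : E) (h : pull B hN n x = 0) :
    x = 0 := by
  rw [pull_apply, (hN n).2.1] at h
  simpa using h

theorem pull_growth (hN : ∀ n, IsNormOn (N n)) (h : StrongExpDichotomyWRT B N) :
    ∃ K a : ℝ, 0 < K ∧ 1 < a ∧ ∀ n i x,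
      pull B hN (n + i) x ≤ K * a ^ i * pull B hN n x ∧
        pull B hN n x ≤ K * a ^ i * pull B hN (n + i) x := by
  obtain ⟨P, K, lam, a, hK, hlam, hla, -, -, h⟩ := h
  refine ⟨K, Real.exp a, hK, Real.one_lt_exp_iff.2 (hlam.trans_le hla), fun n i x => ?_⟩
  have e : Real.exp (a * (((n + i : ℕ) : ℝ) - n)) = Real.exp a ^ i := by
    rw [← Real.exp_nat_mul]; congr 1; push_cast; ring
  have h1 := (h (n + i) n (Nat.le_add_right _ _) (fwd B 0 n x)).2.2.1
  have h2 := (h (n + i) n (Nat.le_add_right _ _) (fwd B 0 (n + i) x)).2.2.2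
  have e2 : fwd B 0 (n + i) x = fwd B n i (fwd B 0 n x) := by rw [fwd_add, zero_add]
  rw [e, coc_add, ← e2] at h1
  rw [e, coc_add_symm] at h2
  rw [pull_apply, pull_apply]
  refine ⟨h1, ?_⟩
  rwa [e2, ContinuousLinearEquiv.symm_apply_apply, ← e2] at h2

theorem exists_dich_pull (hN : ∀ n, IsNormOn (N n)) {τ : ℝ} (hτ : 0 < τ) (h : τ ∉ SigmaED B N) :
    ∃ P, Dich (pull B hN) τ P := by
  have h0 : StrongExpDichotomyWRT (fun n => scale τ⁻¹ (B n)) N := by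
    by_contra h'
    exact h ⟨hτ, h'⟩
  obtain ⟨P, K, lam, a, hK, hlam, -, hP, hinv, h⟩ := h0
  set A := fun n => scale τ⁻¹ (B n) with hA
  have hnorm : ∀ m x, N m (fwd A 0 m x) = (τ ^ m)⁻¹ * pull B hN m x := fun m x => by
    rw [hA, fwd_scale hτ, (hN m).2.2.1, pull_apply, abs_of_pos (by positivity), inv_pow]
  have hPP : ∀ x, P 0 (P 0 x) = P 0 x := fun x => DFunLike.congr_fun (hP 0) x
  refine ⟨P 0, hPP, K, Real.exp lam, hK, Real.one_lt_exp_iff.2 hlam, fun n i x => ?_⟩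
  have e : Real.exp (-lam * (((n + i : ℕ) : ℝ) - n)) = (Real.exp lam ^ i)⁻¹ := by
    rw [← Real.exp_nat_mul, ← Real.exp_neg]; congr 1; push_cast; ring
  have e2 : ∀ x, fwd A 0 (n + i) x = fwd A n i (fwd A 0 n x) := fun x => by
    rw [fwd_add, zero_add]
  have h1 := (h (n + i) n (Nat.le_add_right _ _) (fwd A 0 n x)).1
  have h2 := (h (n + i) n (Nat.le_add_right _ _) (fwd A 0 (n + i) x)).2.1
  rw [e, coc_add, ← fwd_proj hinv, ← e2, hnorm, hnorm] at h1
  rw [e, coc_add_symm, ← fwd_proj hinv, ← map_sub, hnorm, e2,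
    ContinuousLinearEquiv.symm_apply_apply, hnorm] at h2
  have hθ := Real.exp_pos lam
  have hτn : 0 < τ ^ n := by positivity
  have hτi : 0 < τ ^ i := by positivity
  have hθi : 0 < Real.exp lam ^ i := by positivity
  rw [pow_add] at h1 h2
  constructor
  · have := mul_le_mul_of_nonneg_left h1 (mul_pos hτn hτi).le
    rw [div_pow]
    calc _ = τ ^ n * τ ^ i * ((τ ^ n * τ ^ i)⁻¹ * pull B hN (n + i) (P 0 x)) := by field_simp
      _ ≤ _ := this
      _ = _ := by field_simp
  · have := mul_le_mul_of_nonneg_left h2 (mul_pos (mul_pos hτn hτi) hθi).le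
    rw [mul_pow]
    calc _ = τ ^ n * τ ^ i * Real.exp lam ^ i * ((τ ^ n)⁻¹ * pull B hN n (x - P 0 x)) := by
          field_simp
      _ ≤ _ := this
      _ = _ := by field_simp

end Cocycle

section Filtration
variable {F : Type*} [NormedAddCommGroup F] [InnerProductSpace ℝ F] [FiniteDimensional ℝ F]

/-- The spectral gap with index `g`: the rates above the bands `i < g` and below the bands
`i ≥ g`. -/
def spectralGap (r : ℕ) (α β : ℕ → ℝ) (g : ℕ) : Set ℝ :=
  {τ | 0 < τ ∧ (∀ i < g, β i < τ) ∧ ∀ i, g ≤ i → i < r → τ < α i}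

theorem ordConnected_spectralGap (r : ℕ) (α β : ℕ → ℝ) (g : ℕ) :
    (spectralGap r α β g).OrdConnected :=
  ⟨fun _ hx _ hy _ hz => ⟨hx.1.trans_le hz.1, fun i hi => (hx.2.1 i hi).trans_le hz.1,
    fun i hi hi' => hz.2.trans_lt (hy.2.2 i hi hi')⟩⟩

section Bands
variable {r : ℕ} {α β : ℕ → ℝ}

theorem band_lt_band (hαβ : ∀ i < r, α i ≤ β i) (hβα : ∀ i, i + 1 < r → β i < α (i + 1)) {i j : ℕ}
    (hij : i < j) (hj : j < r) : β i < α j := by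
  induction j, hij using Nat.le_induction with
  | base => exact hβα i hj
  | succ j hij ih =>
    exact (ih (by omega)).trans ((hαβ j (by omega)).trans_lt (hβα j hj))

theorem lower_band_mono (hαβ : ∀ i < r, α i ≤ β i) (hβα : ∀ i, i + 1 < r → β i < α (i + 1))
    {i j : ℕ} (hij : i ≤ j) (hj : j < r) : α i ≤ α j := by
  rcases hij.eq_or_lt with rfl | hij
  · exact le_rfl
  · exact (hαβ i (hij.trans hj)).trans (band_lt_band hαβ hβα hij hj).le

theorem upper_band_mono (hαβ : ∀ i < r, α i ≤ β i) (hβα : ∀ i, i + 1 < r → β i < α (i + 1))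
    {i j : ℕ} (hij : i ≤ j) (hj : j < r) : β i ≤ β j := by
  rcases hij.eq_or_lt with rfl | hij
  · exact le_rfl
  · exact (band_lt_band hαβ hβα hij hj).le.trans (hαβ j hj)

theorem exists_mem_spectralGap (hα : ∀ i < r, 0 < α i) (hαβ : ∀ i < r, α i ≤ β i)
    (hβα : ∀ i, i + 1 < r → β i < α (i + 1)) {g : ℕ} (hg : g ≤ r) :
    ∃ τ, τ ∈ spectralGap r α β g := by
  rcases hg.eq_or_lt with rfl | hg
  · have h : ∀ᶠ τ : ℝ in atTop, 0 < τ ∧ ∀ i ∈ Finset.range g, β i < τ :=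
      (eventually_gt_atTop 0).and ((Finset.eventually_all _).2 fun i _ => eventually_gt_atTop _)
    obtain ⟨τ, h0, h1⟩ := h.exists
    exact ⟨τ, h0, fun i hi => h1 i (Finset.mem_range.2 hi), fun i hi hi' => by omega⟩
  have hαg : ∀ i, g ≤ i → i < r → α g ≤ α i := fun i => lower_band_mono hαβ hβα
  rcases Nat.eq_zero_or_pos g with rfl | hg0
  · exact ⟨α 0 / 2, by linarith [hα 0 hg], fun i hi => by omega,
      fun i hi hir => by linarith [hα 0 hg, hαg i hi hir]⟩
  · have hb : 0 < β (g - 1) := (hα _ (by omega)).trans_le (hαβ _ (by omega))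
    have hgap := band_lt_band hαβ hβα (show g - 1 < g by omega) hg
    refine ⟨(β (g - 1) + α g) / 2, by linarith [hα g hg], fun i hi => ?_,
      fun i hi hir => by linarith [hαg i hi hir]⟩
    have : β i ≤ β (g - 1) := upper_band_mono hαβ hβα (Nat.le_sub_one_of_lt hi) (by omega)
    linarith

end Bands

/-- The spectral filtration of a trivial cocycle with gaps in its dichotomy spectrum, realized by
commuting projections. -/
theorem exists_filtration {ν : ℕ → Seminorm ℝ F} (hν : ∀ x, ν 0 x = 0 → x = 0) {K a : ℝ}
    (hK : 0 < K) (ha : 1 < a)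
    (growth : ∀ n i x, ν (n + i) x ≤ K * a ^ i * ν n x ∧ ν n x ≤ K * a ^ i * ν (n + i) x)
    {r : ℕ} {α β : ℕ → ℝ} (hα : ∀ i < r, 0 < α i) (hαβ : ∀ i < r, α i ≤ β i)
    (hβα : ∀ i, i + 1 < r → β i < α (i + 1))
    (h : ∀ τ, 0 < τ → (∀ i < r, τ < α i ∨ β i < τ) → ∃ P, Dich ν τ P) :
    ∃ P : ℕ → F →L[ℝ] F, P 0 = 0 ∧ (∀ x, P r x = x) ∧ (∀ i j x, P i (P j x) = P (min i j) x) ∧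
      ∀ g ≤ r, ∀ τ ∈ spectralGap r α β g, Dich ν τ (P g) := by
  have hdich : ∀ g, ∀ τ ∈ spectralGap r α β g, 0 < τ ∧ ∃ P, Dich ν τ P := fun g τ hτ =>
    ⟨hτ.1, h τ hτ.1 fun i hi => (lt_or_ge i g).elim (fun hig => Or.inr (hτ.2.1 i hig))
      fun hig => Or.inl (hτ.2.2 i hig hi)⟩
  have hex : ∀ g, ∃ τ, τ ∈ spectralGap r α β (min g r) := fun g =>
    exists_mem_spectralGap hα hαβ hβα (min_le_right g r)
  choose σ hσ using hex
  have hσ' : ∀ g ≤ r, σ g ∈ spectralGap r α β g := fun g hg => by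
    have := hσ g
    rwa [min_eq_left hg] at this
  let V : ℕ → Submodule ℝ F := fun g => slowSpace ν (σ (min g r))
  have hV : ∀ g ≤ r, ∀ τ ∈ spectralGap r α β g, V g = slowSpace ν τ := fun g hg τ hτ => by
    simp only [V, min_eq_left hg]
    exact slowSpace_eqOn hν (ordConnected_spectralGap r α β g) (hdich g) (hσ' g hg) hτ
  have hmono : Monotone V := by
    refine monotone_nat_of_le_succ fun g => ?_
    rcases Nat.lt_or_ge g r with hg | hg
    · simp only [V, min_eq_left hg.le, min_eq_left (show g + 1 ≤ r from hg)]
      have h1 := hσ' g hg.le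
      have h2 := hσ' (g + 1) hg
      exact slowSpace_mono h1.1.le (((h1.2.2 g le_rfl hg).le.trans (hαβ g hg)).trans
        (h2.2.1 g (Nat.lt_succ_self g)).le)
    · simp only [V, min_eq_right hg, min_eq_right (show r ≤ g + 1 by omega), le_refl]
  have ha0 : 0 < a := by linarith
  have hbot : V 0 = ⊥ := by
    have hτ := hσ' 0 (Nat.zero_le r)
    set τ := min (σ 0) ((2 * a)⁻¹) with hτdef
    have hτ0 : 0 < τ := lt_min hτ.1 (by positivity)
    have hτ' : τ ∈ spectralGap r α β 0 :=
      ⟨hτ0, fun i hi => by omega, fun i hi hir => (min_le_left _ _).trans_lt (hτ.2.2 i hi hir)⟩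
    rw [hV 0 (Nat.zero_le r) τ hτ', Submodule.eq_bot_iff]
    rintro x ⟨C, hC⟩
    refine hν x (eq_zero_of_le_pow (K := K * C) (q := a * τ) (apply_nonneg _ _) (by positivity)
      ?_ fun m => ?_)
    · have : a * τ ≤ a * (2 * a)⁻¹ := mul_le_mul_of_nonneg_left (min_le_right _ _) ha0.le
      have e : a * (2 * a)⁻¹ = 1 / 2 := by field_simp
      linarith
    · have h1 := (growth 0 m x).2
      rw [zero_add] at h1
      have h2 := mul_le_mul_of_nonneg_left (hC m) (by positivity : 0 ≤ K * a ^ m)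
      rw [mul_pow]
      linarith
  have htop : V r = ⊤ := by
    have hτ := hσ' r le_rfl
    have hτ' : max (σ r) a ∈ spectralGap r α β r :=
      ⟨hτ.1.trans_le (le_max_left _ _), fun i hi => (hτ.2.1 i hi).trans_le (le_max_left _ _),
        fun i hi hir => by omega⟩
    rw [hV r le_rfl _ hτ', Submodule.eq_top_iff']
    intro x
    refine ⟨K * ν 0 x, fun m => ?_⟩
    have h1 := (growth 0 m x).1
    rw [zero_add] at h1
    refine h1.trans ?_
    have h2 : a ^ m ≤ max (σ r) a ^ m := pow_le_pow_left₀ ha0.le (le_max_right _ _) m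
    have h3 := mul_le_mul_of_nonneg_left h2 (mul_nonneg hK.le (apply_nonneg (ν 0) x))
    linarith
  have hself : ∀ g x, (V g).starProjection x = x ↔ x ∈ V g := fun g x =>
    Submodule.starProjection_eq_self_iff
  refine ⟨fun g => (V g).starProjection, ?_, fun x => ?_, fun i j x => ?_, fun g hg τ hτ => ?_⟩
  · simp only [hbot, Submodule.starProjection_bot]
  · rw [hself, htop]
    trivial
  · rcases le_total i j with hij | hij
    · rw [min_eq_left hij]
      exact DFunLike.congr_fun (Submodule.starProjection_comp_starProjection_of_le (hmono hij)) x
    · rw [min_eq_right hij, hself]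
      exact hmono hij (Submodule.starProjection_apply_mem _ _)
  · obtain ⟨hτ0, P, hP⟩ := hdich g τ hτ
    obtain ⟨θ, hθ, hθ'⟩ := hP.mem_slowSpace_iff hν hτ0
    have hm := hθ' τ (div_lt_self hτ0 hθ) (lt_mul_of_one_lt_right hτ0 hθ)
    rw [← hV g hg τ hτ] at hm
    refine hP.congr_range hν hτ0 (fun x => (hm _).1 (Submodule.starProjection_apply_mem _ _))
      fun x => (hself g _).2 ((hm _).2 (hP.1 x))

end Filtration

section Lyapunov
variable {ν : ℕ → Seminorm ℝ E} {r : ℕ} {α β : ℕ → ℝ} {P : ℕ → E →L[ℝ] E}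

/-- Seminorms on a single spectral band that realize its growth rates in one step. -/
theorem exists_adapted_band (hα : ∀ i < r, 0 < α i) (hαβ : ∀ i < r, α i ≤ β i)
    (hβα : ∀ i, i + 1 < r → β i < α (i + 1))
    (P_comp : ∀ i j x, P i (P j x) = P (min i j) x)
    (hdich : ∀ g ≤ r, ∀ τ ∈ spectralGap r α β g, Dich ν τ (P g)) {c : ℝ} (hc : 1 < c) {i : ℕ}
    (hi : i < r) :
    ∃ K, 0 < K ∧ ∃ s : ℕ → Seminorm ℝ E, ∀ n x,
      ν n (P (i + 1) x - P i x) ≤ s n (P (i + 1) x - P i x) ∧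
      s n (P (i + 1) x - P i x) ≤ K * ν n x ∧
      α i / c * s n (P (i + 1) x - P i x) ≤ s (n + 1) (P (i + 1) x - P i x) ∧
      s (n + 1) (P (i + 1) x - P i x) ≤ β i * c * s n (P (i + 1) x - P i x) := by
  have hc0 : 0 < c := by linarith
  have hα0 := hα i hi
  have hβ0 : 0 < β i := hα0.trans_le (hαβ i hi)
  set Q : E →L[ℝ] E := P (i + 1) - P i with hQ
  have hQx : ∀ x, P (i + 1) x - P i x = Q x := fun x => rfl
  simp only [hQx]
  have hPQ : ∀ x, P (i + 1) (Q x) = Q x := fun x => by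
    rw [← hQx, map_sub, P_comp, P_comp, min_self, min_eq_right (Nat.le_succ i)]
  have hPQ' : ∀ x, P i (Q x) = 0 := fun x => by
    rw [← hQx, map_sub, P_comp, P_comp, min_self, min_eq_left (Nat.le_succ i), sub_self]
  have hQQ : ∀ x, Q (Q x) = Q x := fun x => by rw [← hQx, hPQ, hPQ', sub_zero]
  obtain ⟨σ, hσ⟩ := exists_mem_spectralGap hα hαβ hβα (show i + 1 ≤ r from hi)
  obtain ⟨σ', hσ'⟩ := exists_mem_spectralGap hα hαβ hβα hi.le
  have hτ : min σ (β i * c) ∈ spectralGap r α β (i + 1) :=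
    ⟨lt_min hσ.1 (by positivity), fun l hl => lt_min (hσ.2.1 l hl)
      ((upper_band_mono hαβ hβα (Nat.le_of_lt_succ hl) hi).trans_lt
        (lt_mul_of_one_lt_right hβ0 hc)), fun l hl hlr => (min_le_left _ _).trans_lt (hσ.2.2 l hl hlr)⟩
  have hτ' : max σ' (α i / c) ∈ spectralGap r α β i :=
    ⟨hσ'.1.trans_le (le_max_left _ _), fun l hl => (hσ'.2.1 l hl).trans_le (le_max_left _ _),
      fun l hl hlr => max_lt (hσ'.2.2 l hl hlr)
        ((div_lt_self hα0 hc).trans_le (lower_band_mono hαβ hβα hl hlr))⟩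
  obtain ⟨-, K₁, θ₁, hK₁, hθ₁, h₁⟩ := hdich (i + 1) hi _ hτ
  obtain ⟨-, K₂, θ₂, hK₂, hθ₂, h₂⟩ := hdich i hi.le _ hτ'
  set τ := min σ (β i * c) with hτd
  set τ' := max σ' (α i / c) with hτd'
  have hup : ∀ n j x, ν (n + j) (Q x) ≤ K₁ * (β i * c) ^ j * ν n (Q x) := fun n j x => by
    have h3 := (h₁ n j (Q x)).1
    rw [hPQ] at h3
    refine h3.trans ?_
    have h4 : τ / θ₁ ≤ β i * c := (div_le_self hτ.1.le hθ₁.le).trans (min_le_right _ _)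
    have h5 : (τ / θ₁) ^ j ≤ (β i * c) ^ j :=
      pow_le_pow_left₀ (div_nonneg hτ.1.le (by linarith)) h4 j
    exact mul_le_mul_of_nonneg_right (mul_le_mul_of_nonneg_left h5 hK₁.le) (apply_nonneg _ _)
  have hlow : ∀ n j x, (α i / c) ^ j * ν n (Q x) ≤ K₂ * ν (n + j) (Q x) := fun n j x => by
    have h3 := (h₂ n j (Q x)).2
    rw [hPQ', sub_zero] at h3
    refine le_trans ?_ h3
    have h4 : α i / c ≤ τ' * θ₂ :=
      (le_max_right _ _).trans (le_mul_of_one_le_right hτ'.1.le hθ₂.le)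
    exact mul_le_mul_of_nonneg_right (pow_le_pow_left₀ (by positivity) h4 j) (apply_nonneg _ _)
  have hQn : ∀ n x, ν n (Q x) ≤ (K₁ + K₂ * K₁) * ν n x := fun n x => by
    have h3 := (h₁ n 0 x).1
    have e : Q x = P (i + 1) x - P i (P (i + 1) x) := by
      rw [P_comp, min_eq_left (Nat.le_succ i), hQx]
    have h4 := (h₂ n 0 (P (i + 1) x)).2
    rw [pow_zero, mul_one, add_zero] at h3
    rw [pow_zero, one_mul, add_zero, ← e] at h4
    have h5 := mul_le_mul_of_nonneg_left h3 hK₂.le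
    have h6 := mul_nonneg hK₁.le (apply_nonneg (ν n) x)
    linarith
  obtain ⟨s, hs⟩ := exists_adapted (fun n => (ν n).comp Q.toLinearMap) (K := K₁ + K₂)
    (a := α i / c) (b := β i * c) (by positivity)
    ((div_le_self hα0.le hc.le).trans ((hαβ i hi).trans (le_mul_of_one_le_right hβ0.le hc.le)))
    fun n j x => by
      have h3 := hup n j x
      have h4 := hlow n j x
      have h5 : 0 ≤ K₂ * (β i * c) ^ j * ν n (Q x) := by positivity
      have h6 : 0 ≤ K₁ * ν (n + j) (Q x) := by positivity
      exact ⟨by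
        change ν (n + j) (Q x) ≤ (K₁ + K₂) * (β i * c) ^ j * ν n (Q x)
        linarith, by
        change (α i / c) ^ j * ν n (Q x) ≤ (K₁ + K₂) * ν (n + j) (Q x)
        linarith⟩
  refine ⟨(K₁ + K₂) * (K₁ + K₂ * K₁), by positivity, s, fun n x => ?_⟩
  obtain ⟨s1, s2, s3, s4⟩ := hs n (Q x)
  have e : (ν n).comp Q.toLinearMap (Q x) = ν n (Q x) := congrArg (ν n) (hQQ x)
  rw [e] at s1 s2
  refine ⟨s1, s2.trans ?_, s3, s4⟩
  rw [mul_assoc]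
  exact mul_le_mul_of_nonneg_left (hQn n x) (by positivity)

/-- Norms, uniformly equivalent to `ν`, that realize all spectral rates in one step and for which
the spectral projections have norm at most one. -/
theorem exists_lyapunov (hα : ∀ i < r, 0 < α i) (hαβ : ∀ i < r, α i ≤ β i)
    (hβα : ∀ i, i + 1 < r → β i < α (i + 1))
    (P_zero : P 0 = 0) (P_r : ∀ x, P r x = x) (P_comp : ∀ i j x, P i (P j x) = P (min i j) x)
    (hdich : ∀ g ≤ r, ∀ τ ∈ spectralGap r α β g, Dich ν τ (P g)) {c : ℝ} (hc : 1 < c) :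
    ∃ C, 0 < C ∧ ∃ M : ℕ → Seminorm ℝ E,
      (∀ n x, ν n x ≤ M n x ∧ M n x ≤ C * ν n x) ∧
      (∀ g n x, M n (P g x) ≤ M n x ∧ M n (x - P g x) ≤ M n x) ∧
      (∀ g < r, ∀ n x, M (n + 1) (P (g + 1) x) ≤ β g * c * M n (P (g + 1) x)) ∧
      ∀ g < r, ∀ n x, α g / c * M n (x - P g x) ≤ M (n + 1) (x - P g x) := by
  have hc0 : 0 < c := by linarith
  have hex : ∀ i, ∃ K, 0 < K ∧ ∃ s : ℕ → Seminorm ℝ E, i < r → ∀ n x,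
      ν n (P (i + 1) x - P i x) ≤ s n (P (i + 1) x - P i x) ∧
      s n (P (i + 1) x - P i x) ≤ K * ν n x ∧
      α i / c * s n (P (i + 1) x - P i x) ≤ s (n + 1) (P (i + 1) x - P i x) ∧
      s (n + 1) (P (i + 1) x - P i x) ≤ β i * c * s n (P (i + 1) x - P i x) := fun i => by
    by_cases hi : i < r
    · obtain ⟨K, hK, s, hs⟩ := exists_adapted_band hα hαβ hβα P_comp hdich hc hi
      exact ⟨K, hK, s, fun _ => hs⟩
    · exact ⟨1, one_pos, fun _ => 0, fun h => absurd h hi⟩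
  choose K hK s hs using hex
  let M : ℕ → Seminorm ℝ E := fun n =>
    ∑ i ∈ Finset.range r, (s i n).comp ((P (i + 1)).toLinearMap - (P i).toLinearMap)
  have hM : ∀ n x, M n x = ∑ i ∈ Finset.range r, s i n (P (i + 1) x - P i x) := fun n x => by
    simp only [M, _root_.sum_apply]
    rfl
  have hlt : ∀ i g x, i < g → P (i + 1) (P g x) - P i (P g x) = P (i + 1) x - P i x :=
    fun i g x hig => by
      rw [P_comp, P_comp, min_eq_left (show i + 1 ≤ g from hig), min_eq_left hig.le]
  have hge : ∀ i g x, g ≤ i → P (i + 1) (P g x) - P i (P g x) = 0 := fun i g x hig => by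
    rw [P_comp, P_comp, min_eq_right hig, min_eq_right (hig.trans (Nat.le_succ i)), sub_self]
  have hlt' : ∀ i g x, i < g → P (i + 1) (x - P g x) - P i (x - P g x) = 0 :=
    fun i g x hig => by
      rw [map_sub, map_sub, sub_sub_sub_comm, hlt i g x hig, sub_self]
  have hge' : ∀ i g x, g ≤ i → P (i + 1) (x - P g x) - P i (x - P g x) = P (i + 1) x - P i x :=
    fun i g x hig => by
      rw [map_sub, map_sub, sub_sub_sub_comm, hge i g x hig, sub_zero]
  have hKs : 0 ≤ ∑ i ∈ Finset.range r, K i := Finset.sum_nonneg fun i _ => (hK i).le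
  refine ⟨∑ i ∈ Finset.range r, K i + 1, by positivity, M, fun n x => ⟨?_, ?_⟩, fun g n x => ⟨?_, ?_⟩,
    fun g hg n x => ?_, fun g hg n x => ?_⟩
  · have e : x = ∑ i ∈ Finset.range r, (P (i + 1) x - P i x) := by
      rw [Finset.sum_range_sub (fun i => P i x), P_r, P_zero]
      simp
    calc ν n x = ν n (∑ i ∈ Finset.range r, (P (i + 1) x - P i x)) := by rw [← e]
      _ ≤ ∑ i ∈ Finset.range r, ν n (P (i + 1) x - P i x) :=
        Finset.le_sum_of_subadditive (ν n) (map_zero (ν n)).le (map_add_le_add (ν n)) _ _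
      _ ≤ M n x := by
        rw [hM]
        exact Finset.sum_le_sum fun i hi => (hs i (Finset.mem_range.1 hi) n x).1
  · rw [hM, add_mul, Finset.sum_mul]
    have := Finset.sum_le_sum fun i (hi : i ∈ Finset.range r) =>
      (hs i (Finset.mem_range.1 hi) n x).2.1
    linarith [apply_nonneg (ν n) x]
  · rw [hM, hM]
    refine Finset.sum_le_sum fun i _ => ?_
    rcases Nat.lt_or_ge i g with hig | hig
    · rw [hlt i g x hig]
    · rw [hge i g x hig, map_zero]
      exact apply_nonneg _ _
  · rw [hM, hM]
    refine Finset.sum_le_sum fun i _ => ?_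
    rcases Nat.lt_or_ge i g with hig | hig
    · rw [hlt' i g x hig, map_zero]
      exact apply_nonneg _ _
    · rw [hge' i g x hig]
  · rw [hM, hM, Finset.mul_sum]
    refine Finset.sum_le_sum fun i hi => ?_
    rcases Nat.lt_or_ge i (g + 1) with hig | hig
    · refine (hs i (Finset.mem_range.1 hi) n (P (g + 1) x)).2.2.2.trans ?_
      have := upper_band_mono hαβ hβα (Nat.le_of_lt_succ hig) hg
      gcongr
    · simp [hge i (g + 1) x hig]
  · rw [hM, hM, Finset.mul_sum]
    refine Finset.sum_le_sum fun i hi => ?_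
    rcases Nat.lt_or_ge i g with hig | hig
    · rw [hlt' i g x hig, map_zero, map_zero, mul_zero]
    · refine le_trans ?_ (hs i (Finset.mem_range.1 hi) n (x - P g x)).2.2.1
      have := lower_band_mono hαβ hβα hig (Finset.mem_range.1 hi)
      gcongr

end Lyapunov

section Rates

theorem eventually_mul_pow_lt {X Y : ℝ} (h : X < Y) (m : ℕ) : ∀ᶠ c in 𝓝[>] (1 : ℝ), X * c ^ m < Y := by
  have h1 : Tendsto (fun c : ℝ => X * c ^ m) (𝓝 1) (𝓝 (X * 1 ^ m)) :=
    (continuous_const.mul (continuous_pow m)).tendsto 1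
  rw [one_pow, mul_one] at h1
  exact nhdsWithin_le_nhds (h1.eventually (gt_mem_nhds h))

theorem eventually_two_mul_lt {X : ℝ} (h : 0 < X) : ∀ᶠ δ in 𝓝[>] (0 : ℝ), 2 * δ < X := by
  have h1 : Tendsto (fun δ : ℝ => 2 * δ) (𝓝 0) (𝓝 (2 * 0)) :=
    (continuous_const.mul continuous_id).tendsto 0
  rw [mul_zero] at h1
  exact nhdsWithin_le_nhds (h1.eventually (gt_mem_nhds h))

/-- Rates with room to spare around the gaps of a spectrum satisfying the gap and band
conditions. -/
theorem exists_rates {r k : ℕ} {α β : ℕ → ℝ} (hk : 1 ≤ k) (hkr : k < r) (hα : ∀ i < r, 0 < α i)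
    (hαβ : ∀ i < r, α i ≤ β i) (hβα : ∀ i, i + 1 < r → β i < α (i + 1))
    (hbk : β (k - 1) < 1) (hak : 1 < α k) (hgap : β (k - 1) * β (r - 1) < α k)
    (hgap' : β (k - 1) < α k * α 0) (hs : ∀ i < k, β (k - 1) * β i < α i)
    (hu : ∀ i, k ≤ i → i < r → β i < α k * α i) :
    ∃ (c δ : ℝ) (lo hi : ℕ → ℝ), 1 < c ∧ 0 < δ ∧ (∀ g ≤ r, 2 * δ < lo g) ∧ (∀ g ≤ r, lo g < hi g) ∧
      (∀ g < r, β g * c ≤ lo (g + 1) - 2 * δ) ∧ (∀ g < r, hi g + 2 * δ ≤ α g / c) ∧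
      (∀ i < r, hi i ≤ lo (i + 1)) ∧ lo k ≤ 1 ∧ 1 ≤ hi k ∧ lo k * lo r ≤ hi k ∧
      lo k ≤ hi k * hi 0 ∧ (∀ i < k, lo k * lo (i + 1) ≤ hi i) ∧
      ∀ i, k ≤ i → i < r → lo (i + 1) ≤ hi k * hi i := by
  have hβ : ∀ i < r, 0 < β i := fun i hi => (hα i hi).trans_le (hαβ i hi)
  obtain ⟨c, hc, e1, e2, e3, e4, e5, e6, e7⟩ : ∃ c : ℝ, 1 < c ∧
      (∀ i ∈ Finset.range (r - 1), β i * c ^ 4 < α (i + 1)) ∧ β (k - 1) * c ^ 2 < 1 ∧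
      1 * c ^ 2 < α k ∧ β (k - 1) * β (r - 1) * c ^ 6 < α k ∧ β (k - 1) * c ^ 6 < α k * α 0 ∧
      (∀ i ∈ Finset.range k, β (k - 1) * β i * c ^ 6 < α i) ∧
      (∀ i ∈ Finset.Ico k r, β i * c ^ 6 < α k * α i) := by
    refine Eventually.exists (f := 𝓝[>] (1 : ℝ)) ?_
    refine (eventually_mem_nhdsWithin (a := (1 : ℝ)) (s := Ioi 1)).and ?_
    refine ((Finset.eventually_all _).2 fun i hi => ?_).and
      ((eventually_mul_pow_lt hbk 2).and ((eventually_mul_pow_lt hak 2).and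
      ((eventually_mul_pow_lt hgap 6).and ((eventually_mul_pow_lt hgap' 6).and
      (((Finset.eventually_all _).2 fun i hi => ?_).and
      ((Finset.eventually_all _).2 fun i hi => ?_))))))
    · exact eventually_mul_pow_lt (hβα i (by have := Finset.mem_range.1 hi; omega)) 4
    · exact eventually_mul_pow_lt (hs i (Finset.mem_range.1 hi)) 6
    · exact eventually_mul_pow_lt (hu i (Finset.mem_Ico.1 hi).1 (Finset.mem_Ico.1 hi).2) 6
  have hc0 : 0 < c := by linarith
  have hcc : c < c ^ 2 := by nlinarith
  have hc2 : 1 < c ^ 2 := hc.trans hcc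
  have hc1 : 0 < c ^ 2 := by positivity
  let lo : ℕ → ℝ := fun g => if g = 0 then α 0 / c ^ 2 / 2 else β (g - 1) * c ^ 2
  let hi : ℕ → ℝ := fun g => if g < r then α g / c ^ 2 else lo r + 1
  have hlo0 : lo 0 = α 0 / c ^ 2 / 2 := rfl
  have hlo : ∀ g, lo (g + 1) = β g * c ^ 2 := fun g => rfl
  have hlok : lo k = β (k - 1) * c ^ 2 := if_neg (by omega)
  have hlor : lo r = β (r - 1) * c ^ 2 := if_neg (by omega)
  have hhi : ∀ g < r, hi g = α g / c ^ 2 := fun g hg => if_pos hg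
  have hhir : hi r = lo r + 1 := if_neg (lt_irrefl r)
  have hα0 := hα 0 (by omega)
  have hlo_pos : ∀ g ≤ r, 0 < lo g := fun g hg => by
    rcases g with _ | g
    · rw [hlo0]; positivity
    · have := hβ g hg
      rw [hlo]; positivity
  obtain ⟨δ, hδ, d1, d2⟩ : ∃ δ : ℝ, 0 < δ ∧ (∀ g ∈ Finset.range (r + 1), 2 * δ < lo g) ∧
      (∀ g ∈ Finset.range r, 2 * δ < β g * (c ^ 2 - c) ∧ 2 * δ < α g / c - α g / c ^ 2) := by
    refine Eventually.exists (f := 𝓝[>] (0 : ℝ)) ?_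
    refine (eventually_mem_nhdsWithin (a := (0 : ℝ)) (s := Ioi 0)).and
      (((Finset.eventually_all _).2 fun g hg => ?_).and ((Finset.eventually_all _).2 fun g hg => ?_))
    · exact eventually_two_mul_lt (hlo_pos g (Nat.lt_succ_iff.1 (Finset.mem_range.1 hg)))
    · have hg := Finset.mem_range.1 hg
      have := hα g hg
      exact (eventually_two_mul_lt (mul_pos (hβ g hg) (sub_pos.2 hcc))).and
        (eventually_two_mul_lt (sub_pos.2 (div_lt_div_of_pos_left this hc0 hcc)))
  refine ⟨c, δ, lo, hi, hc, hδ, fun g hg => d1 g (Finset.mem_range.2 (Nat.lt_succ_of_le hg)),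
    fun g hg => ?_, fun g hg => ?_, fun g hg => ?_, fun i hi => ?_, ?_, ?_, ?_, ?_, fun i hi => ?_,
    fun i hi hir => ?_⟩
  · rcases hg.eq_or_lt with rfl | hg
    · rw [hhir]; linarith
    · rw [hhi g hg]
      rcases g with _ | g
      · rw [hlo0]
        have : 0 < α 0 / c ^ 2 := by positivity
        linarith
      · rw [hlo, lt_div_iff₀ hc1]
        have := e1 g (Finset.mem_range.2 (by omega))
        linarith
  · have := (d2 g (Finset.mem_range.2 hg)).1
    rw [hlo]
    linarith
  · have := (d2 g (Finset.mem_range.2 hg)).2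
    rw [hhi g hg]
    linarith
  · rw [hhi i hi, hlo]
    have h1 := hα i hi
    have h2 := hβ i hi
    exact (div_le_self h1.le hc2.le).trans ((hαβ i hi).trans (le_mul_of_one_le_right h2.le hc2.le))
  · rw [hlok]; exact e2.le
  · rw [hhi k hkr, le_div_iff₀ hc1]; exact e3.le
  · rw [hlok, hlor, hhi k hkr, le_div_iff₀ hc1]
    linarith
  · rw [hlok, hhi k hkr, hhi 0 (by omega), div_mul_div_comm, le_div_iff₀ (by positivity)]
    linarith
  · rw [hlok, hlo, hhi i (by omega), le_div_iff₀ hc1]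
    have := e6 i (Finset.mem_range.2 hi)
    linarith
  · rw [hlo, hhi k hkr, hhi i hir, div_mul_div_comm, le_div_iff₀ (by positivity)]
    have := e7 i (Finset.mem_Ico.2 ⟨hi, hir⟩)
    linarith

end Rates

section Conj

theorem fderiv_conj_apply {g : E → E} (hg : ContDiff ℝ 1 g) (A₁ A₂ : E ≃L[ℝ] E) (x v : E) :
    fderiv ℝ (fun z => A₂ (g (A₁ z))) x v = A₂ (fderiv ℝ g (A₁ x) (A₁ v)) := by
  have h1 : HasFDerivAt g (fderiv ℝ g (A₁ x)) (A₁ x) :=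
    (hg.differentiable one_ne_zero _).hasFDerivAt
  have h2 := A₂.hasFDerivAt.comp x (h1.comp x A₁.hasFDerivAt)
  have h3 : fderiv ℝ (fun z => A₂ (g (A₁ z))) x = _ := h2.fderiv
  rw [h3]
  rfl

theorem contDiff_conj {g : E → E} (hg : ContDiff ℝ 1 g) (A₁ A₂ : E ≃L[ℝ] E) :
    ContDiff ℝ 1 fun z => A₂ (g (A₁ z)) :=
  A₂.contDiff.comp (hg.comp A₁.contDiff)

end Conj

/-- Theorem: `C¹` linearization under exponential dichotomy. -/
theorem c1_linearization_expDichotomy {d : ℕ}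
    (B : ℕ → (EuclideanSpace ℝ (Fin d) ≃L[ℝ] EuclideanSpace ℝ (Fin d)))
    (N : ℕ → EuclideanSpace ℝ (Fin d) → ℝ)
    (hN : ∀ n : ℕ, IsNormOn (N n))
    (hdich : StrongExpDichotomyWRT B N)
    (r k : ℕ) (aa bb : ℕ → ℝ)
    (hk : 1 ≤ k) (hkr : k < r)
    (hab : ∀ i : ℕ, 1 ≤ i → i ≤ r → 0 < aa i ∧ aa i ≤ bb i)
    (hord : ∀ i : ℕ, 1 ≤ i → i < r → bb i < aa (i + 1))
    (hbk : bb k < 1) (hak : 1 < aa (k + 1))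
    (hgap : max (bb r) (aa 1)⁻¹ < aa (k + 1) / bb k)
    (hband₁ : ∀ i : ℕ, 1 ≤ i → i ≤ k → bb i / aa i < (bb k)⁻¹)
    (hband₂ : ∀ j : ℕ, k + 1 ≤ j → j ≤ r → bb j / aa j < aa (k + 1))
    (hspec : SigmaED B N = ⋃ i ∈ Finset.Icc 1 r, Set.Icc (aa i) (bb i))
    (L : ℝ) (hL : 0 < L) :
    ∃ η₀ : ℝ, 0 < η₀ ∧
      ∀ η : ℝ, 0 < η → η ≤ η₀ →
        ∀ f : ℕ → EuclideanSpace ℝ (Fin d) → EuclideanSpace ℝ (Fin d),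
          (∀ n : ℕ, ContDiff ℝ 1 (f n)) →
          (∀ n : ℕ, f n 0 = 0) →
          (∀ n : ℕ, fderiv ℝ (f n) 0 = 0) →
          (∀ (n : ℕ) (x v : EuclideanSpace ℝ (Fin d)),
            N (n + 1) (fderiv ℝ (f n) x v) ≤ η * N n v) →
          (∀ (n : ℕ) (x y v : EuclideanSpace ℝ (Fin d)),
            N (n + 1) ((fderiv ℝ (f n) x - fderiv ℝ (f n) y) v) ≤ L * N n (x - y) * N n v) →
          ∃ h : ℕ → (EuclideanSpace ℝ (Fin d) ≃ EuclideanSpace ℝ (Fin d)),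
            (∀ n : ℕ, ContDiff ℝ 1 (h n) ∧ ContDiff ℝ 1 (h n).symm) ∧
            (∀ (n : ℕ) (x : EuclideanSpace ℝ (Fin d)),
              h (n + 1) (B n x + f n x) = B n (h n x)) ∧
            ∃ M ρ : ℝ, 0 < M ∧ 0 < ρ ∧
              ∀ (n : ℕ) (x : EuclideanSpace ℝ (Fin d)), N n x ≤ ρ →
                ∀ v : EuclideanSpace ℝ (Fin d),
                  N n (fderiv ℝ (h n) x v) ≤ M * N n v ∧
                  N n (fderiv ℝ (h n).symm x v) ≤ M * N n v := by
  set α : ℕ → ℝ := fun i => aa (i + 1) with hαd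
  set β : ℕ → ℝ := fun i => bb (i + 1) with hβd
  have hα : ∀ i < r, 0 < α i := fun i hi => (hab (i + 1) (by omega) (by omega)).1
  have hαβ : ∀ i < r, α i ≤ β i := fun i hi => (hab (i + 1) (by omega) (by omega)).2
  have hβα : ∀ i, i + 1 < r → β i < α (i + 1) := fun i hi => hord (i + 1) (by omega) hi
  have hβ : ∀ i < r, 0 < β i := fun i hi => (hα i hi).trans_le (hαβ i hi)
  have ek : β (k - 1) = bb k := by simp only [hβd, Nat.sub_add_cancel hk]
  have er : β (r - 1) = bb r := by simp only [hβd, Nat.sub_add_cancel (show 1 ≤ r by omega)]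
  have hbk0 : 0 < bb k := ek ▸ hβ (k - 1) (by omega)
  obtain ⟨hgap₁, hgap₂⟩ := max_lt_iff.1 hgap
  obtain ⟨c, δ, lo, hi, hc, hδ, lo_pos, lo_lt_hi, rP, rQ, hi_le_lo, lo_k, hi_k, lo_mul, lo_le_mul,
    band_stable, band_unstable⟩ := exists_rates hk hkr hα hαβ hβα (by rwa [ek]) hak
    (by rw [ek, er, mul_comm]; exact (lt_div_iff₀ hbk0).1 hgap₁)
    (by
      have h1 := (lt_div_iff₀ hbk0).1 hgap₂
      rw [inv_mul_lt_iff₀ (hα 0 (by omega))] at h1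
      rw [ek, mul_comm]
      exact h1)
    (fun i hi => by
      have h1 := hband₁ (i + 1) (by omega) (by omega)
      rw [div_lt_iff₀ (hα i (by omega)), lt_inv_mul_iff₀ hbk0] at h1
      rw [ek]
      exact h1)
    (fun i hi hir => (div_lt_iff₀ (hα i hir)).1 (hband₂ (i + 1) (by omega) (by omega)))
  obtain ⟨K, a, hK, ha, growth⟩ := pull_growth hN hdich
  obtain ⟨P, P_zero, P_r, P_comp, hP⟩ := exists_filtration (eq_zero_of_pull hN 0) hK ha growth hα hαβ
    hβα fun τ hτ hτ' => exists_dich_pull hN hτ (by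
      rw [hspec]
      simp only [mem_iUnion, Finset.mem_Icc, not_exists]
      rintro i ⟨hi1, hir⟩ hi
      obtain ⟨i, rfl⟩ : ∃ j, i = j + 1 := ⟨i - 1, by omega⟩
      rcases hτ' i (by omega) with h | h
      · exact absurd hi.1 (not_le.2 h)
      · exact absurd hi.2 (not_le.2 h))
  obtain ⟨C, hC, M, hM, hMP, hMup, hMlow⟩ :=
    exists_lyapunov hα hαβ hβα P_zero P_r P_comp hP hc
  refine ⟨δ / (4000 * ((r : ℝ) + 1) * C), by positivity, fun η hη hη₀ f hf hf0 hdf0 hdf hdfL => ?_⟩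
  set A := fun n => fwd B 0 n with hA
  have hAs : ∀ n x, A (n + 1) x = B n (A n x) := fun n x => by
    simp only [hA, fwd_succ, zero_add]
  have hpull : ∀ n x, pull B hN n x = N n (A n x) := fun n x => rfl
  have hpull' : ∀ n x, pull B hN n ((A n).symm x) = N n x := fun n x => by
    rw [hpull, ContinuousLinearEquiv.apply_symm_apply]
  let S : Sys (EuclideanSpace ℝ (Fin d)) :=
    { N := M
      pos := fun n x hx => eq_zero_of_pull hN n x
        (le_antisymm (hx ▸ (hM n x).1) (apply_nonneg _ _))
      f := fun n x => (A (n + 1)).symm (f n (A n x))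
      contDiff_f := fun n => contDiff_conj (hf n) _ _
      f_zero := fun n => by rw [map_zero, hf0, map_zero]
      fderiv_zero := fun n => by
        ext1 v
        rw [fderiv_conj_apply (hf n), map_zero, hdf0]
        simp
      η := C * η
      L := C * L
      δ := δ
      η_nonneg := by positivity
      L_nonneg := by positivity
      δ_pos := hδ
      fderiv_le := fun n x v => by
        rw [fderiv_conj_apply (hf n)]
        refine (hM _ _).2.trans ?_
        rw [hpull', mul_assoc]
        refine mul_le_mul_of_nonneg_left ((hdf n _ _).trans ?_) hC.le
        exact mul_le_mul_of_nonneg_left (hM n v).1 hη.le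
      fderiv_sub_le := fun n x y v => by
        rw [fderiv_conj_apply (hf n), fderiv_conj_apply (hf n), ← map_sub]
        refine (hM _ _).2.trans ?_
        rw [hpull', mul_assoc, mul_assoc]
        refine mul_le_mul_of_nonneg_left ((hdfL n _ _ _).trans ?_) hC.le
        rw [← map_sub, ← hpull, ← hpull, mul_assoc]
        exact mul_le_mul_of_nonneg_left (mul_le_mul (hM n _).1 (hM n v).1 (apply_nonneg _ _)
          (apply_nonneg _ _)) hL.le
      r := r
      k := k
      k_le := hkr.le
      P := P
      P_zero := P_zero
      P_r := P_r
      P_comp := P_comp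
      N_P := fun i n x => (hMP i n x).1
      N_Q := fun i n x => (hMP i n x).2
      lo := lo
      hi := hi
      lo_pos := lo_pos
      lo_lt_hi := lo_lt_hi
      rate_P := fun g hg n x => by
        rcases g with _ | g
        · simp [P_zero]
        · exact (hMup g hg n x).trans
            (mul_le_mul_of_nonneg_right (rP g hg) (apply_nonneg _ _))
      rate_Q := fun g hg n x => by
        rcases hg.eq_or_lt with rfl | hg
        · simp [P_r]
        · exact (mul_le_mul_of_nonneg_right (rQ g hg) (apply_nonneg _ _)).trans (hMlow g hg n x)
      hi_le_lo := hi_le_lo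
      lo_k := lo_k
      hi_k := hi_k
      lo_mul := lo_mul
      lo_le_mul := lo_le_mul
      band_stable := band_stable
      band_unstable := band_unstable
      small := by
        rw [le_div_iff₀ (by positivity)] at hη₀
        linarith }
  obtain ⟨H, hH, hconj, ρ, hρ, hbound⟩ := S.exists_linearization
  refine ⟨fun n => (A n).symm.toEquiv.trans ((H n).trans (A n).toEquiv), fun n =>
    ⟨contDiff_conj (hH n).1 (A n).symm (A n), contDiff_conj (hH n).2 (A n).symm (A n)⟩,
    fun n x => ?_, 2 * C, ρ / C, by positivity, by positivity, fun n x hx v => ?_⟩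
  · change A (n + 1) (H (n + 1) ((A (n + 1)).symm (B n x + f n x))) = B n (A n (H n ((A n).symm x)))
    have e : (A (n + 1)).symm (B n x + f n x) = (A n).symm x + S.f n ((A n).symm x) := by
      rw [ContinuousLinearEquiv.symm_apply_eq, map_add, hAs]
      simp only [S, ContinuousLinearEquiv.apply_symm_apply]
    rw [e, hconj, hAs]
  · have hx' : M n ((A n).symm x) ≤ ρ := by
      refine (hM _ _).2.trans ?_
      rw [hpull', mul_comm]
      exact (le_div_iff₀ hC).1 hx
    have hb := hbound n _ hx' ((A n).symm v)
    have hlast : 2 * M n ((A n).symm v) ≤ 2 * C * N n v := by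
      have := (hM n ((A n).symm v)).2
      rw [hpull'] at this
      linarith
    constructor
    · change N n (fderiv ℝ (fun z => A n (H n ((A n).symm z))) x v) ≤ _
      rw [fderiv_conj_apply (hH n).1, ← hpull]
      exact (hM n _).1.trans (hb.1.trans hlast)
    · change N n (fderiv ℝ (fun z => A n ((H n).symm ((A n).symm z))) x v) ≤ _
      rw [fderiv_conj_apply (hH n).2, ← hpull]
      exact (hM n _).1.trans (hb.2.trans hlast)

end NonautLin
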